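/- arXiv:1908.09661 — 5 statements merged into one kernel-verified Lean document; each statement's English description precedes it below -/
import Mathlib

section
/- Let n ≥ 1 and let u be a single unipotent Jordan block of size 2n acting on a 2n-dimensional K-vector space V. Then every Jordan block size of ∧²u on ∧²(V) occurs with odd multiplicity. -/
open Module LinearMap

noncomputable section

/-- Multiplicity of a Jordan block of size `d` of a unipotent map `u`, computed from
`f = u - 1` as `rank f^(d-1) - 2 rank f^d + rank f^(d+1)`. -/
def jordanMult (K : Type*) [Field K] {V : Type*} [AddCommGroup V] [Module K V]
    (f : V →ₗ[K] V) (d : ℕ) : ℕ :=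
  Module.finrank K (LinearMap.range (f ^ (d - 1))) +
    Module.finrank K (LinearMap.range (f ^ (d + 1))) -
    2 * Module.finrank K (LinearMap.range (f ^ d))

open Classical in
/-- The invariant ε_{V,b}(d) of Hesselink/Spaltenstein, computed from `f = u - 1`. -/
def eps (K : Type*) [Field K] {V : Type*} [AddCommGroup V] [Module K V]
    (f : V →ₗ[K] V) (b : V →ₗ[K] V →ₗ[K] K) (d : ℕ) : ℕ :=
  if ∃ v : V, (f ^ d) v = 0 ∧ b ((f ^ (d - 1)) v) v ≠ 0 then 1 else 0

/-- A linear endomorphism is unipotent if `(f - 1)^N = 0` for some `N`. -/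
def IsUnipotent (K : Type*) [Field K] {V : Type*} [AddCommGroup V] [Module K V]
    (f : V →ₗ[K] V) : Prop :=
  ∃ N : ℕ, (f - 1) ^ N = 0

/-- The standard single unipotent Jordan block of size `m` over `K`. -/
def jordanBlockMap (K : Type*) [Field K] (m : ℕ) : (Fin m → K) →ₗ[K] (Fin m → K) :=
  Matrix.toLin' (1 + Matrix.of fun i j : Fin m => if (i : ℕ) + 1 = (j : ℕ) then 1 else 0)

end
/-- `(E, wedge)` is a model of the exterior square `∧²V` of `V`: `wedge` is an alternating
bilinear map whose image spans `E`, and `E` has the dimension `C(dim V, 2)` of the exterior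
square. This characterizes `∧²V` together with its canonical map up to isomorphism. -/
def IsExteriorSquare (K : Type*) [Field K] {V E : Type*} [AddCommGroup V] [Module K V]
    [AddCommGroup E] [Module K E] (wedge : V →ₗ[K] V →ₗ[K] E) : Prop :=
  (∀ v, wedge v v = 0) ∧
  Submodule.span K {x | ∃ v w, wedge v w = x} = ⊤ ∧
  Module.finrank K E = Nat.choose (Module.finrank K V) 2


/-- Upper bound for the rank of a power of `Z` from a spanning family. -/
theorem extsq_rank_bound {K E : Type*} [Field K] [AddCommGroup E] [Module K E]
    [FiniteDimensional K E] (Z : Module.End K E) (y : ℕ → E) (s : ℕ) (b : ℕ → ℕ) (a : ℕ)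
    (R Q : Submodule K E)
    (htop : ∀ N : Submodule K E, (∀ j < s, ∀ i, (Z ^ i) (y j) ∈ N) → R ≤ N → N = ⊤)
    (hQ : ∀ x ∈ Q, Z x ∈ Q) (hb : ∀ j < s, (Z ^ (b j)) (y j) ∈ Q)
    (hR : ∀ x ∈ R, (Z ^ a) x ∈ Q) :
    finrank K (LinearMap.range (Z ^ a)) ≤ (∑ j ∈ Finset.range s, (b j - a)) + finrank K Q := by
  classical
  have hQi : ∀ i, ∀ x ∈ Q, (Z ^ i) x ∈ Q := by
    intro i
    induction i with
    | zero => intro x hx; simpa using hx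
    | succ i ih => intro x hx; rw [pow_succ]; exact ih _ (hQ x hx)
  let F : Finset E := ((Finset.range s).sigma (fun j => Finset.Ico a (b j))).image
    (fun t : (_ : ℕ) × ℕ => (Z ^ t.2) (y t.1))
  have hF : finrank K (Submodule.span K (F : Set E)) ≤ ∑ j ∈ Finset.range s, (b j - a) := by
    refine (finrank_span_finset_le_card F).trans (Finset.card_image_le.trans ?_)
    simp [Finset.card_sigma]
  have hle : LinearMap.range (Z ^ a) ≤ Submodule.span K (F : Set E) ⊔ Q := by
    have h := htop (Submodule.comap (Z ^ a) (Submodule.span K (F : Set E) ⊔ Q)) ?_ ?_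
    · rintro _ ⟨x, rfl⟩
      have : x ∈ Submodule.comap (Z ^ a) (Submodule.span K (F : Set E) ⊔ Q) := by
        rw [h]; trivial
      exact this
    · intro j hj i
      rw [Submodule.mem_comap, ← Module.End.mul_apply, ← pow_add]
      by_cases hlt : a + i < b j
      · refine Submodule.mem_sup_left (Submodule.subset_span ?_)
        simp only [F, Finset.coe_image, Set.mem_image]
        refine ⟨⟨j, a + i⟩, ?_, rfl⟩
        simp [hj, hlt]
      · refine Submodule.mem_sup_right ?_
        obtain ⟨c, hc⟩ := Nat.exists_eq_add_of_le (not_lt.1 hlt)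
        rw [hc, add_comm, pow_add, Module.End.mul_apply]
        exact hQi _ _ (hb j hj)
    · intro x hx
      exact Submodule.mem_sup_right (hR x hx)
  refine (Submodule.finrank_mono hle).trans ((Submodule.finrank_add_le_finrank_add_finrank _ _).trans ?_)
  omega

set_option linter.unusedSectionVars false

section
variable {K V E : Type*} [Field K] [CharP K 2] [AddCommGroup V] [Module K V]
  [AddCommGroup E] [Module K E] (w : V →ₗ[K] V →ₗ[K] E)

theorem extsq_two (K : Type*) {E : Type*} [Field K] [CharP K 2] [AddCommGroup E] [Module K E]
    (x : E) : x + x = 0 := by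
  have : (2 : K) = 0 := CharTwo.two_eq_zero
  rw [← two_smul K x, this, zero_smul]

theorem extsq_ext {F : Type*} [AddCommGroup F] [Module K F]
    (hs : Submodule.span K {x | ∃ a b, w a b = x} = ⊤) (f g : E →ₗ[K] F)
    (h : ∀ a b, f (w a b) = g (w a b)) : f = g := by
  refine LinearMap.ext_on hs ?_
  rintro _ ⟨a, b, rfl⟩
  exact h a b

theorem extsq_Zpow (X : Module.End K V) (Z : Module.End K E)
    (hZ : ∀ a b, Z (w a b) = w (X a) b + w a (X b) + w (X a) (X b)) (t : ℕ) (a b : V) :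
    (Z ^ 2 ^ t) (w a b) = w ((X ^ 2 ^ t) a) b + w a ((X ^ 2 ^ t) b)
      + w ((X ^ 2 ^ t) a) ((X ^ 2 ^ t) b) := by
  induction t generalizing a b with
  | zero => simpa using hZ a b
  | succ t ih =>
    rw [pow_succ 2 t, mul_two, pow_add, pow_add, Module.End.mul_apply, ih, map_add, map_add,
      ih, ih, ih]
    simp only [Module.End.mul_apply]
    set P := X ^ 2 ^ t
    have h1 := extsq_two K (w (P a) (P b))
    have h2 := extsq_two K (w (P (P a)) (P b))
    have h3 := extsq_two K (w (P a) (P (P b)))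
    have : ∀ A B C D G H : E, D + D = 0 → G + G = 0 → H + H = 0 →
      A + D + G + (D + B + H) + (G + H + C) = A + B + C := by
      intro A B C D G H h1 h2 h3
      calc _ = A + B + C + (D + D) + (G + G) + (H + H) := by abel
        _ = _ := by rw [h1, h2, h3]; simp
    exact this _ _ _ _ _ _ h1 h2 h3

theorem extsq_Tpow (X : Module.End K V) (T : Module.End K E)
    (hT : ∀ a b, T (w a b) = w (X a) (X b)) (t : ℕ) (a b : V) :
    (T ^ t) (w a b) = w ((X ^ t) a) ((X ^ t) b) := by
  induction t generalizing a b with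
  | zero => simp
  | succ t ih => simp only [pow_succ, Module.End.mul_apply, hT, ih]

theorem extsq_comm (X : Module.End K V) (Z T : Module.End K E)
    (hs : Submodule.span K {x | ∃ a b, w a b = x} = ⊤)
    (hZ : ∀ a b, Z (w a b) = w (X a) b + w a (X b) + w (X a) (X b))
    (hT : ∀ a b, T (w a b) = w (X a) (X b)) : Commute Z T := by
  refine extsq_ext w hs (Z * T) (T * Z) ?_
  intro a b
  simp only [Module.End.mul_apply, hT, hZ, map_add]

/-- The element `v ∧ X v` generates. -/
theorem extsq_gen (X : Module.End K V) (Z T : Module.End K E) (v : V)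
    (halt : ∀ a, w a a = 0)
    (hs : Submodule.span K {x | ∃ a b, w a b = x} = ⊤)
    (hZ : ∀ a b, Z (w a b) = w (X a) b + w a (X b) + w (X a) (X b))
    (hT : ∀ a b, T (w a b) = w (X a) (X b))
    (hv : Submodule.span K (Set.range fun i : ℕ => (X ^ i) v) = ⊤)
    (N : Submodule K E) (hNZ : ∀ x ∈ N, Z x ∈ N) (hNT : ∀ x ∈ N, T x ∈ N)
    (hg : w v (X v) ∈ N) : N = ⊤ := by
  have h1 : ∀ j, w v ((X ^ j) v) ∈ N ∧ w v ((X ^ (j + 1)) v) ∈ N := by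
    intro j
    induction j with
    | zero => simpa [halt] using hg
    | succ j ih =>
      refine ⟨ih.2, ?_⟩
      have e := hZ v ((X ^ (j + 1)) v)
      have e1 := hT v ((X ^ j) v)
      have e2 := hT v ((X ^ (j + 1)) v)
      have p1 : X ((X ^ j) v) = (X ^ (j + 1)) v := by rw [pow_succ']; rfl
      have p2 : X ((X ^ (j + 1)) v) = (X ^ (j + 1 + 1)) v := by rw [pow_succ' X (j + 1)]; rfl
      rw [p1] at e1
      rw [p2] at e e2
      have : w v ((X ^ (j + 1 + 1)) v) = Z (w v ((X ^ (j + 1)) v)) - T (w v ((X ^ j) v))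
          - T (w v ((X ^ (j + 1)) v)) := by
        rw [e, e1, e2]; abel
      rw [this]
      exact N.sub_mem (N.sub_mem (hNZ _ ih.2) (hNT _ ih.1)) (hNT _ ih.2)
  have hTi : ∀ i, ∀ x ∈ N, (T ^ i) x ∈ N := by
    intro i
    induction i with
    | zero => intro x hx; simpa using hx
    | succ i ih => intro x hx; rw [pow_succ]; exact ih _ (hNT x hx)
  have h2 : ∀ i j, w ((X ^ i) v) ((X ^ (i + j)) v) ∈ N := by
    intro i j
    have := hTi i _ (h1 j).1
    rw [extsq_Tpow w X T hT] at this
    rwa [pow_add]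
  have hanti : ∀ a b, w a b = - w b a := by
    intro a b
    have := halt (a + b)
    simp only [map_add, LinearMap.add_apply, halt] at this
    simp only [zero_add, add_zero] at this
    rw [add_comm] at this
    exact eq_neg_of_add_eq_zero_left this
  have h3 : ∀ i j, w ((X ^ i) v) ((X ^ j) v) ∈ N := by
    intro i j
    rcases le_total i j with h | h
    · obtain ⟨c, rfl⟩ := Nat.exists_eq_add_of_le h
      exact h2 i c
    · obtain ⟨c, rfl⟩ := Nat.exists_eq_add_of_le h
      rw [hanti]
      exact N.neg_mem (h2 j c)
  have h4 : ∀ i b, w ((X ^ i) v) b ∈ N := by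
    intro i b
    have hle : Submodule.span K (Set.range fun i : ℕ => (X ^ i) v) ≤ N.comap (w ((X ^ i) v)) := by
      rw [Submodule.span_le]
      rintro _ ⟨j, rfl⟩
      exact h3 i j
    rw [hv] at hle
    exact hle (x := b) trivial
  have h5 : ∀ a b, w a b ∈ N := by
    intro a b
    have hle : Submodule.span K (Set.range fun i : ℕ => (X ^ i) v) ≤ N.comap (w.flip b) := by
      rw [Submodule.span_le]
      rintro _ ⟨j, rfl⟩
      exact h4 j b
    rw [hv] at hle
    exact hle (x := a) trivial
  rw [eq_top_iff, ← hs, Submodule.span_le]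
  rintro _ ⟨a, b, rfl⟩
  exact h5 a b

/-- `(∑ T^i Z^(p-1-i)) (v ∧ Xv) = v ∧ X^p v`. -/
theorem extsq_geom (X : Module.End K V) (Z T : Module.End K E) (v : V)
    (halt : ∀ a, w a a = 0) (hc : Commute Z T)
    (hZ : ∀ a b, Z (w a b) = w (X a) b + w a (X b) + w (X a) (X b))
    (hT : ∀ a b, T (w a b) = w (X a) (X b)) (t : ℕ) :
    (∑ i ∈ Finset.range (2 ^ t), T ^ i * Z ^ (2 ^ t - 1 - i)) (w v (X v))
      = w v ((X ^ 2 ^ t) v) := by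
  induction t with
  | zero => simp
  | succ t ih =>
    have key : ∑ i ∈ Finset.range (2 ^ (t + 1)), T ^ i * Z ^ (2 ^ (t + 1) - 1 - i)
        = (Z ^ 2 ^ t + T ^ 2 ^ t) * ∑ i ∈ Finset.range (2 ^ t), T ^ i * Z ^ (2 ^ t - 1 - i) := by
      rw [pow_succ 2 t, mul_two, Finset.sum_range_add, add_mul, Finset.mul_sum, Finset.mul_sum]
      congr 1
      · refine Finset.sum_congr rfl fun i hi => ?_
        rw [Finset.mem_range] at hi
        rw [← mul_assoc, (hc.pow_pow _ _).eq, mul_assoc, ← pow_add]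
        congr 2; omega
      · refine Finset.sum_congr rfl fun i hi => ?_
        rw [← mul_assoc, ← pow_add]
        congr 2; omega
    rw [key, Module.End.mul_apply, ih, LinearMap.add_apply, extsq_Zpow w X Z hZ,
      extsq_Tpow w X T hT, halt, zero_add, add_assoc, extsq_two K, add_zero, pow_succ 2 t, mul_two,
      pow_add, Module.End.mul_apply]

/-- The adapted generating family. -/
theorem extsq_family (X : Module.End K V) (Z T : Module.End K E) (v : V)
    (halt : ∀ a, w a a = 0)
    (hs : Submodule.span K {x | ∃ a b, w a b = x} = ⊤)
    (hZ : ∀ a b, Z (w a b) = w (X a) b + w a (X b) + w (X a) (X b))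
    (hT : ∀ a b, T (w a b) = w (X a) (X b))
    (hv : Submodule.span K (Set.range fun i : ℕ => (X ^ i) v) = ⊤)
    (t s : ℕ) (hsp : s + 1 ≤ 2 ^ t) (hX : X ^ (2 ^ t + (s + 1)) = 0) :
    ∃ y : ℕ → E, (Z ^ (2 ^ (t + 1) - (s + 1))) (y s) = 0 ∧
      ∀ N : Submodule K E, (∀ j < s + 1, ∀ i, (Z ^ i) (y j) ∈ N) →
        LinearMap.range (T ^ (s + 1)) ≤ N → N = ⊤ := by
  have hc := extsq_comm w X Z T hs hZ hT
  set g := w v (X v) with hg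
  let D : Module.End K E := ∑ i ∈ Finset.range (s + 1), T ^ i * Z ^ (s + 1 - 1 - i)
  refine ⟨fun j => if j < s then (T ^ j) g else D g, ?_, ?_⟩
  · simp only [lt_irrefl, if_false]
    have hZT : ∀ i, s + 1 ≤ i → Z ^ 2 ^ t * T ^ i = 0 := by
      intro i hi
      refine extsq_ext w hs _ _ fun a b => ?_
      obtain ⟨c, rfl⟩ := Nat.exists_eq_add_of_le hi
      have hX' : ∀ a, (X ^ 2 ^ t) ((X ^ (s + 1 + c)) a) = 0 := by
        intro a
        rw [← Module.End.mul_apply, ← pow_add, ← add_assoc, pow_add, hX]; simp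
      simp [Module.End.mul_apply, extsq_Tpow w X T hT, extsq_Zpow w X Z hZ, hX']
    have e := extsq_geom w X Z T v halt hc hZ hT t
    have e2 : (Z ^ 2 ^ t) (w v ((X ^ 2 ^ t) v)) = 0 := by
      have : (X ^ 2 ^ t) ((X ^ 2 ^ t) v) = 0 := by
        rw [← Module.End.mul_apply, ← pow_add]
        obtain ⟨c, hc⟩ := Nat.exists_eq_add_of_le hsp
        rw [show 2 ^ t + 2 ^ t = 2 ^ t + (s + 1) + c by omega, pow_add, hX]; simp
      rw [extsq_Zpow w X Z hZ, halt, this]; simp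
    rw [← e, ← Module.End.mul_apply] at e2
    have e3 : Z ^ (2 ^ (t + 1) - (s + 1)) * D = Z ^ 2 ^ t *
        ∑ i ∈ Finset.range (2 ^ t), T ^ i * Z ^ (2 ^ t - 1 - i) := by
      obtain ⟨c, hcc⟩ := Nat.exists_eq_add_of_le hsp
      conv_rhs => rw [hcc, Finset.sum_range_add, ← hcc, mul_add, Finset.mul_sum, Finset.mul_sum]
      rw [Finset.sum_eq_zero (s := Finset.range c), add_zero, Finset.mul_sum]
      · refine Finset.sum_congr rfl fun i hi => ?_
        rw [Finset.mem_range] at hi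
        rw [← mul_assoc, ← mul_assoc, (hc.pow_pow _ _).eq, (hc.pow_pow _ _).eq, mul_assoc,
          mul_assoc, ← pow_add, ← pow_add]
        congr 2
        rw [pow_succ]; omega
      · intro i _
        rw [← mul_assoc, hZT _ (by omega), zero_mul]
    rw [← Module.End.mul_apply, e3, e2]
  · intro N h1 h2
    let A : Submodule K E := Submodule.span K
      {x | ∃ j < s + 1, ∃ i, x = (Z ^ i) (if j < s then (T ^ j) g else D g)} ⊔
      LinearMap.range (T ^ (s + 1))
    have hA : A = ⊤ := by
      have hZpow : ∀ i, ∀ x ∈ A, (Z ^ i) x ∈ A := by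
        intro i x hx
        have : A ≤ A.comap (Z ^ i) := by
          refine sup_le ?_ ?_
          · rw [Submodule.span_le]
            rintro _ ⟨j, hj, k, rfl⟩
            refine Submodule.mem_sup_left (Submodule.subset_span ⟨j, hj, i + k, ?_⟩)
            rw [pow_add]; rfl
          · rintro _ ⟨x, rfl⟩
            refine Submodule.mem_sup_right ⟨(Z ^ i) x, ?_⟩
            rw [← Module.End.mul_apply, ← (hc.pow_pow _ _).eq]; rfl
        exact this hx
      have hlow : ∀ j < s, (T ^ j) g ∈ A := by
        intro j hj
        refine Submodule.mem_sup_left (Submodule.subset_span ⟨j, by omega, 0, ?_⟩)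
        simp [hj]
      have hD : D g ∈ A := by
        refine Submodule.mem_sup_left (Submodule.subset_span ⟨s, by omega, 0, ?_⟩)
        simp
      have hts : (T ^ s) g ∈ A := by
        have : (T ^ s) g = D g - ∑ i ∈ Finset.range s, (Z ^ (s - i)) ((T ^ i) g) := by
          simp only [D, Finset.sum_range_succ, LinearMap.add_apply, LinearMap.sum_apply]
          simp only [Nat.add_sub_cancel, Nat.sub_self, pow_zero, mul_one]
          rw [eq_sub_iff_add_eq, add_comm]
          congr 1
          refine Finset.sum_congr rfl fun i _ => ?_
          rw [← Module.End.mul_apply, (hc.pow_pow _ _).eq]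
        rw [this]
        refine A.sub_mem hD (A.sum_mem fun i hi => hZpow _ _ (hlow i (Finset.mem_range.1 hi)))
      have hall : ∀ j, (T ^ j) g ∈ A := by
        intro j
        rcases lt_trichotomy j s with h | h | h
        · exact hlow j h
        · rw [h]; exact hts
        · obtain ⟨c, rfl⟩ := Nat.exists_eq_add_of_le (show s + 1 ≤ j from h)
          refine Submodule.mem_sup_right ⟨(T ^ c) g, ?_⟩
          rw [pow_add T (s + 1) c]; rfl
      refine extsq_gen w X Z T v halt hs hZ hT hv A ?_ ?_ (by simpa using hall 0)
      · intro x hx; simpa using hZpow 1 x hx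
      · intro x hx
        have : A ≤ A.comap T := by
          refine sup_le ?_ ?_
          · rw [Submodule.span_le]
            rintro _ ⟨j, hj, k, rfl⟩
            change T ((Z ^ k) _) ∈ A
            rw [← Module.End.mul_apply, ← (hc.pow_left k).eq, Module.End.mul_apply]
            apply hZpow
            split_ifs
            · rw [← Module.End.mul_apply, ← pow_succ']; exact hall _
            · rw [← Module.End.mul_apply]
              simp only [D, Finset.mul_sum, LinearMap.sum_apply]
              refine A.sum_mem fun i _ => ?_
              rw [← mul_assoc, ← pow_succ', ← (hc.pow_pow _ _).eq]
              exact hZpow _ _ (hall _)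
          · rintro _ ⟨x, rfl⟩
            refine Submodule.mem_sup_right ⟨T x, ?_⟩
            rw [← Module.End.mul_apply, ← Module.End.mul_apply, ← pow_succ, pow_succ']
        exact this hx
    rw [eq_top_iff, ← hA]
    refine sup_le ?_ h2
    rw [Submodule.span_le]
    rintro _ ⟨j, hj, i, rfl⟩
    exact h1 j hj i

theorem extsq_choose (p S : ℕ) (h : S ≤ p) (hS : 1 ≤ S) :
    (p + S).choose 2 = (p - S).choose 2 + S * (2 * p - 1) := by
  obtain ⟨c, rfl⟩ := Nat.exists_eq_add_of_le h
  obtain ⟨s, rfl⟩ := Nat.exists_eq_add_of_le hS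
  have h1 := Nat.choose_two_right (1 + s + c + (1 + s))
  have h2 := Nat.choose_two_right c
  have e1 := Nat.div_mul_cancel (Nat.even_mul_pred_self (1 + s + c + (1 + s))).two_dvd
  have e2 := Nat.div_mul_cancel (Nat.even_mul_pred_self c).two_dvd
  rw [← h1] at e1
  rw [← h2] at e2
  rw [show 1 + s + c - (1 + s) = c by omega]
  rw [show 2 * (1 + s + c) - 1 = 2 * s + 2 * c + 1 by omega]
  rw [show 1 + s + c + (1 + s) - 1 = 2 * s + c + 1 by omega] at e1
  rcases c with _ | c
  · simp only [add_zero] at e1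
    simp
    nlinarith
  · rw [Nat.add_sub_cancel] at e2
    nlinarith

/-- The rank recursion. -/
theorem extsq_ranks {E' : Type*} [AddCommGroup E'] [Module K E'] [FiniteDimensional K E]
    [FiniteDimensional K E'] (X : Module.End K V) (Z T : Module.End K E) (v : V)
    (halt : ∀ a, w a a = 0)
    (hs : Submodule.span K {x | ∃ a b, w a b = x} = ⊤)
    (hZ : ∀ a b, Z (w a b) = w (X a) b + w a (X b) + w (X a) (X b))
    (hT : ∀ a b, T (w a b) = w (X a) (X b))
    (hv : Submodule.span K (Set.range fun i : ℕ => (X ^ i) v) = ⊤)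
    (t s : ℕ) (hsp : s + 1 ≤ 2 ^ t) (hX : X ^ (2 ^ t + (s + 1)) = 0)
    (hdim : finrank K E = (2 ^ t + (s + 1)).choose 2)
    (hdim' : finrank K E' = (2 ^ t - (s + 1)).choose 2)
    (Z' : Module.End K E') (hZ' : Z' ^ 2 ^ t = 0)
    (π : E →ₗ[K] E') (hπ : Function.Surjective π) (hπZ : ∀ x, π (Z x) = Z' (π x))
    (ρ : E' →ₗ[K] E)
    (hρ : ∀ x, (T ^ (s + 1)) x - (T ^ (s + 1)) (ρ (π x)) ∈ LinearMap.range (Z ^ 2 ^ t)) :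
    (∀ d ≤ 2 ^ t, finrank K (LinearMap.range (Z ^ d)) + (s + 1) * d =
      finrank K (LinearMap.range (Z' ^ d)) + (s + 1) * (2 * 2 ^ t - 1)) ∧
    (∀ k, finrank K (LinearMap.range (Z ^ (2 ^ t + k))) =
      (2 ^ t - (s + 1) - k) + s * (2 ^ t - k)) := by
  have hc := extsq_comm w X Z T hs hZ hT
  obtain ⟨y, hy, htop⟩ := extsq_family w X Z T v halt hs hZ hT hv t s hsp hX
  have hch := extsq_choose (2 ^ t) (s + 1) hsp (by omega)
  set p := 2 ^ t with hp
  set S := s + 1 with hS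
  rw [pow_succ, ← hp] at hy
  have hZ2 : Z ^ (p + p) = 0 := by
    have : X ^ (p + p) = 0 := by
      obtain ⟨c, hc⟩ := Nat.exists_eq_add_of_le hsp
      rw [show p + p = p + S + c by omega, pow_add, hX, zero_mul]
    refine extsq_ext w hs _ _ fun a b => ?_
    have e := extsq_Zpow w X Z hZ (t + 1) a b
    rw [pow_succ, ← hp, mul_two, this] at e
    simpa using e
  have hZT : ∀ x, (Z ^ p) ((T ^ S) x) = 0 := by
    intro x
    have : Z ^ p * T ^ S = 0 := by
      refine extsq_ext w hs _ _ fun a b => ?_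
      have hX' : ∀ a, (X ^ p) ((X ^ S) a) = 0 := by
        intro a
        rw [← Module.End.mul_apply, ← pow_add, hX]; simp
      have e := extsq_Zpow w X Z hZ t ((X ^ S) a) ((X ^ S) b)
      rw [← hp] at e
      simp [Module.End.mul_apply, extsq_Tpow w X T hT, e, hX']
    rw [← Module.End.mul_apply, this]; rfl
  have hstab : ∀ d, ∀ x ∈ LinearMap.range (Z ^ d), Z x ∈ LinearMap.range (Z ^ d) := by
    rintro d _ ⟨x, rfl⟩
    refine ⟨Z x, ?_⟩
    rw [← Module.End.mul_apply, ← Module.End.mul_apply, ← pow_succ, pow_succ']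
  have hmono : ∀ {i d}, d ≤ i → ∀ x, (Z ^ i) x ∈ LinearMap.range (Z ^ d) := by
    intro i d h x
    obtain ⟨c, rfl⟩ := Nat.exists_eq_add_of_le h
    exact ⟨(Z ^ c) x, by rw [pow_add]; rfl⟩
  have hTS : ∀ d x, (Z ^ d) ((T ^ S) x) = (T ^ S) ((Z ^ d) x) := by
    intro d x
    rw [← Module.End.mul_apply, (hc.pow_pow _ _).eq]; rfl
  have hπd : ∀ d x, π ((Z ^ d) x) = (Z' ^ d) (π x) := by
    intro d
    induction d with
    | zero => simp
    | succ d ih => intro x; rw [pow_succ, pow_succ, Module.End.mul_apply, ih, hπZ]; rfl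
  -- upper bounds for the high powers
  have hE : ∀ k ≤ p, finrank K (LinearMap.range (Z ^ (p + k))) ≤ (p - S - k) + s * (p - k) := by
    intro k hk
    have h := extsq_rank_bound Z y S (fun j => if j < s then p + p else p * 2 - S) (p + k)
      (LinearMap.range (T ^ S)) ⊥ htop (by simp) ?_ ?_
    · rw [Finset.sum_range_succ, Finset.sum_congr rfl (g := fun _ => p - k)] at h
      · simp only [Finset.sum_const, Finset.card_range, smul_eq_mul, finrank_bot] at h
        simp only [lt_irrefl, if_false] at h
        omega
      · intro j hj
        simp only [Finset.mem_range.1 hj, if_true]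
        omega
    · intro j hj
      by_cases h : j < s
      · simp [h, hZ2]
      · have : j = s := by omega
        subst this
        simpa using hy
    · rintro _ ⟨x, rfl⟩
      rw [add_comm, pow_add, Module.End.mul_apply, hZT]; simp
  have hF : ∀ k ≤ p, finrank K (LinearMap.range (Z ^ p)) ≤ (min k (p - S)) + s * k +
      finrank K (LinearMap.range (Z ^ (p + k))) := by
    intro k hk
    have h := extsq_rank_bound Z y S (fun j => if j < s then p + k else min (p + k) (p * 2 - S)) p
      (LinearMap.range (T ^ S)) (LinearMap.range (Z ^ (p + k))) htop (hstab _) ?_ ?_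
    · rw [Finset.sum_range_succ, Finset.sum_congr rfl (g := fun _ => k)] at h
      · simp only [Finset.sum_const, Finset.card_range, smul_eq_mul] at h
        simp only [lt_irrefl, if_false] at h
        omega
      · intro j hj
        simp only [Finset.mem_range.1 hj, if_true]
        omega
    · intro j hj
      by_cases h : j < s
      · simp [h]
      · have : j = s := by omega
        subst this
        simp only [lt_irrefl, if_false]
        rcases le_total (p + k) (p * 2 - S) with h | h
        · rw [min_eq_left h]; exact ⟨_, rfl⟩
        · rw [min_eq_right h, hy]; exact Submodule.zero_mem _
    · rintro _ ⟨x, rfl⟩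
      rw [hZT]; exact Submodule.zero_mem _
  -- bounds for the low powers
  have hA : ∀ d ≤ p, finrank K (LinearMap.range (Z ^ d)) ≤ S * (p - d) +
      (finrank K (LinearMap.range (Z' ^ d)) + finrank K (LinearMap.range (Z ^ p))) := by
    intro d hd
    have h := extsq_rank_bound Z y S (fun _ => p) d
      (LinearMap.range (T ^ S))
      (((LinearMap.range (Z' ^ d)).map ρ).map (T ^ S) ⊔ LinearMap.range (Z ^ p)) htop ?_ ?_ ?_
    · rw [Finset.sum_const, Finset.card_range, smul_eq_mul] at h
      have h1 := Submodule.finrank_add_le_finrank_add_finrank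
        (((LinearMap.range (Z' ^ d)).map ρ).map (T ^ S)) (LinearMap.range (Z ^ p))
      have h2 := Submodule.finrank_map_le (T ^ S) ((LinearMap.range (Z' ^ d)).map ρ)
      have h3 := Submodule.finrank_map_le ρ (LinearMap.range (Z' ^ d))
      omega
    · intro x hx
      obtain ⟨_, ⟨_, ⟨_, ⟨e, rfl⟩, rfl⟩, rfl⟩, r, hr, rfl⟩ := Submodule.mem_sup.1 hx
      obtain ⟨e, rfl⟩ := hπ e
      rw [map_add]
      refine Submodule.add_mem _ ?_ (Submodule.mem_sup_right (hstab _ _ hr))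
      have e1 := hρ ((Z ^ d) e)
      have e2 := hstab _ _ e1
      have e3 := hρ (Z ((Z ^ d) e))
      have e4 := hTS 1
      simp only [pow_one] at e4
      rw [map_sub, e4] at e2
      have e5 := Submodule.sub_mem _ e3 e2
      rw [← hπd]
      have e6 : (T ^ S) (ρ (π (Z ((Z ^ d) e)))) ∈
          ((LinearMap.range (Z' ^ d)).map ρ).map (T ^ S) := by
        refine ⟨_, ⟨_, ⟨π (Z e), rfl⟩, rfl⟩, ?_⟩
        have : (Z ^ d) (Z e) = Z ((Z ^ d) e) := by
          rw [← Module.End.mul_apply, ← Module.End.mul_apply, ← pow_succ, pow_succ']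
        rw [← hπd, this]
      rw [show Z ((T ^ S) (ρ (π ((Z ^ d) e)))) = (T ^ S) (ρ (π (Z ((Z ^ d) e)))) +
        ((T ^ S) (Z ((Z ^ d) e)) - (T ^ S) (ρ (π (Z ((Z ^ d) e)))) - ((T ^ S) (Z ((Z ^ d) e)) -
          Z ((T ^ S) (ρ (π ((Z ^ d) e)))))) by abel]
      exact Submodule.add_mem _ (Submodule.mem_sup_left e6) (Submodule.mem_sup_right e5)
    · intro j _
      exact Submodule.mem_sup_right ⟨_, rfl⟩
    · rintro _ ⟨x, rfl⟩
      have e1 := hρ ((Z ^ d) x)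
      rw [hTS, ← sub_add_cancel ((T ^ S) ((Z ^ d) x)) ((T ^ S) (ρ (π ((Z ^ d) x))))]
      refine Submodule.add_mem _ (Submodule.mem_sup_right e1) (Submodule.mem_sup_left ?_)
      exact ⟨_, ⟨_, ⟨π x, rfl⟩, by rw [hπd]⟩, rfl⟩
  have hC : ∀ d ≤ p, finrank K E + finrank K (LinearMap.range (Z' ^ d)) ≤ S * d +
      (finrank K E' + finrank K (LinearMap.range (Z ^ d))) := by
    intro d hd
    obtain ⟨C, hC⟩ := (LinearMap.range (Z' ^ d)).exists_isCompl
    have hCd := Submodule.finrank_add_eq_of_isCompl hC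
    have hmem : ∀ x, (T ^ S) x ∈ (C.map ρ).map (T ^ S) ⊔ LinearMap.range (Z ^ d) := by
      intro x
      have hx : π x ∈ LinearMap.range (Z' ^ d) ⊔ C := by rw [hC.sup_eq_top]; trivial
      obtain ⟨_, ⟨e, rfl⟩, c, hcC, hxe⟩ := Submodule.mem_sup.1 hx
      obtain ⟨e, rfl⟩ := hπ e
      have e1 := hρ x
      have e2 := hρ ((Z ^ d) e)
      rw [hπd, ← hTS] at e2
      rw [← hxe, map_add, map_add] at e1
      have hpd : LinearMap.range (Z ^ p) ≤ LinearMap.range (Z ^ d) := by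
        rintro _ ⟨x, rfl⟩; exact hmono hd x
      rw [show (T ^ S) x = (T ^ S) (ρ c) + (((T ^ S) x - ((T ^ S) (ρ ((Z' ^ d) (π e))) +
        (T ^ S) (ρ c))) - ((Z ^ d) ((T ^ S) e) - (T ^ S) (ρ ((Z' ^ d) (π e)))) +
          (Z ^ d) ((T ^ S) e)) by abel]
      refine Submodule.add_mem _ (Submodule.mem_sup_left ⟨_, ⟨_, hcC, rfl⟩, rfl⟩)
        (Submodule.mem_sup_right (Submodule.add_mem _ (Submodule.sub_mem _ (hpd e1) (hpd e2)) ⟨_, rfl⟩))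
    have hQ : LinearMap.range (T ^ S) ⊔ LinearMap.range (Z ^ d) ≤
        (C.map ρ).map (T ^ S) ⊔ LinearMap.range (Z ^ d) := by
      refine sup_le ?_ le_sup_right
      rintro _ ⟨x, rfl⟩
      exact hmem x
    have h := extsq_rank_bound Z y S (fun _ => d) 0
      (LinearMap.range (T ^ S))
      (LinearMap.range (T ^ S) ⊔ LinearMap.range (Z ^ d)) htop ?_ ?_ ?_
    · rw [Finset.sum_const, Finset.card_range, smul_eq_mul, pow_zero, Nat.sub_zero,
        Module.End.one_eq_id, LinearMap.range_id, finrank_top] at h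
      have h0 := Submodule.finrank_mono hQ
      have h1 := Submodule.finrank_add_le_finrank_add_finrank
        ((C.map ρ).map (T ^ S)) (LinearMap.range (Z ^ d))
      have h2 := Submodule.finrank_map_le (T ^ S) (C.map ρ)
      have h3 := Submodule.finrank_map_le ρ C
      omega
    · intro x hx
      obtain ⟨_, ⟨e, rfl⟩, r, hr, rfl⟩ := Submodule.mem_sup.1 hx
      rw [map_add]
      refine Submodule.add_mem _ (Submodule.mem_sup_left ⟨Z e, ?_⟩)
        (Submodule.mem_sup_right (hstab _ _ hr))
      simpa using (hTS 1 e).symm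
    · intro j _
      exact Submodule.mem_sup_right ⟨_, rfl⟩
    · intro x hx
      exact Submodule.mem_sup_left (by simpa using hx)
  have hrp' : finrank K (LinearMap.range (Z' ^ p)) = 0 := by
    rw [hZ', LinearMap.range_zero, finrank_bot]
  have hp1 : 1 ≤ p := by omega
  obtain ⟨q, hq⟩ : ∃ q, p = S + q := Nat.exists_eq_add_of_le hsp
  have hCp := hC p le_rfl
  have hEp : finrank K (LinearMap.range (Z ^ p)) ≤ p - S - 0 + s * (p - 0) := hE 0 (by omega)
  rw [hrp', hdim, hdim', hch] at hCp
  simp only [Nat.sub_zero] at hEp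
  have e1 : S * (2 * p - 1) = S * p + (p - S + s * p) := by
    rw [hq, show 2 * (S + q) - 1 = (S + q) + (q + s) by omega, show S + q - S = q by omega, hS]
    ring
  have hrp : finrank K (LinearMap.range (Z ^ p)) = p - S + s * p := by omega
  refine ⟨?_, ?_⟩
  · intro d hd
    have h1 := hA d hd
    have h2 := hC d hd
    rw [hdim, hdim', hch] at h2
    obtain ⟨c, hc⟩ : ∃ c, p = d + c := Nat.exists_eq_add_of_le hd
    have e3 : S * p = S * d + S * (p - d) := by
      rw [show p - d = c by omega, hc]; ring
    omega
  · intro k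
    by_cases hk : k ≤ p
    · have h1 := hE k hk
      have h2 := hF k hk
      obtain ⟨c, hc⟩ : ∃ c, p = k + c := Nat.exists_eq_add_of_le hk
      have e3 : s * p = s * k + s * (p - k) := by
        rw [show p - k = c by omega, hc]; ring
      omega
    · have : Z ^ (p + k) = 0 := by
        rw [show p + k = p + p + (k - p) by omega, pow_add, hZ2, zero_mul]
      rw [this, LinearMap.range_zero, finrank_bot, show p - k = 0 by omega]
      omega
end

/-- Arithmetic of multiplicities. -/
theorem extsq_arith (r r' : ℕ → ℕ) (p s : ℕ) (hsp : s + 1 ≤ p)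
    (hpar : Even (s + 1) ∨ p = 1)
    (h1 : ∀ d ≤ p, r d + (s + 1) * d = r' d + (s + 1) * (2 * p - 1))
    (h2 : ∀ k, r (p + k) = (p - (s + 1) - k) + s * (p - k))
    (h3 : ∀ d, p ≤ d → r' d = 0) (h4 : s + 1 = p → ∀ d, r' d = 0)
    (ih : ∀ d, 1 ≤ d → r' (d - 1) + r' (d + 1) - 2 * r' d ≠ 0 →
      Odd (r' (d - 1) + r' (d + 1) - 2 * r' d)) (d : ℕ) (hd : 1 ≤ d)
    (hne : r (d - 1) + r (d + 1) - 2 * r d ≠ 0) :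
    Odd (r (d - 1) + r (d + 1) - 2 * r d) := by
  obtain ⟨e, rfl⟩ : ∃ e, d = e + 1 := ⟨d - 1, by omega⟩
  simp only [Nat.add_sub_cancel] at *
  rcases lt_trichotomy (e + 1) p with h | h | h
  · have a0 := h1 e (by omega)
    have a1 := h1 (e + 1) (by omega)
    have a2 := h1 (e + 1 + 1) (by omega)
    have := ih (e + 1) (by omega)
    simp only [Nat.add_sub_cancel] at this
    have m1 : (s + 1) * (e + 1) = (s + 1) * e + (s + 1) := by ring
    have m2 : (s + 1) * (e + 1 + 1) = (s + 1) * e + (s + 1) + (s + 1) := by ring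
    have : r e + r (e + 1 + 1) - 2 * r (e + 1) = r' e + r' (e + 1 + 1) - 2 * r' (e + 1) := by
      omega
    rw [this] at hne ⊢
    have := ih (e + 1) (by omega)
    simp only [Nat.add_sub_cancel] at this
    exact this hne
  · have a0 := h1 e (by omega)
    have a1 := h1 (e + 1) (by omega)
    have a2 := h2 1
    have a3 := h3 (e + 1) (by omega)
    have a4 := h3 (e + 1 + 1) (by omega)
    have a5 := h2 0
    subst h
    have m1 : (s + 1) * (e + 1) = s * e + s + e + 1 := by ring
    have m2 : (s + 1) * (2 * (e + 1) - 1) = 2 * (s * e) + s + 2 * e + 1 := by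
      rw [show 2 * (e + 1) - 1 = 2 * e + 1 by omega]; ring
    have m3 : s * (e + 1 - 1) = s * e := by simp
    have m4 : s * (e + 1 - 0) = s * e + s := by simp; ring
    have m5 : (s + 1) * e = s * e + e := by ring
    by_cases hs : s + 1 = e + 1
    · have a6 := h4 hs e
      have : r e + r (e + 1 + 1) - 2 * r (e + 1) = 1 := by
        simp only [add_zero] at a5
        omega
      rw [this]; exact odd_one
    · have : r e + r (e + 1 + 1) - 2 * r (e + 1) = r' e + r' (e + 1 + 1) - 2 * r' (e + 1) := by
        simp only [add_zero] at a5
        omega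
      rw [this] at hne ⊢
      have := ih (e + 1) (by omega)
      simp only [Nat.add_sub_cancel] at this
      exact this hne
  · obtain ⟨k, rfl⟩ : ∃ k, e = p + k := ⟨e - p, by omega⟩
    have a0 := h2 k
    have a1 := h2 (k + 1)
    have a2 := h2 (k + 1 + 1)
    simp only [← add_assoc] at a1 a2
    rcases lt_trichotomy (k + 1) p with hk | hk | hk
    · obtain ⟨c, rfl⟩ : ∃ c, p = k + 2 + c := ⟨p - (k + 2), by omega⟩
      rw [show k + 2 + c - k = c + 2 by omega] at a0
      rw [show k + 2 + c - (k + 1) = c + 1 by omega] at a1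
      rw [show k + 2 + c - (k + 1 + 1) = c by omega] at a2
      have m0 : s * (c + 2) = s * c + 2 * s := by ring
      have m1 : s * (c + 1) = s * c + s := by ring
      by_cases hx : k + 1 + (s + 1) = k + 2 + c
      · have : r (k + 2 + c + k) + r (k + 2 + c + k + 1 + 1) - 2 * r (k + 2 + c + k + 1) = 1 := by
          omega
        rw [this]; exact odd_one
      · exfalso
        apply hne
        omega
    · subst hk
      rw [show k + 1 - k = 1 by omega] at a0
      rw [show k + 1 - (k + 1) = 0 by omega] at a1
      rw [show k + 1 - (k + 1 + 1) = 0 by omega] at a2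
      have : r (k + 1 + k) + r (k + 1 + k + 1 + 1) - 2 * r (k + 1 + k + 1) = s := by
        omega
      rw [this] at hne ⊢
      rcases hpar with h | h
      · exact (Nat.even_add_one.1 h |> Nat.not_even_iff_odd.1)
      · omega
    · exfalso
      apply hne
      rw [show p - k = 0 by omega, mul_zero] at a0
      rw [show p - (k + 1) = 0 by omega, mul_zero] at a1
      rw [show p - (k + 1 + 1) = 0 by omega, mul_zero] at a2
      omega

theorem extsq_span {K V : Type*} [Field K] [AddCommGroup V] [Module K V]
    [FiniteDimensional K V] (X : Module.End K V) (m : ℕ) (hm : 1 ≤ m)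
    (hdim : finrank K V = m) (h0 : X ^ m = 0) (h1 : X ^ (m - 1) ≠ 0) :
    ∃ v, Submodule.span K (Set.range fun i : ℕ => (X ^ i) v) = ⊤ := by
  obtain ⟨v, hv⟩ : ∃ v, (X ^ (m - 1)) v ≠ 0 := by
    by_contra h
    push Not at h
    exact h1 (LinearMap.ext h)
  refine ⟨v, ?_⟩
  let N : ℕ → Submodule K V := fun j => Submodule.span K {x | ∃ i, j ≤ i ∧ x = (X ^ i) v}
  have hN : ∀ c, c ≤ m → c ≤ finrank K (N (m - c)) := by
    intro c
    induction c with
    | zero => simp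
    | succ c ih =>
      intro hc
      have := ih (by omega)
      have hlt : N (m - c) < N (m - (c + 1)) := by
        refine lt_of_le_of_ne ?_ ?_
        · refine Submodule.span_mono ?_
          rintro _ ⟨i, hi, rfl⟩
          exact ⟨i, by omega, rfl⟩
        · intro he
          have hmem : (X ^ (m - (c + 1))) v ∈ N (m - c) := by
            rw [he]; exact Submodule.subset_span ⟨_, le_rfl, rfl⟩
          have hle : N (m - c) ≤ LinearMap.ker (X ^ c) := by
            refine Submodule.span_le.2 ?_
            rintro _ ⟨i, hi, rfl⟩
            obtain ⟨e, he⟩ : ∃ e, c + i = m + e := ⟨c + i - m, by omega⟩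
            change (X ^ c) ((X ^ i) v) = 0
            rw [← Module.End.mul_apply, ← pow_add, he, pow_add, h0]; simp
          have h2 : (X ^ c) ((X ^ (m - (c + 1))) v) = 0 := hle hmem
          rw [← Module.End.mul_apply, ← pow_add, show c + (m - (c + 1)) = m - 1 by omega] at h2
          exact hv h2
      have := Submodule.finrank_lt_finrank_of_lt hlt
      omega
  have h2 := hN m le_rfl
  have h3 : N (m - m) = Submodule.span K (Set.range fun i : ℕ => (X ^ i) v) := by
    change Submodule.span K {x | ∃ i, m - m ≤ i ∧ x = (X ^ i) v} = _
    congr 1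
    ext x
    simp [eq_comm]
  rw [h3] at h2
  apply Submodule.eq_top_of_finrank_eq
  have := Submodule.finrank_le (Submodule.span K (Set.range fun i : ℕ => (X ^ i) v))
  omega

/-- The canonical wedge. -/
noncomputable def extsqWedge (K V : Type*) [Field K] [AddCommGroup V] [Module K V] :
    V →ₗ[K] V →ₗ[K] ⋀[K]^2 V :=
  LinearMap.mk₂ K (fun a b => exteriorPower.ιMulti K 2 ![a, b])
    (by
      intro a a' b
      have := (exteriorPower.ιMulti K 2 (M := V)).map_update_add ![0, b] 0 a a'
      have hu : ∀ x : V, Function.update ![0, b] 0 x = ![x, b] := by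
        intro x; funext i; fin_cases i <;> rfl
      rw [hu, hu] at this
      try rw [hu] at this
      exact this)
    (by
      intro c a b
      have := (exteriorPower.ιMulti K 2 (M := V)).map_update_smul ![0, b] 0 c a
      have hu : ∀ x : V, Function.update ![0, b] 0 x = ![x, b] := by
        intro x; funext i; fin_cases i <;> rfl
      rw [hu, hu] at this
      try rw [hu] at this
      exact this)
    (by
      intro a b b'
      have := (exteriorPower.ιMulti K 2 (M := V)).map_update_add ![a, 0] 1 b b'
      have hu : ∀ x : V, Function.update ![a, 0] 1 x = ![a, x] := by
        intro x; funext i; fin_cases i <;> rfl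
      rw [hu, hu] at this
      try rw [hu] at this
      exact this)
    (by
      intro c a b
      have := (exteriorPower.ιMulti K 2 (M := V)).map_update_smul ![a, 0] 1 c b
      have hu : ∀ x : V, Function.update ![a, 0] 1 x = ![a, x] := by
        intro x; funext i; fin_cases i <;> rfl
      rw [hu, hu] at this
      try rw [hu] at this
      exact this)

section
variable {K V : Type*} [Field K] [AddCommGroup V] [Module K V]

theorem extsqWedge_apply (a b : V) : extsqWedge K V a b = exteriorPower.ιMulti K 2 ![a, b] := rfl

theorem extsqWedge_self (a : V) : extsqWedge K V a a = 0 := by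
  rw [extsqWedge_apply]
  exact (exteriorPower.ιMulti K 2 (M := V)).map_eq_zero_of_eq ![a, a] (i := 0) (j := 1) rfl
    (by decide)

theorem extsqWedge_span : Submodule.span K {x | ∃ a b, extsqWedge K V a b = x} = ⊤ := by
  rw [eq_top_iff, ← exteriorPower.ιMulti_span K 2 V]
  refine Submodule.span_mono ?_
  rintro _ ⟨m, rfl⟩
  refine ⟨m 0, m 1, ?_⟩
  rw [extsqWedge_apply]
  congr 1
  ext i; fin_cases i <;> rfl

theorem extsqWedge_map {V' : Type*} [AddCommGroup V'] [Module K V'] (f : V →ₗ[K] V') (a b : V) :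
    exteriorPower.map 2 f (extsqWedge K V a b) = extsqWedge K V' (f a) (f b) := by
  rw [extsqWedge_apply, exteriorPower.map_apply_ιMulti, extsqWedge_apply]
  congr 1
  ext i; fin_cases i <;> rfl
end

noncomputable def extsqZ {K V : Type*} [Field K] [AddCommGroup V] [Module K V]
    (X : Module.End K V) : Module.End K (⋀[K]^2 V) :=
  exteriorPower.map 2 (1 + X) - 1

theorem extsqZ_apply {K V : Type*} [Field K] [AddCommGroup V] [Module K V]
    (X : Module.End K V) (a b : V) : extsqZ X (extsqWedge K V a b) =
      extsqWedge K V (X a) b + extsqWedge K V a (X b) + extsqWedge K V (X a) (X b) := by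
  simp only [extsqZ, LinearMap.sub_apply, Module.End.one_apply]
  erw [extsqWedge_map]
  simp only [LinearMap.add_apply, Module.End.one_apply, map_add]
  abel

universe u v

theorem extsq_main (K : Type u) [Field K] [CharP K 2] (m : ℕ) : Even m →
    ∀ (V : Type v) [AddCommGroup V] [Module K V] [FiniteDimensional K V]
    (X : Module.End K V) (v : V), finrank K V = m → X ^ m = 0 →
    Submodule.span K (Set.range fun i : ℕ => (X ^ i) v) = ⊤ →
    ∀ d, 1 ≤ d → jordanMult K (extsqZ X) d ≠ 0 → Odd (jordanMult K (extsqZ X) d) := by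
  induction m using Nat.strong_induction_on with
  | _ m IH =>
  intro hm V _ _ _ X v hdim hX hv
  by_cases hm0 : m = 0
  · intro d hd hne
    exfalso
    apply hne
    have h0 : finrank K (⋀[K]^2 V) = 0 := by
      rw [exteriorPower.finrank_eq, hdim, hm0]; rfl
    have hr : ∀ i, finrank K (LinearMap.range (extsqZ X ^ i)) = 0 := fun i => by
      have := Submodule.finrank_le (LinearMap.range (extsqZ X ^ i))
      omega
    simp [jordanMult, hr]
  have hm2 : 2 ≤ m := by
    obtain ⟨c, hc⟩ := hm
    omega
  obtain ⟨t, ht1, ht2⟩ : ∃ t, 2 ^ t ≤ m - 1 ∧ m - 1 < 2 ^ (t + 1) :=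
    ⟨Nat.log 2 (m - 1), Nat.pow_log_le_self 2 (by omega), Nat.lt_pow_succ_log_self (by omega) _⟩
  obtain ⟨s, hs⟩ : ∃ s, m = 2 ^ t + (s + 1) := ⟨m - 1 - 2 ^ t, by omega⟩
  have hsp : s + 1 ≤ 2 ^ t := by rw [pow_succ] at ht2; omega
  have hpar : Even (s + 1) ∨ 2 ^ t = 1 := by
    rcases t with _ | t
    · right; rfl
    · left
      rw [hs, Nat.even_add] at hm
      exact hm.1 ((Nat.even_pow.2 ⟨even_two, by omega⟩))
  set k := 2 ^ t - (s + 1) with hk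
  have hXmono : ∀ i, m ≤ i → X ^ i = 0 := by
    intro i hi
    obtain ⟨c, rfl⟩ := Nat.exists_eq_add_of_le hi
    rw [pow_add, hX, zero_mul]
  -- the quotient block
  let R : Submodule K V := LinearMap.range (X ^ k)
  have hRX : R ≤ R.comap X := by
    rintro _ ⟨x, rfl⟩
    exact ⟨X x, by rw [← Module.End.mul_apply, ← Module.End.mul_apply, ← pow_succ, pow_succ']⟩
  let X' : Module.End K (V ⧸ R) := R.mapQ R X hRX
  have hX'pow : ∀ i x, (X' ^ i) (R.mkQ x) = R.mkQ ((X ^ i) x) := by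
    intro i
    induction i with
    | zero => simp
    | succ i ih =>
      intro x
      rw [pow_succ, pow_succ, Module.End.mul_apply, Module.End.mul_apply, ← ih]
      rfl
  have hX'k : X' ^ k = 0 := by
    refine LinearMap.ext fun y => ?_
    obtain ⟨x, rfl⟩ := R.mkQ_surjective y
    rw [hX'pow]
    simp only [Submodule.mkQ_apply, LinearMap.zero_apply, Submodule.Quotient.mk_eq_zero]
    exact ⟨x, rfl⟩
  have htopv : ∀ N : Submodule K V, (∀ j < 1, ∀ i, (X ^ i) ((fun _ : ℕ => v) j) ∈ N) → ⊥ ≤ N →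
      N = ⊤ := by
    intro N h _
    rw [eq_top_iff, ← hv, Submodule.span_le]
    rintro _ ⟨i, rfl⟩
    exact h 0 (by omega) i
  have hdimQ : finrank K (V ⧸ R) = k := by
    have e1 := extsq_rank_bound X (fun _ => v) 1 (fun _ => k) 0 ⊥ R htopv hRX
      (fun _ _ => ⟨v, rfl⟩) (by simp)
    have e2 := extsq_rank_bound X (fun _ => v) 1 (fun _ => m) k ⊥ ⊥ htopv (by simp)
      (by simp [hX]) (by simp)
    rw [pow_zero, Module.End.one_eq_id, LinearMap.range_id, finrank_top] at e1
    simp only [Finset.sum_const, Finset.card_range, one_smul, finrank_bot] at e1 e2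
    have e3 := R.finrank_quotient_add_finrank
    have e4 : finrank K R ≤ m - k := e2
    omega
  have hv' : Submodule.span K (Set.range fun i : ℕ => (X' ^ i) (R.mkQ v)) = ⊤ := by
    have : (Set.range fun i : ℕ => (X' ^ i) (R.mkQ v)) =
        R.mkQ '' (Set.range fun i : ℕ => (X ^ i) v) := by
      rw [← Set.range_comp]
      congr 1
      funext i
      exact hX'pow i v
    rw [this, Submodule.span_image, hv, Submodule.map_top, Submodule.range_mkQ]
  have hkeven : Even k := by
    rw [hk, Nat.even_sub hsp]
    rw [hs, Nat.even_add] at hm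
    exact hm
  have ih := IH k (by omega) hkeven (V ⧸ R) X' (R.mkQ v) hdimQ hX'k hv'
  obtain ⟨σ, hσ⟩ := R.mkQ.exists_rightInverse_of_surjective R.range_mkQ
  have hZ'p : extsqZ X' ^ 2 ^ t = 0 := by
    refine extsq_ext (extsqWedge K (V ⧸ R)) extsqWedge_span _ _ fun a b => ?_
    have : X' ^ 2 ^ t = 0 := by
      rw [show 2 ^ t = k + (s + 1) by omega, pow_add, hX'k, zero_mul]
    rw [extsq_Zpow _ X' _ (extsqZ_apply X'), this]; simp
  let T : Module.End K (⋀[K]^2 V) := exteriorPower.map 2 X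
  have hT : ∀ a b, T (extsqWedge K V a b) = extsqWedge K V (X a) (X b) := extsqWedge_map X
  let π := exteriorPower.map 2 R.mkQ
  let ρ := exteriorPower.map 2 σ
  have hρ : ∀ x, (T ^ (s + 1)) x - (T ^ (s + 1)) (ρ (π x)) ∈
      LinearMap.range (extsqZ X ^ 2 ^ t) := by
    intro x
    have hx : x ∈ Submodule.span K {x | ∃ a b, extsqWedge K V a b = x} := by
      rw [extsqWedge_span]; trivial
    induction hx using Submodule.span_induction with
    | zero => simp
    | add x y _ _ h1 h2 =>
      have := Submodule.add_mem _ h1 h2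
      simp only [map_add]
      convert this using 1
      abel
    | smul c x _ h =>
      let L : Module.End K (⋀[K]^2 V) := T ^ (s + 1) - (T ^ (s + 1)) ∘ₗ ρ ∘ₗ π
      have e : L (c • x) = c • L x := L.map_smul c x
      change L (c • x) ∈ _
      rw [e]
      exact Submodule.smul_mem _ c h
    | mem x h =>
      obtain ⟨a, b, rfl⟩ := h
      simp only [π, ρ, extsqWedge_map]
      rw [extsq_Tpow _ X T hT, extsq_Tpow _ X T hT]
      have hsec : ∀ a, ∃ c, (X ^ (s + 1)) a =
          (X ^ (s + 1)) (σ (R.mkQ a)) + (X ^ 2 ^ t) c := by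
        intro a
        have : a - σ (R.mkQ a) ∈ R := by
          have h0 : R.mkQ (a - σ (R.mkQ a)) = 0 := by
            rw [map_sub, sub_eq_zero]
            exact (LinearMap.congr_fun hσ (R.mkQ a)).symm
          exact (Submodule.Quotient.mk_eq_zero R).1 h0
        obtain ⟨c, hc⟩ := this
        refine ⟨c, ?_⟩
        rw [show 2 ^ t = (s + 1) + k by omega, pow_add X (s + 1) k, Module.End.mul_apply, hc,
          map_sub]
        abel
      have hkill : ∀ a, (X ^ 2 ^ t) ((X ^ (s + 1)) a) = 0 := by
        intro a
        rw [← Module.End.mul_apply, ← pow_add, ← hs, hX]; rfl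
      obtain ⟨α, hα⟩ := hsec a
      obtain ⟨β, hβ⟩ := hsec b
      refine ⟨extsqWedge K V α ((X ^ (s + 1)) b) +
        extsqWedge K V ((X ^ (s + 1)) (σ (R.mkQ a))) β, ?_⟩
      rw [map_add, extsq_Zpow _ X _ (extsqZ_apply X), extsq_Zpow _ X _ (extsqZ_apply X)]
      rw [hkill, hkill]
      simp only [map_zero, LinearMap.zero_apply, add_zero, zero_add]
      rw [hα, hβ]
      simp only [map_add, LinearMap.add_apply]
      abel
  have hπZ : ∀ x, π (extsqZ X x) = extsqZ X' (π x) := by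
    have : π ∘ₗ extsqZ X = extsqZ X' ∘ₗ π := by
      refine extsq_ext (extsqWedge K V) extsqWedge_span _ _ fun a b => ?_
      simp only [LinearMap.comp_apply, extsqZ_apply, map_add, π, extsqWedge_map]
      rfl
    exact fun x => LinearMap.congr_fun this x
  obtain ⟨h1, h2⟩ := extsq_ranks (extsqWedge K V) X (extsqZ X) T v extsqWedge_self
    extsqWedge_span (extsqZ_apply X) hT hv t s hsp (by rw [← hs]; exact hX)
    (by rw [exteriorPower.finrank_eq, hdim, hs])
    (by rw [exteriorPower.finrank_eq, hdimQ]) (extsqZ X') hZ'p π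
    (exteriorPower.map_surjective R.mkQ_surjective) hπZ ρ hρ
  intro d hd hne
  refine extsq_arith (fun d => finrank K (LinearMap.range (extsqZ X ^ d)))
    (fun d => finrank K (LinearMap.range (extsqZ X' ^ d))) (2 ^ t) s hsp hpar h1 h2 ?_ ?_ ih d hd hne
  · intro d hd
    obtain ⟨c, rfl⟩ := Nat.exists_eq_add_of_le hd
    rw [pow_add, hZ'p, zero_mul, LinearMap.range_zero, finrank_bot]
  · intro hs d
    have h0 : finrank K (⋀[K]^2 (V ⧸ R)) = 0 := by
      rw [exteriorPower.finrank_eq, hdimQ, show k = 0 by omega]; rfl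
    have := Submodule.finrank_le (LinearMap.range (extsqZ X' ^ d))
    omega

/-- for a single unipotent Jordan block `u` of size `2n` over `K`, every
Jordan block size of `∧²u` on `∧²V` occurs with odd multiplicity. -/
theorem exterior_square_multiplicities_odd
    (K : Type*) [Field K] [IsAlgClosed K] [CharP K 2]
    (V : Type*) [AddCommGroup V] [Module K V] [FiniteDimensional K V]
    (n : ℕ) (hn : 1 ≤ n)
    (u : V ≃ₗ[K] V)
    (hdim : Module.finrank K V = 2 * n)
    (hb : ((u : V →ₗ[K] V) - 1) ^ (2 * n - 1) ≠ 0)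
    (hb' : ((u : V →ₗ[K] V) - 1) ^ (2 * n) = 0)
    (E : Type*) [AddCommGroup E] [Module K E]
    (wedge : V →ₗ[K] V →ₗ[K] E) (hE : IsExteriorSquare K wedge)
    (uE : E →ₗ[K] E) (huE : ∀ v w, uE (wedge v w) = wedge (u v) (u w)) :
    ∀ d : ℕ, 1 ≤ d → jordanMult K (uE - 1) d ≠ 0 → Odd (jordanMult K (uE - 1) d) := by
  obtain ⟨halt, hspan, hfr⟩ := hE
  let X : Module.End K V := (u : V →ₗ[K] V) - 1
  obtain ⟨v, hv⟩ := extsq_span X (2 * n) (by omega) hdim hb' hb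
  have hmain := extsq_main K (2 * n) (even_two_mul n) V X v hdim hb' hv
  let A : V [⋀^Fin 2]→ₗ[K] E :=
    { toFun := fun m => wedge (m 0) (m 1)
      map_update_add' := by
        intro inst m i x y
        rw [Subsingleton.elim inst (instDecidableEqFin 2)]
        fin_cases i <;> simp
      map_update_smul' := by
        intro inst m i c x
        rw [Subsingleton.elim inst (instDecidableEqFin 2)]
        fin_cases i <;> simp
      map_eq_zero_of_eq' := by
        intro m i j hij hne
        have h01 : m 0 = m 1 := by
          fin_cases i <;> fin_cases j <;> simp_all
        change wedge (m 0) (m 1) = 0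
        rw [h01, halt] }
  let φ : ⋀[K]^2 V →ₗ[K] E := exteriorPower.alternatingMapLinearEquiv A
  have hφ : ∀ a b, φ (extsqWedge K V a b) = wedge a b := by
    intro a b
    rw [extsqWedge_apply]
    exact exteriorPower.alternatingMapLinearEquiv_apply_ιMulti A ![a, b]
  have hsurj : Function.Surjective φ := by
    rw [← LinearMap.range_eq_top, eq_top_iff, ← hspan, Submodule.span_le]
    rintro _ ⟨a, b, rfl⟩
    exact ⟨_, hφ a b⟩
  haveI : FiniteDimensional K E := Module.Finite.of_surjective φ hsurj
  have hfin : finrank K (⋀[K]^2 V) = finrank K E := by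
    rw [exteriorPower.finrank_eq, hfr]
  have hinj : Function.Injective φ :=
    (LinearMap.injective_iff_surjective_of_finrank_eq_finrank hfin).2 hsurj
  have hcomm : ∀ x, φ (extsqZ X x) = (uE - 1) (φ x) := by
    have : φ ∘ₗ extsqZ X = (uE - 1) ∘ₗ φ := by
      refine extsq_ext (extsqWedge K V) extsqWedge_span _ _ fun a b => ?_
      have hu : ∀ a, u a = a + X a := by
        intro a
        simp [X]
      simp only [LinearMap.comp_apply, extsqZ_apply, map_add, hφ, LinearMap.sub_apply, huE,
        Module.End.one_apply, hu, LinearMap.add_apply]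
      abel
    exact fun x => LinearMap.congr_fun this x
  have hpow : ∀ d x, φ ((extsqZ X ^ d) x) = ((uE - 1) ^ d) (φ x) := by
    intro d
    induction d with
    | zero => simp
    | succ d ih => intro x; rw [pow_succ, pow_succ, Module.End.mul_apply, ih, hcomm]; rfl
  have hrank : ∀ d, finrank K (LinearMap.range ((uE - 1) ^ d)) =
      finrank K (LinearMap.range (extsqZ X ^ d)) := by
    intro d
    have : LinearMap.range ((uE - 1) ^ d) = (LinearMap.range (extsqZ X ^ d)).map φ := by
      ext y
      constructor
      · rintro ⟨x, rfl⟩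
        obtain ⟨x, rfl⟩ := hsurj x
        exact ⟨_, ⟨x, rfl⟩, hpow d x⟩
      · rintro ⟨_, ⟨x, rfl⟩, rfl⟩
        exact ⟨φ x, (hpow d x).symm⟩
    rw [this]
    exact (Submodule.equivMapOfInjective φ hinj _).finrank_eq.symm
  have hjm : ∀ d, jordanMult K (uE - 1) d = jordanMult K (extsqZ X) d := by
    intro d
    simp only [jordanMult, hrank]
  intro d hd
  rw [hjm]
  exact hmain d hd
end

section
/- Let n ≥ 1 and let u be a single unipotent Jordan block of size 2n acting on a 2n-dimensional K-vector space V. If every Jordan block size of ∧²u on ∧²(V) has multiplicity at most 2, then n ∈ {1, 2, 3, 5}. -/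
open Module LinearMap

section Helpers

/-- The alternating map attached to an alternating bilinear map. -/
def altOfBilin {K V E : Type*} [Field K] [AddCommGroup V] [Module K V]
    [AddCommGroup E] [Module K E] (B : V →ₗ[K] V →ₗ[K] E) (hB : ∀ v, B v v = 0) :
    V [⋀^Fin 2]→ₗ[K] E where
  toFun v := B (v 0) (v 1)
  map_update_add' := by
    intro _ m i x y
    fin_cases i <;> simp [Function.update]
  map_update_smul' := by
    intro _ m i c x
    fin_cases i <;> simp [Function.update]
  map_eq_zero_of_eq' := by
    intro v i j h hij
    have h01 : v 0 = v 1 := by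
      fin_cases i <;> fin_cases j <;> simp_all
    simp [h01, hB]

/-- Universal property of a model of the exterior square. -/
lemma exists_lift {K V E W : Type*} [Field K] [AddCommGroup V] [Module K V]
    [FiniteDimensional K V] [AddCommGroup E] [Module K E] [AddCommGroup W] [Module K W]
    (wedge : V →ₗ[K] V →ₗ[K] E) (halt : ∀ v, wedge v v = 0)
    (hspan : Submodule.span K {x | ∃ v w, wedge v w = x} = ⊤)
    (hdim : Module.finrank K E = Nat.choose (Module.finrank K V) 2)
    [FiniteDimensional K E]
    (B : V →ₗ[K] V →ₗ[K] W) (hB : ∀ v, B v v = 0) :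
    ∃ L : E →ₗ[K] W, ∀ v w, L (wedge v w) = B v w := by
  let φ := exteriorPower.alternatingMapLinearEquiv (altOfBilin wedge halt)
  have hφ : ∀ v w, φ (exteriorPower.ιMulti K 2 ![v, w]) = wedge v w := by
    intro v w
    simp [φ, altOfBilin]
  have hsurj : Function.Surjective φ := by
    rw [← LinearMap.range_eq_top, eq_top_iff, ← hspan, Submodule.span_le]
    rintro x ⟨v, w, rfl⟩
    exact ⟨_, hφ v w⟩
  have hinj : Function.Injective φ := by
    rw [LinearMap.injective_iff_surjective_of_finrank_eq_finrank]
    · exact hsurj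
    · rw [hdim, exteriorPower.finrank_eq]
  let e := LinearEquiv.ofBijective φ ⟨hinj, hsurj⟩
  refine ⟨exteriorPower.alternatingMapLinearEquiv (altOfBilin B hB) ∘ₗ e.symm.toLinearMap, ?_⟩
  intro v w
  have : e.symm (wedge v w) = exteriorPower.ιMulti K 2 ![v, w] := by
    rw [LinearEquiv.symm_apply_eq]
    exact (hφ v w).symm
  simp [this, altOfBilin]

/-- Lucas step. -/
lemma choose_two (a b : ℕ) : ((a.choose b : ℕ) : ZMod 2) =
    (((a % 2).choose (b % 2) : ℕ) : ZMod 2) * (((a / 2).choose (b / 2) : ℕ) : ZMod 2) := by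
  have : Fact (Nat.Prime 2) := ⟨Nat.prime_two⟩
  have := (ZMod.natCast_eq_natCast_iff _ _ 2).2
    (Choose.choose_modEq_choose_mod_mul_choose_div_nat (n := a) (k := b) (p := 2))
  rw [this]; push_cast; rfl

lemma sum_range_two_mul {M : Type*} [AddCommMonoid M] (g : ℕ → M) (r : ℕ) :
    ∑ i ∈ Finset.range (2 * r), g i = ∑ i ∈ Finset.range r, (g (2 * i) + g (2 * i + 1)) := by
  induction r with
  | zero => simp
  | succ r ih => 
    rw [show 2 * (r + 1) = 2 * r + 1 + 1 by ring, Finset.sum_range_succ, Finset.sum_range_succ, ih,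
      Finset.sum_range_succ, add_assoc]

lemma choose_sum (k : ℕ) : ∀ j l : ℕ, j + l + 1 = 2 ^ k →
    ∑ i ∈ Finset.range (2 ^ k), ((i.choose j : ℕ) : ZMod 2) * ((i.choose l : ℕ) : ZMod 2) = 1 := by
  induction k with
  | zero =>
    intro j l h
    obtain ⟨rfl, rfl⟩ : j = 0 ∧ l = 0 := by simp at h; omega
    simp
  | succ k ih =>
    intro j l h
    rw [pow_succ] at h
    have h' := ih (j / 2) (l / 2) (by omega)
    rw [pow_succ, mul_comm, sum_range_two_mul, ← h']
    apply Finset.sum_congr rfl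
    intro i _
    rw [choose_two (2 * i) j, choose_two (2 * i) l, choose_two (2 * i + 1) j,
      choose_two (2 * i + 1) l]
    have e1 : (2 * i) % 2 = 0 := by omega
    have e2 : (2 * i) / 2 = i := by omega
    have e3 : (2 * i + 1) % 2 = 1 := by omega
    have e4 : (2 * i + 1) / 2 = i := by omega
    rw [e1, e2, e3, e4]
    rcases Nat.mod_two_eq_zero_or_one j with hj | hj <;>
    rcases Nat.mod_two_eq_zero_or_one l with hl | hl
    · omega
    · simp [hj, hl]
    · simp [hj, hl]
    · omega

/-- Powers of a nilpotent operator applied to a vector are independent. -/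
lemma linIndep_pow {K V : Type*} [Field K] [AddCommGroup V] [Module K V]
    (T : V →ₗ[K] V) (x : V) (c r : ℕ) (hr : (T ^ r) x = 0) (hc : ∀ i < c, (T ^ i) x ≠ 0) :
    LinearIndependent K (fun i : Fin c => (T ^ (i : ℕ)) x) := by
  classical
  have hex : ∃ r, (T ^ r) x = 0 := ⟨r, hr⟩
  set M := Nat.find hex with hM
  have hM0 : (T ^ M) x = 0 := Nat.find_spec hex
  have hlt : ∀ i < M, (T ^ i) x ≠ 0 := fun i hi => Nat.find_min hex hi
  have hbig : ∀ i, M ≤ i → (T ^ i) x = 0 := by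
    intro i hi
    rw [← Nat.sub_add_cancel hi, pow_add, Module.End.mul_apply, hM0, map_zero]
  have hcM : c ≤ M := by
    by_contra h
    exact hc M (by omega) hM0
  rw [Fintype.linearIndependent_iff]
  intro g hg
  have key : ∀ s : ℕ, ∀ i : Fin c, (i : ℕ) = s → g i = 0 := by
    intro s
    induction s using Nat.strong_induction_on with
    | _ s ih =>
      intro i hi
      have h1 := congrArg (T ^ (M - 1 - s)) hg
      rw [map_sum, map_zero, Finset.sum_eq_single i] at h1
      · rw [map_smul, ← Module.End.mul_apply, ← pow_add] at h1
        have := hlt (M - 1 - s + i) (by have := i.2; omega)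
        exact (smul_eq_zero.1 h1).resolve_right this
      · intro b _ hb
        rcases lt_trichotomy (b : ℕ) s with hbs | hbs | hbs
        · rw [ih b hbs b rfl]; simp
        · exact absurd (Fin.ext (by omega)) hb
        · rw [map_smul, ← Module.End.mul_apply, ← pow_add, hbig _ (by omega), smul_zero]
      · simp
  exact fun i => key i i rfl

/-- In characteristic two, `(x - 1)^(2^k - 1)` is a geometric sum. -/
lemma pow_sub_one_eq_sum {K V : Type*} [Field K] [CharP K 2] [AddCommGroup V] [Module K V]
    (T : V →ₗ[K] V) (k : ℕ) :
    (T - 1) ^ (2 ^ k - 1) = ∑ i ∈ Finset.range (2 ^ k), T ^ i := by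
  have : Fact (Nat.Prime 2) := ⟨Nat.prime_two⟩
  have h : ((Polynomial.X - 1 : Polynomial K)) ^ (2 ^ k - 1) =
      ∑ i ∈ Finset.range (2 ^ k), Polynomial.X ^ i := by
    have hne : (Polynomial.X - 1 : Polynomial K) ≠ 0 := by
      simpa using Polynomial.X_sub_C_ne_zero (1 : K)
    apply mul_right_cancel₀ hne
    rw [geom_sum_mul, ← pow_succ, Nat.sub_add_cancel Nat.one_le_two_pow, sub_pow_char_pow, one_pow]
  simpa using congrArg (Polynomial.aeval T) h

lemma pow_sub_one_eq {K V : Type*} [Field K] [CharP K 2] [AddCommGroup V] [Module K V]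
    (T : V →ₗ[K] V) (k : ℕ) :
    (T - 1) ^ (2 ^ k) = T ^ (2 ^ k) - 1 := by
  have : Fact (Nat.Prime 2) := ⟨Nat.prime_two⟩
  have h : ((Polynomial.X - 1 : Polynomial K)) ^ (2 ^ k) = Polynomial.X ^ (2 ^ k) - 1 := by
    rw [sub_pow_char_pow, one_pow]
  simpa using congrArg (Polynomial.aeval T) h

lemma finrank_map_add {K V : Type*} [Field K] [AddCommGroup V] [Module K V]
    [FiniteDimensional K V] (f : V →ₗ[K] V) (A : Submodule K V) :
    Module.finrank K (A.map f) + Module.finrank K (A ⊓ LinearMap.ker f : Submodule K V) =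
      Module.finrank K A := by
  have h := (f.domRestrict A).finrank_range_add_finrank_ker
  rw [LinearMap.range_domRestrict] at h
  rw [← h]
  congr 1
  have : (LinearMap.ker (f.domRestrict A)).map A.subtype = A ⊓ LinearMap.ker f := by
    ext x; simp [LinearMap.mem_ker, and_comm]
  rw [← this]
  exact (Submodule.equivMapOfInjective _ A.injective_subtype _).finrank_eq.symm

lemma rank_step {K V : Type*} [Field K] [AddCommGroup V] [Module K V]
    [FiniteDimensional K V] (f : V →ₗ[K] V) (d : ℕ) :
    Module.finrank K (LinearMap.range (f ^ (d + 1))) +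
      Module.finrank K (LinearMap.range (f ^ d) ⊓ LinearMap.ker f : Submodule K V) =
      Module.finrank K (LinearMap.range (f ^ d)) := by
  have h := finrank_map_add f (LinearMap.range (f ^ d))
  rw [← LinearMap.range_comp, ← Module.End.mul_eq_comp, ← pow_succ'] at h
  exact h

end Helpers

section KeyLemma

lemma charTwo_add_self {K V : Type*} [Field K] [CharP K 2] [AddCommGroup V] [Module K V]
    (x : V) : x + x = 0 := by
  rw [← two_smul K x, CharTwo.two_eq_zero, zero_smul]

lemma apply_pow_unip {K V : Type*} [Field K] [AddCommGroup V] [Module K V]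
    (U : V →ₗ[K] V) (lam : V →ₗ[K] K) (e : V) (m p : ℕ) (hp : p < m)
    (hlam : ∀ j, lam (((U - 1) ^ j) e) = if j = m - 1 then 1 else 0) (i : ℕ) :
    lam (((U - 1) ^ p) ((U ^ i) e)) = ((i.choose (m - 1 - p) : ℕ) : K) := by
  have hU : U ^ i = ∑ j ∈ Finset.range (i + 1), (i.choose j) • (U - 1) ^ j := by
    conv_lhs => rw [show U = (U - 1) + 1 by abel]
    rw [(Commute.one_right (U - 1)).add_pow]
    apply Finset.sum_congr rfl
    intro j _
    rw [one_pow, mul_one, nsmul_eq_mul, Nat.cast_comm]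
  rw [hU]
  simp only [LinearMap.sum_apply, LinearMap.smul_apply, map_sum, map_nsmul]
  have : ∀ j, lam (((U - 1) ^ p) (((U - 1) ^ j) e)) = if j = m - 1 - p then 1 else 0 := by
    intro j
    rw [← Module.End.mul_apply, ← pow_add, hlam]
    congr 1
    apply propext
    omega
  simp only [this]
  simp only [smul_ite, smul_zero, nsmul_eq_mul, mul_one]
  rw [Finset.sum_ite_eq']
  split_ifs with h
  · rfl
  · rw [Nat.choose_eq_zero_of_lt (by simp at h; omega)]; simp

lemma key_lemma {K V E : Type*} [Field K] [CharP K 2] [AddCommGroup V] [Module K V]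
    [AddCommGroup E] [Module K E] [FiniteDimensional K E]
    (U Ui : V →ₗ[K] V) (h1 : U * Ui = 1) (h2 : Ui * U = 1) (hnil : ∃ r, (U - 1) ^ r = 0)
    (lam : V →ₗ[K] K) (e : V) (m k c : ℕ) (hmq : m ≤ 2 ^ k) (hc : 2 * c + 1 + 2 ^ k ≤ 2 * m)
    (hlam : ∀ j, lam (((U - 1) ^ j) e) = if j = m - 1 then 1 else 0)
    (hUe : (U ^ (2 ^ k)) e = e)
    (wedge : V →ₗ[K] V →ₗ[K] E) (uE : E →ₗ[K] E)
    (huE : ∀ v w, uE (wedge v w) = wedge (U v) (U w))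
    (L : E →ₗ[K] V) (hL : ∀ v w, L (wedge v w) = lam v • w + lam w • v) :
    c ≤ Module.finrank K
      (LinearMap.range ((uE - 1) ^ (2 ^ k - 1)) ⊓ LinearMap.ker (uE - 1) : Submodule K E) := by
  have hcomm : Commute U Ui := by rw [Commute, SemiconjBy, h1, h2]
  set Y : Submodule K E :=
    LinearMap.range ((uE - 1) ^ (2 ^ k - 1)) ⊓ LinearMap.ker (uE - 1) with hY
  -- powers of uE
  have huEp : ∀ i v w, (uE ^ i) (wedge v w) = wedge ((U ^ i) v) ((U ^ i) w) := by
    intro i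
    induction i with
    | zero => simp
    | succ i ih =>
      intro v w
      rw [pow_succ', Module.End.mul_apply, ih, huE, pow_succ']
      rfl
  set es : V := ∑ i ∈ Finset.range (2 ^ k), lam ((U ^ i) e) • (U ^ i) e with hes
  -- cyclic shift
  have hshift : ∀ j, ∑ i ∈ Finset.range (2 ^ k), lam ((U ^ (i + j)) e) • (U ^ (i + j)) e = es := by
    intro j
    induction j with
    | zero => simp [hes]
    | succ j ih =>
      rw [← ih]
      have e1 := Finset.sum_range_succ (fun i => lam ((U ^ (i + j)) e) • (U ^ (i + j)) e) (2 ^ k)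
      have e2 := Finset.sum_range_succ' (fun i => lam ((U ^ (i + j)) e) • (U ^ (i + j)) e) (2 ^ k)
      have e3 : (U ^ (2 ^ k + j)) e = (U ^ (0 + j)) e := by
        rw [add_comm, pow_add, Module.End.mul_apply, hUe, zero_add]
      rw [e1, e3] at e2
      have := add_right_cancel e2
      rw [this]
      apply Finset.sum_congr rfl
      intro i _
      rw [show i + (j + 1) = i + 1 + j by ring]
  have hUiU : ∀ j, Ui ^ j * U ^ j = 1 := by
    intro j
    rw [← hcomm.symm.mul_pow, h2, one_pow]
  -- the image under L
  have hLY : ∀ j, (U ^ j + Ui ^ j) es ∈ Y.map L := by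
    intro j
    refine Submodule.mem_map.2 ⟨((uE - 1 : E →ₗ[K] E) ^ (2 ^ k - 1)) (wedge e ((U ^ j) e)),
      ⟨⟨_, rfl⟩, ?_⟩, ?_⟩
    · rw [SetLike.mem_coe, LinearMap.mem_ker, ← Module.End.mul_apply, ← pow_succ',
        Nat.sub_add_cancel Nat.one_le_two_pow, pow_sub_one_eq, LinearMap.sub_apply, huEp, hUe,
        ← Module.End.mul_apply, ← pow_add, add_comm, pow_add, Module.End.mul_apply, hUe]
      simp
    · rw [pow_sub_one_eq_sum, LinearMap.sum_apply, map_sum]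
      simp only [huEp, hL]
      rw [Finset.sum_add_distrib, LinearMap.add_apply]
      congr 1
      · rw [hes, map_sum]
        apply Finset.sum_congr rfl
        intro i _
        rw [map_smul, ← Module.End.mul_apply, ← Module.End.mul_apply, ← pow_add, ← pow_add,
          add_comm]
      · rw [← hshift j, map_sum]
        apply Finset.sum_congr rfl
        intro i _
        rw [map_smul, ← Module.End.mul_apply, ← Module.End.mul_apply, ← pow_add]
        congr 1
        rw [add_comm i j, pow_add, ← mul_assoc, hUiU, one_mul]
  set T : V →ₗ[K] V := U + Ui with hT
  have hTeq : T = Ui * (U - 1) ^ 2 := by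
    have : (U - 1) ^ 2 = U * U + 1 := by
      have := pow_sub_one_eq U 1
      rw [pow_one] at this
      rw [this]
      ext x
      have h := charTwo_add_self (K := K) x
      simp only [pow_two, LinearMap.sub_apply, LinearMap.add_apply, Module.End.one_apply]
      rw [sub_eq_add_neg, neg_eq_of_add_eq_zero_left h]
    rw [this, mul_add, ← mul_assoc, h2, one_mul, mul_one]
  have hcommN : Commute Ui (U - 1) := by
    exact (hcomm.symm).sub_right (Commute.one_right _)
  have hTpow : ∀ j, T ^ j = Ui ^ j * (U - 1) ^ (2 * j) := by
    intro j
    rw [hTeq, (hcommN.pow_right 2).mul_pow, ← pow_mul]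
  -- T-stability
  set S : Submodule K V := Submodule.span K (Set.range fun j : ℕ => (U ^ j + Ui ^ j) es) with hS
  have hSle : S ≤ Y.map L := by
    rw [hS, Submodule.span_le]
    rintro _ ⟨j, rfl⟩
    exact hLY j
  have hmemS : ∀ j : ℕ, (U ^ j + Ui ^ j) es ∈ S := fun j => Submodule.subset_span ⟨j, rfl⟩
  have hTS : ∀ x ∈ S, T x ∈ S := by
    intro x hx
    induction hx using Submodule.span_induction with
    | mem x hx =>
      obtain ⟨j, rfl⟩ := hx
      cases j with
      | zero =>
        have : ((U ^ 0 + Ui ^ 0) es) = 0 := by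
          simp only [pow_zero, LinearMap.add_apply, Module.End.one_apply]
          exact charTwo_add_self (K := K) es
        simp only [this, map_zero]
        exact S.zero_mem
      | succ j =>
        have : T * (U ^ (j + 1) + Ui ^ (j + 1)) = (U ^ (j + 2) + Ui ^ (j + 2)) + (U ^ j + Ui ^ j) := by
          rw [hT, add_mul, mul_add, mul_add, ← pow_succ', ← pow_succ',
            show U * Ui ^ (j + 1) = Ui ^ j by rw [pow_succ', ← mul_assoc, h1, one_mul],
            show Ui * U ^ (j + 1) = U ^ j by rw [pow_succ', ← mul_assoc, h2, one_mul]]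
          abel
        have := congrArg (fun F : V →ₗ[K] V => F es) this
        simp only [Module.End.mul_apply] at this
        simp only [this]
        exact S.add_mem (hmemS _) (hmemS _)
    | zero => simp
    | add x y _ _ hx hy => rw [map_add]; exact S.add_mem hx hy
    | smul a x _ hx => rw [map_smul]; exact S.smul_mem a hx
  have hTpS : ∀ j : ℕ, (T ^ j) (T es) ∈ S := by
    intro j
    induction j with
    | zero => simpa [hT] using hmemS 1
    | succ j ih =>
      rw [pow_succ', Module.End.mul_apply]
      exact hTS _ ih
  -- non-vanishing
  have hval : lam (((U - 1) ^ (2 * m - 1 - 2 ^ k)) es) = 1 := by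
    rw [hes, map_sum, map_sum]
    have : ∀ i ∈ Finset.range (2 ^ k),
        lam (((U - 1) ^ (2 * m - 1 - 2 ^ k)) (lam ((U ^ i) e) • (U ^ i) e)) =
        (ZMod.castHom (dvd_refl 2) K)
          (((i.choose (m - 1) : ℕ) : ZMod 2) * ((i.choose (2 ^ k - m) : ℕ) : ZMod 2)) := by
      intro i _
      rw [map_smul, map_smul, apply_pow_unip U lam e m _ (by omega) hlam]
      have h0 := apply_pow_unip U lam e m 0 (by omega) hlam i
      simp only [pow_zero, Module.End.one_apply] at h0
      rw [h0, show m - 1 - (2 * m - 1 - 2 ^ k) = 2 ^ k - m by omega]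
      simp
    rw [Finset.sum_congr rfl this, ← map_sum, choose_sum k _ _ (by omega), map_one]
  have hNne : ((U - 1) ^ (2 * m - 1 - 2 ^ k)) es ≠ 0 := by
    intro h
    rw [h, map_zero] at hval
    exact zero_ne_one hval
  have hTne : ∀ i < c, (T ^ i) (T es) ≠ 0 := by
    intro i hi h
    rw [← Module.End.mul_apply, ← pow_succ, hTpow] at h
    apply hNne
    have hUU : U ^ (i + 1) * Ui ^ (i + 1) = 1 := by
      rw [← hcomm.mul_pow, h1, one_pow]
    have h3 := congrArg (U ^ (i + 1)) h
    rw [map_zero, ← Module.End.mul_apply, ← mul_assoc, hUU, one_mul] at h3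
    rw [show 2 * m - 1 - 2 ^ k = (2 * m - 1 - 2 ^ k - 2 * (i + 1)) + 2 * (i + 1) by omega,
      pow_add, Module.End.mul_apply, h3, map_zero]
  obtain ⟨r, hr⟩ := hnil
  have hli := linIndep_pow T (T es) c r (by
    rw [hTpow, two_mul, pow_add, hr]; simp) hTne
  have hle : Submodule.span K (Set.range fun i : Fin c => (T ^ (i : ℕ)) (T es)) ≤ Y.map L := by
    refine le_trans ?_ hSle
    rw [Submodule.span_le]
    rintro _ ⟨i, rfl⟩
    exact hTpS i
  calc c = Module.finrank K
        (Submodule.span K (Set.range fun i : Fin c => (T ^ (i : ℕ)) (T es))) := by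
        rw [finrank_span_eq_card hli, Fintype.card_fin]
    _ ≤ Module.finrank K (Y.map L) := Submodule.finrank_mono hle
    _ ≤ Module.finrank K Y := Submodule.finrank_map_le L Y

end KeyLemma

section CaseB

lemma wedge_swap {K V E : Type*} [Field K] [AddCommGroup V] [Module K V]
    [AddCommGroup E] [Module K E] (wedge : V →ₗ[K] V →ₗ[K] E) (halt : ∀ v, wedge v v = 0)
    (v w : V) : wedge v w = - wedge w v := by
  have h := halt (v + w)
  simp only [map_add, LinearMap.add_apply, halt, zero_add, add_zero] at h
  exact eq_neg_of_add_eq_zero_left (by rw [add_comm]; exact h)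

/-- If `dim V = h + 2`, there are at most two blocks of size larger than `h = 2 ^ k`. -/
lemma upper_bound {K V E : Type*} [Field K] [CharP K 2] [AddCommGroup V] [Module K V]
    [AddCommGroup E] [Module K E] [FiniteDimensional K E]
    (U : V →ₗ[K] V) (e e1 e2 : V) (k : ℕ)
    (he1 : U e1 = e1) (he2 : U e2 = e2 + e1)
    (hN : ∀ v, ∃ (v' : V) (a : K), v = (U - 1) v' + a • e)
    (hM : ∀ v, ∃ a b : K, ((U - 1 : V →ₗ[K] V) ^ (2 ^ k)) v = a • e1 + b • e2)
    (wedge : V →ₗ[K] V →ₗ[K] E) (halt : ∀ v, wedge v v = 0)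
    (hspan : Submodule.span K {x | ∃ v w, wedge v w = x} = ⊤)
    (uE : E →ₗ[K] E) (huE : ∀ v w, uE (wedge v w) = wedge (U v) (U w)) :
    Module.finrank K
      (LinearMap.range ((uE - 1) ^ (2 ^ k)) ⊓ LinearMap.ker (uE - 1) : Submodule K E) ≤ 2 := by
  set A : Submodule K E := LinearMap.range (wedge e1) ⊔ LinearMap.range (wedge e2) with hA
  have hA1 : ∀ v, wedge e1 v ∈ A := fun v => Submodule.mem_sup_left ⟨v, rfl⟩
  have hA2 : ∀ v, wedge e2 v ∈ A := fun v => Submodule.mem_sup_right ⟨v, rfl⟩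
  have huEp : ∀ i v w, (uE ^ i) (wedge v w) = wedge ((U ^ i) v) ((U ^ i) w) := by
    intro i
    induction i with
    | zero => simp
    | succ i ih =>
      intro v w
      rw [pow_succ', Module.End.mul_apply, ih, huE, pow_succ']
      rfl
  have hAM : ∀ v w, wedge (((U - 1 : V →ₗ[K] V) ^ (2 ^ k)) v) w ∈ A := by
    intro v w
    obtain ⟨a, b, hab⟩ := hM v
    rw [hab, map_add, map_smul, map_smul]
    exact A.add_mem (A.smul_mem _ (hA1 _)) (A.smul_mem _ (hA2 _))
  have hrange : LinearMap.range ((uE - 1) ^ (2 ^ k)) ≤ A := by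
    rw [LinearMap.range_eq_map, ← hspan, Submodule.map_span, Submodule.span_le]
    rintro _ ⟨_, ⟨v, w, rfl⟩, rfl⟩
    rw [pow_sub_one_eq, LinearMap.sub_apply, huEp]
    have hU : ∀ x, (U ^ (2 ^ k)) x = x + ((U - 1 : V →ₗ[K] V) ^ (2 ^ k)) x := by
      intro x
      rw [pow_sub_one_eq]
      simp
    rw [hU v, hU w]
    set Mv := ((U - 1 : V →ₗ[K] V) ^ (2 ^ k)) v with hMv
    set Mw := ((U - 1 : V →ₗ[K] V) ^ (2 ^ k)) w with hMw
    have : wedge (v + Mv) (w + Mw) - (1 : E →ₗ[K] E) (wedge v w) =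
        wedge Mv w + (- wedge Mw v) + wedge Mv Mw := by
      rw [← wedge_swap wedge halt v Mw]
      simp only [map_add, LinearMap.add_apply, Module.End.one_apply]
      abel
    rw [this]
    exact A.add_mem (A.add_mem (hAM _ _) (A.neg_mem (hAM _ _))) (hAM _ _)
  set P : Submodule K E := Submodule.span K {wedge e1 e, wedge e2 e} with hP
  have hP1 : wedge e1 e ∈ P := Submodule.subset_span (by simp)
  have hP2 : wedge e2 e ∈ P := Submodule.subset_span (by simp)
  have hPr : Module.finrank K P ≤ 2 := by
    classical
    have h := finrank_span_finset_le_card (R := K) ({wedge e1 e, wedge e2 e} : Finset E)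
    rw [Finset.coe_pair] at h
    exact h.trans Finset.card_le_two
  have hQ1 : ∀ v, wedge e1 v ∈ A.map (uE - 1) ⊔ P := by
    intro v
    obtain ⟨v', a, rfl⟩ := hN v
    have : wedge e1 ((U - 1) v') = (uE - 1) (wedge e1 v') := by
      simp [huE, he1]
    rw [map_add, map_smul, this]
    exact Submodule.add_mem_sup (Submodule.mem_map_of_mem (hA1 _)) (P.smul_mem _ hP1)
  have hQ2 : ∀ v, wedge e2 v ∈ A.map (uE - 1) ⊔ P := by
    intro v
    obtain ⟨v', a, rfl⟩ := hN v
    have : wedge e2 ((U - 1) v') = (uE - 1) (wedge e2 v') - wedge e1 (U v') := by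
      simp [huE, he2]
      abel
    rw [map_add, map_smul, this]
    refine Submodule.add_mem _ (Submodule.sub_mem _ (Submodule.mem_sup_left
      (Submodule.mem_map_of_mem (hA2 _))) (hQ1 _)) (Submodule.mem_sup_right (P.smul_mem _ hP2))
  have hAle : A ≤ A.map (uE - 1) ⊔ P := by
    refine sup_le ?_ ?_
    · rintro _ ⟨v, rfl⟩; exact hQ1 v
    · rintro _ ⟨v, rfl⟩; exact hQ2 v
  have i1 := Submodule.finrank_mono hAle
  have i2 := Submodule.finrank_add_le_finrank_add_finrank (A.map (uE - 1)) P
  have i3 := finrank_map_add (uE - 1) A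
  have i4 : Module.finrank K
      (LinearMap.range ((uE - 1) ^ (2 ^ k)) ⊓ LinearMap.ker (uE - 1) : Submodule K E) ≤
      Module.finrank K (A ⊓ LinearMap.ker (uE - 1) : Submodule K E) :=
    Submodule.finrank_mono (inf_le_inf_right _ hrange)
  omega

/-- Arithmetic of `n`. -/
lemma arith (n : ℕ) (hn : 1 ≤ n) (h : ¬ (n = 1 ∨ n = 2 ∨ n = 3 ∨ n = 5)) :
    (∃ k, 2 * n ≤ 2 ^ k ∧ 2 * 3 + 1 + 2 ^ k ≤ 2 * (2 * n)) ∨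
      (∃ k, 4 ≤ k ∧ 2 * n = 2 ^ k + 2) := by
  obtain ⟨k, hk1, hk2⟩ : ∃ k, 2 ^ k < n ∧ n ≤ 2 ^ (k + 1) := by
    refine ⟨Nat.log 2 (n - 1), ?_, ?_⟩
    · have := Nat.pow_log_le_self 2 (x := n - 1) (by omega)
      omega
    · have := Nat.lt_pow_succ_log_self (b := 2) (by norm_num) (n - 1)
      rw [Nat.succ_eq_add_one] at this
      omega
  by_cases h2 : 2 ^ k + 2 ≤ n
  · left
    refine ⟨k + 2, ?_, ?_⟩ <;> rw [pow_succ] <;> [skip; rw [pow_succ]] <;> omega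
  · right
    have hn' : n = 2 ^ k + 1 := by omega
    refine ⟨k + 1, ?_, by rw [pow_succ]; omega⟩
    by_contra hk
    have : k < 3 := by omega
    interval_cases k <;> simp_all

end CaseB

/-- if every Jordan block size of the exterior square of a single unipotent
Jordan block of size `2n` over `K` has multiplicity at most 2, then `n ∈ {1, 2, 3, 5}`. -/
theorem exterior_square_multiplicity_at_most_two
    (K : Type*) [Field K] [IsAlgClosed K] [CharP K 2]
    (V : Type*) [AddCommGroup V] [Module K V] [FiniteDimensional K V]
    (n : ℕ) (hn : 1 ≤ n)
    (u : V ≃ₗ[K] V)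
    (hdim : Module.finrank K V = 2 * n)
    (hb : ((u : V →ₗ[K] V) - 1) ^ (2 * n - 1) ≠ 0)
    (hb' : ((u : V →ₗ[K] V) - 1) ^ (2 * n) = 0)
    (E : Type*) [AddCommGroup E] [Module K E]
    (wedge : V →ₗ[K] V →ₗ[K] E) (hE : IsExteriorSquare K wedge)
    (uE : E →ₗ[K] E) (huE : ∀ v w, uE (wedge v w) = wedge (u v) (u w))
    (hmult : ∀ d : ℕ, 1 ≤ d → jordanMult K (uE - 1) d ≤ 2) :
    n = 1 ∨ n = 2 ∨ n = 3 ∨ n = 5 := by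
  by_contra hcon
  obtain ⟨halt, hspan, hEdim⟩ := hE
  have hEpos : 0 < Module.finrank K E := by
    rw [hEdim, hdim]
    exact Nat.choose_pos (by omega)
  have hEfin : FiniteDimensional K E := Module.finite_of_finrank_pos hEpos
  set U : V →ₗ[K] V := (u : V →ₗ[K] V) with hU
  set Ui : V →ₗ[K] V := (u.symm : V →ₗ[K] V) with hUi
  have h1 : U * Ui = 1 := by ext x; simp [hU, hUi]
  have h2 : Ui * U = 1 := by ext x; simp [hU, hUi]
  have huE' : ∀ v w, uE (wedge v w) = wedge (U v) (U w) := huE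
  obtain ⟨e, he⟩ : ∃ e, ((U - 1 : V →ₗ[K] V) ^ (2 * n - 1)) e ≠ 0 := by
    by_contra! h
    exact hb (LinearMap.ext h)
  have hzero : ∀ j, 2 * n ≤ j → (U - 1) ^ j = 0 := by
    intro j hj
    rw [← Nat.sub_add_cancel hj, pow_add, hb', mul_zero]
  have hli : LinearIndependent K (fun i : Fin (2 * n) => ((U - 1 : V →ₗ[K] V) ^ (i : ℕ)) e) := by
    refine linIndep_pow (U - 1) e (2 * n) (2 * n) (by rw [hb']; rfl) ?_
    intro i hi h
    apply he
    rw [show 2 * n - 1 = (2 * n - 1 - i) + i by omega, pow_add, Module.End.mul_apply, h, map_zero]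
  have : Nonempty (Fin (2 * n)) := ⟨⟨0, by omega⟩⟩
  let b := basisOfLinearIndependentOfCardEqFinrank hli (by rw [hdim, Fintype.card_fin])
  have hbi : ∀ i : Fin (2 * n), b i = ((U - 1 : V →ₗ[K] V) ^ (i : ℕ)) e := by
    intro i
    simp [b]
  let lam : V →ₗ[K] K := b.coord ⟨2 * n - 1, by omega⟩
  have hlam : ∀ j, lam (((U - 1 : V →ₗ[K] V) ^ j) e) = if j = 2 * n - 1 then 1 else 0 := by
    intro j
    by_cases hj : j < 2 * n
    · rw [← hbi ⟨j, hj⟩]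
      simp only [lam, Module.Basis.coord_apply, Module.Basis.repr_self, Finsupp.single_apply,
        Fin.mk.injEq]
    · rw [hzero j (by omega), if_neg (by omega)]
      simp
  let B : V →ₗ[K] V →ₗ[K] V :=
    LinearMap.mk₂ K (fun v w => lam v • w + lam w • v)
      (by intro x y z; simp only [map_add, add_smul, smul_add]; abel)
      (by intro c x y; simp only [map_smul, smul_add, smul_smul, smul_eq_mul, mul_comm])
      (by intro x y z; simp only [map_add, add_smul, smul_add]; abel)
      (by intro c x y; simp only [map_smul, smul_add, smul_smul, smul_eq_mul, mul_comm])
  obtain ⟨L, hL⟩ := exists_lift wedge halt hspan hEdim B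
    (by intro v; exact charTwo_add_self (K := K) _)
  have hL' : ∀ v w, L (wedge v w) = lam v • w + lam w • v := hL
  rcases arith n hn hcon with ⟨k, hk1, hk2⟩ | ⟨k, hk, hk2⟩
  · -- many blocks of the maximal size
    have hUq : U ^ (2 ^ k) = 1 := by
      have := pow_sub_one_eq U k
      rw [hzero _ hk1] at this
      exact (sub_eq_zero.1 this.symm)
    have hkey := key_lemma U Ui h1 h2 ⟨_, hb'⟩ lam e (2 * n) k 3 hk1 hk2 hlam
      (by rw [hUq]; rfl) wedge uE huE' L hL'
    have huEq : (uE - 1) ^ (2 ^ k) = 0 := by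
      have huEp : ∀ i v w, (uE ^ i) (wedge v w) = wedge ((U ^ i) v) ((U ^ i) w) := by
        intro i
        induction i with
        | zero => simp
        | succ i ih =>
          intro v w
          rw [pow_succ', Module.End.mul_apply, ih, huE', pow_succ']
          rfl
      rw [pow_sub_one_eq, sub_eq_zero]
      apply LinearMap.ext_on hspan
      rintro _ ⟨v, w, rfl⟩
      rw [huEp, hUq]
      rfl
    have hm := hmult (2 ^ k) Nat.one_le_two_pow
    have hs := rank_step (uE - 1) (2 ^ k - 1)
    rw [Nat.sub_add_cancel Nat.one_le_two_pow] at hs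
    unfold jordanMult at hm
    rw [pow_succ, huEq, zero_mul, LinearMap.range_zero, finrank_bot] at hm
    omega
  · -- blocks of size `2 ^ k`
    have h16 : 2 ^ 4 ≤ 2 ^ k := Nat.pow_le_pow_right (by norm_num) hk
    have hlam4 : ∀ j, lam (((U - 1 : V →ₗ[K] V) ^ j) (((U - 1 : V →ₗ[K] V) ^ 4) e)) =
        if j = (2 * n - 4) - 1 then 1 else 0 := by
      intro j
      rw [← Module.End.mul_apply, ← pow_add, hlam]
      congr 1
      apply propext
      omega
    have hUe : (U ^ (2 ^ k)) (((U - 1 : V →ₗ[K] V) ^ 4) e) = ((U - 1 : V →ₗ[K] V) ^ 4) e := by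
      have h3 : ((U - 1 : V →ₗ[K] V) ^ (2 ^ k)) (((U - 1 : V →ₗ[K] V) ^ 4) e) = 0 := by
        rw [← Module.End.mul_apply, ← pow_add, hzero _ (by omega)]
        rfl
      rw [pow_sub_one_eq, LinearMap.sub_apply, sub_eq_zero] at h3
      exact h3
    have hkey := key_lemma U Ui h1 h2 ⟨_, hb'⟩ lam (((U - 1 : V →ₗ[K] V) ^ 4) e) (2 * n - 4) k 5
      (by omega) (by omega) hlam4 hUe wedge uE huE' L hL'
    have hexp : ∀ v, v = ∑ i : Fin (2 * n), b.repr v i • ((U - 1 : V →ₗ[K] V) ^ (i : ℕ)) e := by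
      intro v
      conv_lhs => rw [← b.sum_repr v]
      simp only [hbi]
    have hgen : ∀ v, ∃ (v' : V) (a : K), v = (U - 1) v' + a • e := by
      intro v
      have hmem : v ∈ LinearMap.range (U - 1) ⊔ Submodule.span K {e} := by
        rw [hexp v]
        refine Submodule.sum_mem _ fun i _ => Submodule.smul_mem _ _ ?_
        rcases Nat.eq_zero_or_pos (i : ℕ) with hi | hi
        · rw [hi]
          exact Submodule.mem_sup_right (Submodule.mem_span_singleton_self e)
        · apply Submodule.mem_sup_left
          rw [← Nat.sub_add_cancel hi, pow_succ', Module.End.mul_apply]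
          exact ⟨_, rfl⟩
      obtain ⟨x, ⟨v', rfl⟩, y, hy, hxy⟩ := Submodule.mem_sup.1 hmem
      obtain ⟨a, rfl⟩ := Submodule.mem_span_singleton.1 hy
      exact ⟨v', a, hxy.symm⟩
    have hM : ∀ v, ∃ a c : K, ((U - 1 : V →ₗ[K] V) ^ (2 ^ k)) v =
        a • ((U - 1 : V →ₗ[K] V) ^ (2 ^ k + 1)) e + c • ((U - 1 : V →ₗ[K] V) ^ (2 ^ k)) e := by
      intro v
      obtain ⟨v', a, rfl⟩ := hgen v
      obtain ⟨v'', c, rfl⟩ := hgen v'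
      refine ⟨c, a, ?_⟩
      have h3 : ((U - 1 : V →ₗ[K] V) ^ (2 ^ k)) ((U - 1) ((U - 1) v'')) = 0 := by
        rw [← Module.End.mul_apply, ← Module.End.mul_apply, ← pow_succ, ← pow_succ,
          hzero _ (by omega)]
        rfl
      rw [map_add, map_add, map_add, h3, map_smul, map_smul, map_smul, zero_add, pow_succ,
        Module.End.mul_apply]
    have hup := upper_bound U e (((U - 1 : V →ₗ[K] V) ^ (2 ^ k + 1)) e) (((U - 1 : V →ₗ[K] V) ^ (2 ^ k)) e) k
      (by
        have h3 : (U - 1) (((U - 1 : V →ₗ[K] V) ^ (2 ^ k + 1)) e) = 0 := by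
          rw [← Module.End.mul_apply, ← pow_succ', hzero _ (by omega)]
          rfl
        rw [LinearMap.sub_apply, sub_eq_zero] at h3
        exact h3)
      (by
        rw [pow_succ', Module.End.mul_apply, LinearMap.sub_apply]
        simp)
      hgen hM wedge halt hspan uE huE'
    have hm := hmult (2 ^ k) Nat.one_le_two_pow
    have hs := rank_step (uE - 1) (2 ^ k - 1)
    rw [Nat.sub_add_cancel Nat.one_le_two_pow] at hs
    have hs2 := rank_step (uE - 1) (2 ^ k)
    unfold jordanMult at hm
    omega
end

section
/- Let V be an n-dimensional K-vector space, n ≥ 2. Then: (i) b_V is an alternating bilinear form on V ⊗ V*; (ii) if n is even, then b_V is non-degenerate and Ker ψ_V = ⟨γ_V⟩^⊥; (iii) if n is odd, then the radical of b_V equals ⟨γ_V⟩ and V ⊗ V* = Ker ψ_V ⊕ ⟨γ_V⟩; and (iv) every SL(V)-invariant alternating bilinear form on V ⊗ V* is a scalar multiple of b_V. -/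
set_option maxSynthPendingDepth 3

open Module LinearMap TensorProduct in
theorem bV_aux_gl
    (K : Type*) [Field K] [IsAlgClosed K]
    (V : Type*) [AddCommGroup V] [Module K V] [FiniteDimensional K V]
    (n : ℕ) (hn : 2 ≤ n) (hdim : Module.finrank K V = n)
    (c : V ⊗[K] Module.Dual K V →ₗ[K] V ⊗[K] Module.Dual K V →ₗ[K] K)
    (hc : ∀ g : V ≃ₗ[K] V, LinearMap.det (g : V →ₗ[K] V) = 1 →
        ∀ x y, c ((TensorProduct.congr g g.symm.dualMap) x)
            ((TensorProduct.congr g g.symm.dualMap) y) = c x y)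
    (g : V ≃ₗ[K] V) (v w : V) (f h : Dual K V) :
    c (g v ⊗ₜ[K] (f ∘ₗ g.symm.toLinearMap)) (g w ⊗ₜ[K] (h ∘ₗ g.symm.toLinearMap))
      = c (v ⊗ₜ[K] f) (w ⊗ₜ[K] h) := by
  have hd : LinearMap.det (g : V →ₗ[K] V) ≠ 0 := g.isUnit_det'.ne_zero
  obtain ⟨a, ha⟩ := IsAlgClosed.exists_pow_nat_eq (LinearMap.det (g : V →ₗ[K] V))⁻¹
    (show 0 < n by omega)
  have ha0 : a ≠ 0 := by
    rintro rfl
    rw [zero_pow (by omega)] at ha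
    exact inv_ne_zero hd ha.symm
  let g' : V ≃ₗ[K] V := g.trans (LinearEquiv.smulOfNeZero K V a ha0)
  have hg' : (g' : V →ₗ[K] V) = a • (g : V →ₗ[K] V) := by
    ext x; simp [g']
  have h1 : LinearMap.det (g' : V →ₗ[K] V) = 1 := by
    rw [hg', LinearMap.det_smul, hdim, ha, inv_mul_cancel₀ hd]
  have key := hc g' h1 (v ⊗ₜ[K] f) (w ⊗ₜ[K] h)
  have hgv : ∀ v, g' v = a • g v := fun v => by simp [g']
  have hs : ∀ u, g'.symm u = a⁻¹ • g.symm u := fun u => by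
    rw [LinearEquiv.symm_apply_eq, hgv]; simp [ha0]
  have hgf : ∀ f : Dual K V, g'.symm.dualMap f = a⁻¹ • (f ∘ₗ g.symm.toLinearMap) := fun f => by
    ext u; simp [hs]
  rw [TensorProduct.congr_tmul, TensorProduct.congr_tmul, hgv, hgv, hgf, hgf] at key
  simp only [TensorProduct.smul_tmul_smul, mul_inv_cancel₀ ha0, one_smul] at key
  exact key

open Module LinearMap TensorProduct in
theorem bV_aux_basis
    (K : Type*) [Field K]
    (V : Type*) [AddCommGroup V] [Module K V]
    (n : ℕ)
    (c : V ⊗[K] Module.Dual K V →ₗ[K] V ⊗[K] Module.Dual K V →ₗ[K] K)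
    (hc : ∀ (g : V ≃ₗ[K] V) (v w : V) (f h : Dual K V),
      c (g v ⊗ₜ[K] (f ∘ₗ g.symm.toLinearMap)) (g w ⊗ₜ[K] (h ∘ₗ g.symm.toLinearMap))
      = c (v ⊗ₜ[K] f) (w ⊗ₜ[K] h))
    (e e' : Basis (Fin n) K V) (i j k l : Fin n) :
    c (e' i ⊗ₜ[K] e'.coord j) (e' k ⊗ₜ[K] e'.coord l) =
      c (e i ⊗ₜ[K] e.coord j) (e k ⊗ₜ[K] e.coord l) := by
  have key := hc (e.equiv e' (Equiv.refl _)) (e i) (e k) (e.coord j) (e.coord l)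
  have h : ∀ j, e.coord j ∘ₗ (e.equiv e' (Equiv.refl _)).symm.toLinearMap = e'.coord j := by
    intro j
    apply e'.ext
    intro m
    simp [Basis.equiv_symm, Finsupp.single_apply]
  rw [h, h] at key
  simpa using key

open Module LinearMap TensorProduct in
theorem bV_aux_coord
    (K : Type*) [Field K] [IsAlgClosed K] [CharP K 2]
    (V : Type*) [AddCommGroup V] [Module K V]
    (n : ℕ) (hn : 2 ≤ n)
    (c : V ⊗[K] Module.Dual K V →ₗ[K] V ⊗[K] Module.Dual K V →ₗ[K] K)
    (halt : ∀ x, c x x = 0)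
    (hc : ∀ (e e' : Basis (Fin n) K V) (i j k l : Fin n),
      c (e' i ⊗ₜ[K] e'.coord j) (e' k ⊗ₜ[K] e'.coord l) =
      c (e i ⊗ₜ[K] e.coord j) (e k ⊗ₜ[K] e.coord l))
    (e : Basis (Fin n) K V) :
    ∃ s : K, ∀ i j k l, c (e i ⊗ₜ[K] e.coord j) (e k ⊗ₜ[K] e.coord l) =
      s * (e.coord j (e k) * e.coord l (e i) + e.coord j (e i) * e.coord l (e k)) := by
  classical
  obtain ⟨t, ht⟩ := Set.Infinite.exists_notMem_finset (Set.infinite_univ (α := K)) ({0, 1} : Finset K)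
  obtain ⟨ht0, ht1⟩ : t ≠ 0 ∧ t ≠ 1 := by simpa using ht.2
  have ht2 : t * t ≠ 1 := by
    intro h
    rw [mul_self_eq_one_iff, CharTwo.neg_eq] at h
    tauto
  -- torus
  have torus : ∀ m i j k l : Fin n, c (e i ⊗ₜ[K] e.coord j) (e k ⊗ₜ[K] e.coord l) =
      ((if i = m then t else 1) * (if k = m then t else 1) * (if j = m then t else 1)⁻¹ *
        (if l = m then t else 1)⁻¹) * c (e i ⊗ₜ[K] e.coord j) (e k ⊗ₜ[K] e.coord l) := by
    intro m i j k l
    let w : Fin n → Kˣ := fun i => if i = m then Units.mk0 t ht0 else 1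
    have hw : ∀ i, (w i : K) = if i = m then t else 1 := fun i => by
      simp only [w]; split_ifs <;> simp
    have key := hc e (e.unitsSMul w) i j k l
    have hv : ∀ i, e.unitsSMul w i = (w i : K) • e i := fun i => by
      simp [Basis.unitsSMul_apply, Units.smul_def]
    have hf : ∀ i, (e.unitsSMul w).coord i = (w i : K)⁻¹ • e.coord i := fun i => by
      rw [Basis.coord_unitsSMul]; simp [Units.smul_def]
    rw [hv, hv, hf, hf] at key
    simp only [TensorProduct.smul_tmul_smul, map_smul, LinearMap.smul_apply, smul_eq_mul] at key
    rw [← hw, ← hw, ← hw, ← hw]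
    linear_combination (-1 : K) * key
  have killz : ∀ {u B : K}, u ≠ 1 → B = u * B → B = 0 := by
    intro u B hu h
    by_contra hB
    exact hu (mul_right_cancel₀ hB (by rw [one_mul]; exact h.symm))
  have zero1 : ∀ i j k l, ¬ (i = j ∧ k = l) → ¬ (i = l ∧ j = k) →
      c (e i ⊗ₜ[K] e.coord j) (e k ⊗ₜ[K] e.coord l) = 0 := by
    intro i j k l h1 h2
    by_cases hij : i = j
    · subst hij
      have hkl : k ≠ l := fun h => h1 ⟨rfl, h⟩
      refine killz ?_ (torus k i i k l)
      by_cases hik : i = k <;> simp [hik, hkl.symm, ht0, ht1]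
    · by_cases hil : i = l
      · subst hil
        have hjk : j ≠ k := fun h => h2 ⟨rfl, h⟩
        refine killz ?_ (torus k i j k i)
        by_cases hik : i = k <;> simp [hik, hjk, ht0, ht1]
      · refine killz ?_ (torus i i j k l)
        by_cases hik : k = i <;> simp [hik, Ne.symm hij, Ne.symm hil, ht1, ht2]
  -- transvection
  have trans : ∀ i j, i ≠ j → c (e i ⊗ₜ[K] e.coord j) (e j ⊗ₜ[K] e.coord i) =
      c (e i ⊗ₜ[K] e.coord i) (e j ⊗ₜ[K] e.coord j) := by
    intro i j hij
    have hji := hij.symm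
    let A : V →ₗ[K] V := LinearMap.id + (e.coord j).smulRight (e i)
    have hAA : A ∘ₗ A = LinearMap.id := by
      apply e.ext
      intro m
      by_cases hm : m = j
      · subst hm
        simp only [A, LinearMap.comp_apply, LinearMap.add_apply, LinearMap.id_apply,
          LinearMap.smulRight_apply, Basis.coord_apply, map_add, map_smul, Basis.repr_self,
          Finsupp.single_eq_same, one_smul, Finsupp.add_apply, Finsupp.single_eq_of_ne hji,
          add_zero]
        rw [zero_smul, add_zero, add_assoc, ← two_smul K (e i), CharTwo.two_eq_zero, zero_smul, add_zero]
      · simp [A, Finsupp.single_apply, hm]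
    let g : V ≃ₗ[K] V := LinearEquiv.ofLinearMap A A hAA hAA
    have key := hc e (e.map g) i i j i
    have hei : (e.map g) i = e i := by simp [g, A, hij]
    have hej : (e.map g) j = e j + e i := by simp [g, A]
    have hfi : (e.map g).coord i = e.coord i + e.coord j := by
      apply e.ext
      intro m
      have : g.symm (e m) = A (e m) := rfl
      by_cases hm : m = j
      · subst hm
        simp [this, A, Finsupp.single_apply, hji]
      · simp [this, A, Finsupp.single_apply, hm]
    rw [hei, hej, hfi] at key
    simp only [TensorProduct.tmul_add, TensorProduct.add_tmul, map_add,
      LinearMap.add_apply] at key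
    rw [zero1 i i j i (by simp [hji]) (by simp [hij]), zero1 i i i j (by simp [hij]) (by simp [hij]),
      zero1 i j i i (by simp [hij]) (by simp [hji]), zero1 i j j j (by simp [hij]) (by simp [hij]),
      halt, halt] at key
    simp only [zero_add, add_zero] at key
    rw [← CharTwo.add_eq_zero, ← key]
  let z0 : Fin n := ⟨0, by omega⟩
  let z1 : Fin n := ⟨1, by omega⟩
  have hz : z1 ≠ z0 := by simp [z0, z1]
  have perm : ∀ i j, i ≠ j → c (e i ⊗ₜ[K] e.coord i) (e j ⊗ₜ[K] e.coord j) =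
      c (e z0 ⊗ₜ[K] e.coord z0) (e z1 ⊗ₜ[K] e.coord z1) := by
    intro i j hij
    let σ : Equiv.Perm (Fin n) := Equiv.swap (Equiv.swap z0 i z1) j * Equiv.swap z0 i
    have h1 : σ z1 = j := by simp [σ]
    have h0 : σ z0 = i := by
      have : i ≠ Equiv.swap z0 i z1 := by
        intro h
        have h' : Equiv.swap z0 i z0 = Equiv.swap z0 i z1 := by rw [Equiv.swap_apply_left]; exact h
        exact hz ((Equiv.swap z0 i).injective h').symm
      simp only [σ, Equiv.Perm.mul_apply, Equiv.swap_apply_left]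
      exact Equiv.swap_apply_of_ne_of_ne this hij
    have key := hc e (e.reindex σ.symm) z0 z0 z1 z1
    have hf : ∀ i, (e.reindex σ.symm).coord i = e.coord (σ i) := fun i => by
      ext u; simp
    rw [hf, hf, Basis.reindex_apply, Basis.reindex_apply, Equiv.symm_symm, h0, h1] at key
    exact key
  refine ⟨c (e z0 ⊗ₜ[K] e.coord z0) (e z1 ⊗ₜ[K] e.coord z1), ?_⟩
  intro i j k l
  simp only [Basis.coord_apply, Basis.repr_self, Finsupp.single_apply]
  by_cases h1 : i = j ∧ k = l
  · obtain ⟨rfl, rfl⟩ := h1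
    by_cases hik : i = k
    · subst hik
      rw [halt]
      simp [CharTwo.add_self_eq_zero]
    · rw [perm i k hik]
      simp [hik]
  · by_cases h2 : i = l ∧ j = k
    · obtain ⟨rfl, rfl⟩ := h2
      have hij : i ≠ j := fun h => h1 ⟨h, h.symm⟩
      rw [trans i j hij, perm i j hij]
      simp [hij]
    · rw [zero1 i j k l h1 h2]
      have a1 : ¬ (k = j ∧ i = l) := fun h => h2 ⟨h.2, h.1.symm⟩
      by_cases hij : i = j <;> by_cases hkl : k = l <;> by_cases hkj : k = j <;>
        by_cases hil : i = l <;> simp only [hij, hkl, hkj, hil] at h1 a1 ⊢ <;> grind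



open Module LinearMap TensorProduct in
/-- basic properties of the alternating form `b_V` on `V ⊗ V*`:
(i) `b_V` is alternating; (ii) for `n` even it is non-degenerate and `Ker ψ_V = ⟨γ_V⟩^⊥`;
(iii) for `n` odd its radical is `⟨γ_V⟩` and `V ⊗ V* = Ker ψ_V ⊕ ⟨γ_V⟩`; (iv) every
`SL(V)`-invariant alternating bilinear form on `V ⊗ V*` is a scalar multiple of `b_V`. -/
theorem bV_properties
    (K : Type*) [Field K] [IsAlgClosed K] [CharP K 2]
    (V : Type*) [AddCommGroup V] [Module K V] [FiniteDimensional K V]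
    (n : ℕ) (hn : 2 ≤ n) (hdim : Module.finrank K V = n)
    -- ψ_V, characterized on pure tensors by ψ_V(v ⊗ f) = f(v)
    (ψ : V ⊗[K] Module.Dual K V →ₗ[K] K)
    (hψ : ∀ (v : V) (f : Module.Dual K V), ψ (v ⊗ₜ[K] f) = f v)
    -- b_V = b̂_V + ψ_V·ψ_V, characterized on pure tensors
    (bV : V ⊗[K] Module.Dual K V →ₗ[K] V ⊗[K] Module.Dual K V →ₗ[K] K)
    (hbV : ∀ (v : V) (f : Module.Dual K V) (v' : V) (f' : Module.Dual K V),
      bV (v ⊗ₜ[K] f) (v' ⊗ₜ[K] f') = f v' * f' v + f v * f' v')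
    -- γ_V = ∑ eᵢ ⊗ eᵢ*
    (γ : V ⊗[K] Module.Dual K V) (e : Basis (Fin n) K V)
    (hγ : γ = ∑ i, e i ⊗ₜ[K] e.coord i) :
    -- (i)
    (∀ x, bV x x = 0) ∧
    -- (ii)
    (2 ∣ n →
      (∀ x, (∀ y, bV x y = 0) → x = 0) ∧
      (∀ x, ψ x = 0 ↔ bV x γ = 0)) ∧
    -- (iii)
    (¬ 2 ∣ n →
      (∀ x, (∀ y, bV x y = 0) ↔ x ∈ Submodule.span K {γ}) ∧
      IsCompl (LinearMap.ker ψ) (Submodule.span K {γ})) ∧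
    -- (iv)
    (∀ c : V ⊗[K] Module.Dual K V →ₗ[K] V ⊗[K] Module.Dual K V →ₗ[K] K,
      (∀ x, c x x = 0) →
      (∀ g : V ≃ₗ[K] V, LinearMap.det (g : V →ₗ[K] V) = 1 →
        ∀ x y, c ((TensorProduct.congr g g.symm.dualMap) x)
            ((TensorProduct.congr g g.symm.dualMap) y) = c x y) →
      ∃ s : K, ∀ x y, c x y = s * bV x y) := by
  have hψγ : ψ γ = n := by
    rw [hγ]; simp [hψ]
  have hsymm : ∀ x y, bV x y = bV y x := by
    intro x y
    induction x using TensorProduct.induction_on with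
    | zero => simp
    | add a b ha hb => simp [ha, hb]
    | tmul v f =>
      induction y using TensorProduct.induction_on with
      | zero => simp
      | add a b ha hb => simp [ha, hb]
      | tmul w h => rw [hbV, hbV]; ring
  have hbγ : ∀ x, bV x γ = ((n : K) + 1) * ψ x := by
    intro x
    induction x using TensorProduct.induction_on with
    | zero => simp
    | add a b ha hb => simp only [map_add, LinearMap.add_apply, ha, hb]; ring
    | tmul v f =>
      rw [hγ, map_sum, hψ]
      simp only [hbV, Finset.sum_add_distrib]
      have : ∑ i, f (e i) * e.coord i v = f v := by
        conv_rhs => rw [← e.sum_repr v, map_sum]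
        simp only [map_smul, smul_eq_mul, mul_comm, Basis.coord_apply]
      rw [this]
      simp
      ring
  have hrec : ∀ x, ∑ k, ∑ l, bV x (e l ⊗ₜ[K] e.coord k) • (e k ⊗ₜ[K] e.coord l) = x + ψ x • γ := by
    intro x
    induction x using TensorProduct.induction_on with
    | zero => simp
    | add a b ha hb =>
      simp only [map_add, LinearMap.add_apply, add_smul, Finset.sum_add_distrib, ha, hb]
      abel
    | tmul v f =>
      simp only [hbV, add_smul, Finset.sum_add_distrib, hψ]
      congr 1
      · have h1 : v = ∑ k, e.coord k v • e k := by simpa using (e.sum_repr v).symm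
        have h2 : f = ∑ l, f (e l) • e.coord l := by
          apply e.ext
          intro m
          simp [Finsupp.single_apply]
        conv_rhs => rw [h1, h2]
        rw [TensorProduct.sum_tmul]
        refine Finset.sum_congr rfl fun k _ => ?_
        rw [TensorProduct.tmul_sum]
        refine Finset.sum_congr rfl fun l _ => ?_
        rw [TensorProduct.smul_tmul_smul, mul_comm]
      · rw [hγ, Finset.smul_sum]
        refine Finset.sum_congr rfl fun k _ => ?_
        simp [Finsupp.single_apply]
  have hrad : ∀ x, (∀ y, bV x y = 0) → x = -(ψ x • γ) := by
    intro x hx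
    have := hrec x
    simp only [hx, zero_smul, Finset.sum_const_zero] at this
    exact eq_neg_of_add_eq_zero_left this.symm
  refine ⟨?_, ?_, ?_, ?_⟩
  · intro x
    induction x using TensorProduct.induction_on with
    | zero => simp
    | add a b ha hb =>
      simp only [map_add, LinearMap.add_apply, ha, hb, hsymm b a]
      simp [CharTwo.add_self_eq_zero]
    | tmul v f => rw [hbV]; exact CharTwo.add_self_eq_zero _
  · intro h2
    have hn0 : (n : K) = 0 := (CharP.cast_eq_zero_iff K 2 n).2 h2
    have hb : ∀ x, bV x γ = ψ x := fun x => by rw [hbγ, hn0]; ring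
    refine ⟨fun x hx => ?_, fun x => by rw [hb]⟩
    have h := hrad x hx
    rw [← hb, hx] at h
    simpa using h
  · intro h2
    have hn1 : (n : K) = 1 := by
      obtain ⟨m, rfl⟩ : Odd n := by rwa [← Nat.not_even_iff_odd, even_iff_two_dvd]
      push_cast
      rw [CharTwo.two_eq_zero]; ring
    have hb : ∀ x, bV x γ = 0 := fun x => by
      rw [hbγ, hn1, CharTwo.add_self_eq_zero, zero_mul]
    rw [hn1] at hψγ
    refine ⟨fun x => ⟨fun hx => ?_, fun hx y => ?_⟩, ?_⟩
    · rw [hrad x hx]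
      exact neg_mem (Submodule.smul_mem _ _ (Submodule.mem_span_singleton_self γ))
    · obtain ⟨a, rfl⟩ := Submodule.mem_span_singleton.1 hx
      simp [hsymm γ y, hb]
    · constructor
      · rw [Submodule.disjoint_def]
        intro x hx hx'
        obtain ⟨a, rfl⟩ := Submodule.mem_span_singleton.1 hx'
        have : a = 0 := by simpa [hψγ] using hx
        simp [this]
      · rw [codisjoint_iff, eq_top_iff]
        intro x _
        rw [Submodule.mem_sup]
        exact ⟨x - ψ x • γ, by simp [hψγ], ψ x • γ,
          Submodule.smul_mem _ _ (Submodule.mem_span_singleton_self γ), by simp⟩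
  · intro c halt hc
    obtain ⟨s, hs⟩ := bV_aux_coord K V n hn c halt
      (bV_aux_basis K V n c (bV_aux_gl K V n hn hdim c hc)) e
    refine ⟨s, ?_⟩
    have : c = s • bV := by
      refine (e.tensorProduct e.dualBasis).ext fun p => ?_
      refine (e.tensorProduct e.dualBasis).ext fun q => ?_
      have := hs p.1 p.2 q.1 q.2
      simp only [Basis.tensorProduct_apply', Basis.coe_dualBasis, LinearMap.smul_apply, hbV,
        smul_eq_mul]
      exact this
    intro x y
    rw [this]
    simp
end

section
/- Let u act on an n-dimensional K-vector space V as a single unipotent Jordan block of size n, and let β ≥ 1. If the action of u on V ⊗ V* has a Jordan block of size 2^β, then there exists w ∈ V ⊗ V* with X^{2^β} w = 0 and b_V(X^{2^β − 1} w, w) ≠ 0 (that is, ε_{V⊗V*, b_V}(2^β) = 1). -/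
set_option maxSynthPendingDepth 3

open Module LinearMap

theorem aux_pow {K : Type*} [Field K] [CharP K 2] {R : Type*} [Ring R] [Algebra K R] (c : R)
    (k : ℕ) : (c - 1) ^ (2 ^ k) = c ^ (2 ^ k) - 1 ∧
      (c - 1) ^ (2 ^ k - 1) = ∑ i ∈ Finset.range (2 ^ k), c ^ i := by
  have h1 : (Polynomial.X - 1 : Polynomial K) ^ (2 ^ k) = Polynomial.X ^ (2 ^ k) - 1 := by
    rw [sub_pow_char_pow, one_pow]
  have hne : (Polynomial.X - 1 : Polynomial K) ≠ 0 := Polynomial.X_sub_C_ne_zero 1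
  have h2 : (Polynomial.X - 1 : Polynomial K) ^ (2 ^ k - 1) =
      ∑ i ∈ Finset.range (2 ^ k), Polynomial.X ^ i := by
    apply mul_right_cancel₀ hne
    rw [geom_sum_mul, ← h1, ← pow_succ, Nat.sub_add_cancel Nat.one_le_two_pow]
  constructor
  · simpa using congrArg (Polynomial.aeval c) h1
  · simpa using congrArg (Polynomial.aeval c) h2

theorem aux_matrix_trace {K : Type*} [Field K] [CharP K 2] {ι : Type*} [Fintype ι] [DecidableEq ι]
    (M : Matrix ι ι K) : (M * M).trace = M.trace ^ 2 := by
  have h : (M * M).trace = ∑ p : ι × ι, M p.1 p.2 * M p.2 p.1 := by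
    simp [Matrix.trace, Matrix.mul_apply, Fintype.sum_prod_type]
  rw [h, ← Finset.sum_filter_add_sum_filter_not _ (fun p : ι × ι => p.1 = p.2)]
  have h0 : ∑ p : ι × ι with ¬ p.1 = p.2, M p.1 p.2 * M p.2 p.1 = 0 := by
    refine Finset.sum_involution (fun p _ => p.swap) ?_ ?_ ?_ ?_
    · intro p _
      simp only [Prod.fst_swap, Prod.snd_swap]
      rw [mul_comm (M p.2 p.1)]
      exact CharTwo.add_self_eq_zero _
    · rintro ⟨a, b⟩ hp _ h
      simp at hp h
      exact hp h.2
    · rintro ⟨a, b⟩ hp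
      simp at hp ⊢
      exact fun h => hp h.symm
    · intro p _
      simp
  rw [h0, add_zero, Matrix.trace, sum_pow_char]
  refine Finset.sum_bij' (fun p _ => p.1) (fun i _ => (i, i)) ?_ ?_ ?_ ?_ ?_
  · simp
  · simp
  · rintro ⟨a, b⟩ hp
    simp at hp
    simp [hp]
  · simp
  · rintro ⟨a, b⟩ hp
    simp at hp
    subst hp
    simp [pow_two]

theorem aux_trace_sq {K : Type*} [Field K] [CharP K 2] {V : Type*} [AddCommGroup V] [Module K V]
    [FiniteDimensional K V] (A : Module.End K V) :
    LinearMap.trace K V (A * A) = LinearMap.trace K V A ^ 2 := by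
  classical
  rw [LinearMap.trace_eq_matrix_trace K (Module.finBasis K V),
    LinearMap.trace_eq_matrix_trace K (Module.finBasis K V), LinearMap.toMatrix_mul,
    aux_matrix_trace]

theorem aux_sum {K : Type*} [Field K] [CharP K 2] (m : ℕ) (hm : 1 ≤ m) (f : ℕ → K)
    (hf : ∀ i, i ≤ 2 * m → f (2 * m - i) = f i) :
    ∑ i ∈ Finset.range (2 * m), f i = f 0 + f m := by
  rw [← Finset.sum_filter_add_sum_filter_not _ (fun i => i = 0 ∨ i = m)]
  have h0 : ∑ i ∈ Finset.range (2 * m) with ¬ (i = 0 ∨ i = m), f i = 0 := by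
    refine Finset.sum_involution (fun p _ => 2 * m - p) ?_ ?_ ?_ ?_
    · intro p hp
      simp only [Finset.mem_filter, Finset.mem_range] at hp
      rw [hf p (by omega)]
      exact CharTwo.add_self_eq_zero _
    · intro p hp _ h
      simp only [Finset.mem_filter, Finset.mem_range] at hp
      omega
    · intro p hp
      simp only [Finset.mem_filter, Finset.mem_range] at hp ⊢
      omega
    · intro p hp
      simp only [Finset.mem_filter, Finset.mem_range] at hp
      omega
  have h1 : (Finset.range (2 * m)).filter (fun i => i = 0 ∨ i = m) = {0, m} := by
    ext i
    simp only [Finset.mem_filter, Finset.mem_range, Finset.mem_insert, Finset.mem_singleton]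
    omega
  rw [h0, add_zero, h1, Finset.sum_pair (by omega)]

/-- If there is a Jordan block of size `d`, some `A ∈ ker X^d` has `X^(d-1) A ∉ im X^d`. -/
theorem aux_block {K : Type*} [Field K] {W : Type*} [AddCommGroup W] [Module K W]
    [FiniteDimensional K W] (f : W →ₗ[K] W) (d : ℕ) (hd : 1 ≤ d) (h : jordanMult K f d ≠ 0) :
    ∃ A, (f ^ d) A = 0 ∧ (f ^ (d - 1)) A ∉ LinearMap.range (f ^ d) := by
  by_contra! hc
  apply h
  have key : ∀ k, finrank K (LinearMap.range (f ^ (k + 1))) +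
      finrank K (LinearMap.ker f ⊓ LinearMap.range (f ^ k) : Submodule K W) =
      finrank K (LinearMap.range (f ^ k)) := by
    intro k
    have := LinearMap.finrank_range_add_finrank_ker (f.domRestrict (LinearMap.range (f ^ k)))
    rw [LinearMap.range_domRestrict, LinearMap.ker_domRestrict] at this
    rw [← this]
    congr 1
    · rw [pow_succ', Module.End.mul_eq_comp, LinearMap.range_comp]
    · rw [← Submodule.finrank_map_subtype_eq, Submodule.map_comap_subtype, inf_comm]
  have e : LinearMap.ker f ⊓ LinearMap.range (f ^ (d - 1)) =
      LinearMap.ker f ⊓ LinearMap.range (f ^ d) := by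
    apply le_antisymm
    · rintro x ⟨hx, y, rfl⟩
      refine ⟨hx, hc y ?_⟩
      have : f ((f ^ (d - 1)) y) = 0 := hx
      rwa [← Module.End.mul_apply, ← pow_succ', Nat.sub_add_cancel hd] at this
    · refine inf_le_inf le_rfl ?_
      rintro x ⟨y, rfl⟩
      refine ⟨f y, ?_⟩
      rw [← Module.End.mul_apply, ← pow_succ, Nat.sub_add_cancel hd]
  have k1 := key (d - 1)
  have k2 := key d
  rw [Nat.sub_add_cancel hd, e] at k1
  unfold jordanMult
  omega

/-- Conjugation as an endomorphism of `End V`. -/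
noncomputable def auxConj {K : Type*} [Field K] {V : Type*} [AddCommGroup V] [Module K V]
    (U U' : Module.End K V) : Module.End K (Module.End K V) :=
  LinearMap.mulLeft K U * LinearMap.mulRight K U'

theorem auxConj_pow {K : Type*} [Field K] {V : Type*} [AddCommGroup V] [Module K V]
    (U U' : Module.End K V) (k : ℕ) (A : Module.End K V) :
    (auxConj U U' ^ k) A = U ^ k * A * U' ^ k := by
  induction k generalizing A with
  | zero => simp
  | succ k ih =>
    rw [pow_succ, Module.End.mul_apply, ih]
    simp only [auxConj, Module.End.mul_apply, LinearMap.mulLeft_apply, LinearMap.mulRight_apply]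
    rw [pow_succ, pow_succ']
    simp only [mul_assoc]

theorem aux_nil_trace {K : Type*} [Field K] {V : Type*} [AddCommGroup V] [Module K V]
    [FiniteDimensional K V] (h h' Y : Module.End K V) (hh : h' * h = 1) (hh2 : h * h' = 1)
    (hn : IsNilpotent (h - 1)) (hc : Commute h Y) :
    LinearMap.trace K V (h' * Y) = LinearMap.trace K V Y := by
  have hc' : Commute h' Y := by
    have : h' * Y = h' * (Y * h) * h' := by simp only [mul_assoc, hh2, mul_one]
    rw [← hc.eq, ← mul_assoc, hh, one_mul] at this
    exact this
  have e : h' * Y = Y - (h - 1) * (h' * Y) := by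
    rw [sub_mul, ← mul_assoc, hh2]; simp
  have hcc : Commute (h - 1) (h' * Y) := by
    apply Commute.sub_left
    · exact Commute.mul_right (by rw [Commute, SemiconjBy, hh, hh2]) hc
    · exact Commute.one_left _
  have : LinearMap.trace K V ((h - 1) * (h' * Y)) = 0 := by
    have := LinearMap.isNilpotent_trace_of_isNilpotent (hcc.isNilpotent_mul_right hn)
    exact this.eq_zero
  rw [e, map_sub, this, sub_zero]

open TensorProduct in
theorem aux_trace_nondeg {K : Type*} [Field K] {V : Type*} [AddCommGroup V] [Module K V]
    [FiniteDimensional K V] (B : Module.End K V)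
    (h : ∀ Y : Module.End K V, LinearMap.trace K V (B * Y) = 0) : B = 0 := by
  ext v
  rw [LinearMap.zero_apply, ← Module.forall_dual_apply_eq_zero_iff K]
  intro f
  have e : B * dualTensorHom K V V (f ⊗ₜ[K] v) = dualTensorHom K V V (f ⊗ₜ[K] (B v)) := by
    ext x
    simp
  have := h (dualTensorHom K V V (f ⊗ₜ[K] v))
  rwa [e, LinearMap.trace_eq_contract_apply, contractLeft_apply] at this

theorem aux_trace_surj {K : Type*} [Field K] {V : Type*} [AddCommGroup V] [Module K V]
    [FiniteDimensional K V] : Function.Surjective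
      ((LinearMap.mul K (Module.End K V)).compr₂ (LinearMap.trace K V)) := by
  rw [← LinearMap.injective_iff_surjective_of_finrank_eq_finrank Subspace.dual_finrank_eq.symm]
  rw [injective_iff_map_eq_zero]
  intro B hB
  apply aux_trace_nondeg
  intro Y
  exact LinearMap.congr_fun hB Y

/-- The main theorem on `End V`. -/
theorem aux_main {K : Type*} [Field K] [CharP K 2] {V : Type*} [AddCommGroup V] [Module K V]
    [FiniteDimensional K V] (U U' : Module.End K V) (h1 : U * U' = 1) (h2 : U' * U = 1)
    (hn : IsNilpotent (U - 1)) (β : ℕ) (hβ : 1 ≤ β)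
    (A : Module.End K V) (hA : ((auxConj U U' - 1 : Module.End K (Module.End K V)) ^ (2 ^ β)) A = 0)
    (hA' : ((auxConj U U' - 1 : Module.End K (Module.End K V)) ^ (2 ^ β - 1)) A ∉
      LinearMap.range ((auxConj U U' - 1 : Module.End K (Module.End K V)) ^ (2 ^ β))) :
    ∃ C : Module.End K V, ((auxConj U U' - 1 : Module.End K (Module.End K V)) ^ (2 ^ β)) C = 0 ∧
      LinearMap.trace K V (((auxConj U U' - 1 : Module.End K (Module.End K V)) ^ (2 ^ β - 1)) C * C) +
      LinearMap.trace K V (((auxConj U U' - 1 : Module.End K (Module.End K V)) ^ (2 ^ β - 1)) C) * LinearMap.trace K V C ≠ 0 := by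
  obtain ⟨m, hm, hq⟩ : ∃ m, 1 ≤ m ∧ 2 ^ β = 2 * m :=
    ⟨2 ^ (β - 1), Nat.one_le_two_pow, by rw [← pow_succ', Nat.sub_add_cancel hβ]⟩
  have hT : ∀ C, ((auxConj U U' - 1 : Module.End K (Module.End K V)) ^ (2 ^ β - 1)) C =
      ∑ i ∈ Finset.range (2 * m), U ^ i * C * U' ^ i := by
    intro C
    rw [(aux_pow (K := K) (auxConj U U') β).2, hq, LinearMap.sum_apply]
    simp only [auxConj_pow]
  have hcom : Commute U U' := by rw [Commute, SemiconjBy, h1, h2]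
  have hp1 : ∀ i, U ^ i * U' ^ i = 1 := fun i => by rw [← hcom.mul_pow, h1, one_pow]
  have hp2 : ∀ i, U' ^ i * U ^ i = 1 := fun i => by rw [← hcom.symm.mul_pow, h2, one_pow]
  have hX : ∀ C, ((auxConj U U' - 1 : Module.End K (Module.End K V)) ^ (2 ^ β)) C = U ^ (2 * m) * C * U' ^ (2 * m) - C := by
    intro C
    rw [(aux_pow (K := K) (auxConj U U') β).1, hq, LinearMap.sub_apply, auxConj_pow]
    rfl
  have hX0 : ∀ C, ((auxConj U U' - 1 : Module.End K (Module.End K V)) ^ (2 ^ β)) C = 0 ↔ Commute (U ^ (2 * m)) C := by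
    intro C
    rw [hX, sub_eq_zero]
    constructor
    · intro h
      rw [Commute, SemiconjBy]
      conv_rhs => rw [← h]
      rw [mul_assoc _ _ (U ^ (2 * m)), hp2, mul_one]
    · intro h
      rw [h.eq, mul_assoc, hp1, mul_one]
  have hcU : ∀ C, Commute (U ^ (2 * m)) C → Commute (U' ^ (2 * m)) C := by
    intro C hC
    have : U' ^ (2 * m) * C = U' ^ (2 * m) * (C * U ^ (2 * m)) * U' ^ (2 * m) := by
      simp only [mul_assoc, hp1, mul_one]
    rw [← hC.eq, ← mul_assoc, hp2, one_mul] at this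
    exact this
  have hnil : IsNilpotent (U ^ (2 * m) - 1) := by
    rw [← hq, ← (aux_pow (K := K) U β).1]
    exact hn.pow_of_pos (by positivity)
  rw [hX0] at hA
  -- the separating functional
  obtain ⟨B, hB, hTB⟩ : ∃ B : Module.End K V, Commute (U ^ (2 * m)) B ∧
      LinearMap.trace K V (B * ((auxConj U U' - 1 : Module.End K (Module.End K V)) ^ (2 ^ β - 1)) A) ≠ 0 := by
    obtain ⟨φ, hφ, hφ0⟩ := Submodule.exists_le_ker_of_notMem hA'
    obtain ⟨B, rfl⟩ := aux_trace_surj φ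
    refine ⟨B, ?_, hφ⟩
    have hz : U' ^ (2 * m) * B * U ^ (2 * m) - B = 0 := by
      apply aux_trace_nondeg
      intro Y
      have := hφ0 ⟨Y, rfl⟩
      rw [LinearMap.mem_ker, hX, LinearMap.compr₂_apply, LinearMap.mul_apply', mul_sub, map_sub,
        ← mul_assoc, LinearMap.trace_mul_comm] at this
      rw [sub_mul, map_sub, ← this]
      simp only [mul_assoc]
    rw [sub_eq_zero] at hz
    rw [Commute, SemiconjBy]
    conv_lhs => rw [← hz]
    rw [← mul_assoc, ← mul_assoc, hp1, one_mul]
  -- the linear functional is nonzero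
  obtain ⟨C, hC, hsC⟩ : ∃ C : Module.End K V, Commute (U ^ (2 * m)) C ∧
      LinearMap.trace K V ((U ^ m - 1) * C) ≠ 0 := by
    by_contra! hcon
    apply hTB
    rw [hT, two_mul, Finset.sum_range_add, ← Finset.sum_add_distrib, Finset.mul_sum, map_sum]
    apply Finset.sum_eq_zero
    intro i _
    have cU : ∀ j, Commute (U ^ (2 * m)) (U ^ j) := fun j => Commute.pow_pow_self U _ _
    have cU' : ∀ j, Commute (U ^ (2 * m)) (U' ^ j) := fun j => hcom.pow_pow _ _
    have e : B * (U ^ i * A * U' ^ i + U ^ (m + i) * A * U' ^ (m + i)) =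
        B * U ^ i * ((U ^ m - 1) * A + A * (U ^ m - 1)) * U' ^ m * U' ^ i := by
      have x1 : U' ^ (m + i) = U' ^ m * U' ^ i := pow_add _ _ _
      have x2 : U ^ (m + i) = U ^ i * U ^ m := by rw [add_comm, pow_add]
      have x3 : A * U' ^ i = A * U ^ m * U' ^ m * U' ^ i := by
        rw [mul_assoc A, hp1, mul_one]
      have x4 : (U ^ m - 1) * A + A * (U ^ m - 1) = U ^ m * A + A * U ^ m := by
        have : A + A = 0 := by
          rw [← two_smul K A, CharTwo.two_eq_zero, zero_smul]
        calc _ = U ^ m * A + A * U ^ m - (A + A) := by noncomm_ring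
          _ = _ := by rw [this, sub_zero]
      rw [x1, x2, x4, mul_assoc (U ^ i) A, x3]
      noncomm_ring
    rw [e]
    have e2 : B * U ^ i * ((U ^ m - 1) * A + A * (U ^ m - 1)) * U' ^ m * U' ^ i =
       (B * U ^ i) * ((U ^ m - 1) * (A * U' ^ m * U' ^ i)) +
       (B * U ^ i * A) * ((U ^ m - 1) * (U' ^ m * U' ^ i)) := by
      noncomm_ring
    rw [e2, map_add, LinearMap.trace_mul_comm, mul_assoc, hcon,
      LinearMap.trace_mul_comm, mul_assoc, hcon, add_zero]
    · exact ((cU' _).mul_right (cU' _)).mul_right ((hB.mul_right (cU _)).mul_right hA)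
    · exact ((hA.mul_right (cU' _)).mul_right (cU' _)).mul_right (hB.mul_right (cU _))
  refine ⟨C, (hX0 C).2 hC, ?_⟩
  have ht0 : LinearMap.trace K V (((auxConj U U' - 1 : Module.End K (Module.End K V)) ^ (2 ^ β - 1)) C) = 0 := by
    rw [hT, map_sum]
    have : ∀ i ∈ Finset.range (2 * m), LinearMap.trace K V (U ^ i * C * U' ^ i) =
        LinearMap.trace K V C := by
      intro i _
      rw [LinearMap.trace_mul_comm, ← mul_assoc, hp2, one_mul]
    rw [Finset.sum_congr rfl this, Finset.sum_const, Finset.card_range, two_mul, add_smul]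
    exact CharTwo.add_self_eq_zero _
  rw [ht0, zero_mul, add_zero, hT, Finset.sum_mul, map_sum, aux_sum m hm]
  · have x : LinearMap.trace K V (U ^ m * C * U' ^ m * C) =
        LinearMap.trace K V ((U ^ m * C) * (U ^ m * C)) := by
      rw [← aux_nil_trace (U ^ (2 * m)) (U' ^ (2 * m)) ((U ^ m * C) * (U ^ m * C)) (hp2 _) (hp1 _)
        hnil]
      · congr 1
        have c : Commute (U' ^ (2 * m)) (U ^ m * C) :=
          (hcom.symm.pow_pow _ _).mul_right (hcU C hC)
        have z : U' ^ (2 * m) * U ^ m = U' ^ m := by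
          rw [two_mul, pow_add, mul_assoc, hp2, mul_one]
        rw [← mul_assoc, c.eq, ← z]
        simp only [mul_assoc]
      · have c : Commute (U ^ (2 * m)) (U ^ m * C) := (Commute.pow_pow_self U _ _).mul_right hC
        exact c.mul_right c
    rw [x, aux_trace_sq]
    simp only [pow_zero, one_mul, mul_one]
    rw [aux_trace_sq, ← add_pow_char]
    apply pow_ne_zero
    rw [sub_mul, one_mul, map_sub, CharTwo.sub_eq_add] at hsC
    rwa [add_comm]
  · intro i hi
    have y1 : U ^ (2 * m - i) = U ^ (2 * m) * U' ^ i := by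
      conv_rhs => rw [← Nat.sub_add_cancel hi, pow_add, mul_assoc, hp1, mul_one]
    have y2 : U' ^ (2 * m - i) = U ^ i * U' ^ (2 * m) := by
      conv_rhs => rw [← Nat.sub_add_cancel hi, add_comm, pow_add, ← mul_assoc, hp1, one_mul]
    have y3 : U' ^ (2 * m) * C = C * U' ^ (2 * m) := (hcU C hC).eq
    rw [y1, y2]
    have y4 : U ^ (2 * m) * U' ^ i * C * (U ^ i * U' ^ (2 * m)) * C =
        U ^ (2 * m) * (U' ^ i * C * U ^ i * C * U' ^ (2 * m)) := by
      simp only [mul_assoc, y3]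
    rw [y4, LinearMap.trace_mul_comm, mul_assoc _ _ (U ^ (2 * m)), hp2, mul_one, mul_assoc,
      LinearMap.trace_mul_comm]
    simp only [mul_assoc]

open TensorProduct in
/-- if `u` is a single unipotent Jordan block of size `n` on `V` and `u` has a
Jordan block of size `2^β` (β ≥ 1) on `V ⊗ V*`, then there exists `w ∈ V ⊗ V*` with
`X^{2^β} w = 0` and `b_V(X^{2^β-1} w, w) ≠ 0`, i.e. `ε_{V⊗V*, b_V}(2^β) = 1`. -/
theorem eps_one_at_power_block_of_tensor_dual
    (K : Type*) [Field K] [IsAlgClosed K] [CharP K 2]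
    (V : Type*) [AddCommGroup V] [Module K V] [FiniteDimensional K V]
    (n : ℕ) (hdim : Module.finrank K V = n)
    (u : V ≃ₗ[K] V)
    (hb : ((u : V →ₗ[K] V) - 1) ^ (n - 1) ≠ 0)
    (hb' : ((u : V →ₗ[K] V) - 1) ^ n = 0)
    (bV : V ⊗[K] Module.Dual K V →ₗ[K] V ⊗[K] Module.Dual K V →ₗ[K] K)
    (hbV : ∀ (v : V) (f : Module.Dual K V) (v' : V) (f' : Module.Dual K V),
      bV (v ⊗ₜ[K] f) (v' ⊗ₜ[K] f') = f v' * f' v + f v * f' v')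
    (β : ℕ) (hβ : 1 ≤ β)
    (hblock : jordanMult K ((TensorProduct.congr u u.symm.dualMap).toLinearMap - 1)
        (2 ^ β) ≠ 0) :
    ∀ XT : Module.End K (V ⊗[K] Module.Dual K V),
      XT = (TensorProduct.congr u u.symm.dualMap).toLinearMap - 1 →
      ∃ w : V ⊗[K] Module.Dual K V,
        (XT ^ (2 ^ β)) w = 0 ∧ bV ((XT ^ (2 ^ β - 1)) w) w ≠ 0 := by
  rintro XT rfl
  set e : V ⊗[K] Module.Dual K V ≃ₗ[K] Module.End K V :=
    (TensorProduct.comm K V (Module.Dual K V)).trans (dualTensorHomEquiv K V V) with he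
  have he1 : ∀ v f, e (v ⊗ₜ[K] f) = dualTensorHom K V V (f ⊗ₜ[K] v) := by
    intro v f
    simp [he]
  set U : Module.End K V := (u : V →ₗ[K] V) with hU
  set U' : Module.End K V := (u.symm : V →ₗ[K] V) with hU'
  have h1 : U * U' = 1 := by ext; simp [U, U']
  have h2 : U' * U = 1 := by ext; simp [U, U']
  have hconj : ∀ z, e ((TensorProduct.congr u u.symm.dualMap) z) = auxConj U U' (e z) := by
    intro z
    induction z with
    | zero => simp
    | add x y hx hy => simp only [map_add, hx, hy]
    | tmul v f =>
      ext x
      simp [he1, auxConj, U, U']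
  have hpow : ∀ k z, e ((((TensorProduct.congr u u.symm.dualMap).toLinearMap - 1) ^ k) z) =
      ((auxConj U U' - 1 : Module.End K (Module.End K V)) ^ k) (e z) := by
    intro k
    induction k with
    | zero => intro z; simp
    | succ k ih =>
      intro z
      rw [pow_succ, Module.End.mul_apply, ih, pow_succ, Module.End.mul_apply]
      congr 1
      simp only [LinearMap.sub_apply, map_sub, Module.End.one_apply, LinearEquiv.coe_coe, hconj]
  have hb : ∀ z z', bV z z' = LinearMap.trace K V (e z * e z') +
      LinearMap.trace K V (e z) * LinearMap.trace K V (e z') := by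
    intro z z'
    induction z with
    | zero => simp
    | add x y hx hy => simp only [map_add, add_mul, LinearMap.add_apply, hx, hy]; ring
    | tmul v f =>
      induction z' with
      | zero => simp
      | add x y hx hy => simp only [map_add, mul_add, hx, hy]; ring
      | tmul v' f' =>
        have : e (v ⊗ₜ[K] f) * e (v' ⊗ₜ[K] f') = f v' • e (v ⊗ₜ[K] f') := by
          ext x
          simp [he1, smul_smul, mul_comm]
        rw [this, hbV, map_smul]
        simp only [he1, LinearMap.trace_eq_contract_apply, contractLeft_apply, smul_eq_mul]
  obtain ⟨A, hA, hA'⟩ := aux_block _ _ Nat.one_le_two_pow hblock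
  obtain ⟨C, hC, hC'⟩ := aux_main U U' h1 h2 ⟨n, hb'⟩ β hβ (e A)
    (by rw [← hpow, hA, map_zero]) (by
      rintro ⟨y, hy⟩
      apply hA'
      refine ⟨e.symm y, e.injective ?_⟩
      rw [hpow, hpow, e.apply_symm_apply, hy])
  refine ⟨e.symm C, e.injective ?_, ?_⟩
  · rw [hpow, e.apply_symm_apply, hC, map_zero]
  · rw [hb, hpow, e.apply_symm_apply]
    exact hC'
end

section
/- Let (V,b) be a non-degenerate alternating bilinear K[u]-module of dimension 2n (n ≥ 1) such that either u acts on V as a single Jordan block of size 2n, or (V,b) is isomorphic as a bilinear K[u]-module to the paired module associated with a single unipotent Jordan block of size n. Let α ≥ 0 with 2^α dividing n. Then: (i) there exists δ ∈ ∧²(V) with X^{2^α − 1}·δ = β_V and φ_V(δ) equal to the image of the integer n/2^α in K; (ii) Ker(X^{2^α − 1} on ∧²(V)) ⊆ Ker φ_V; and (iii) if α = ν₂(n), then Ker(X^{2^α} on ∧²(V)) ⊄ Ker φ_V. -/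
open Module LinearMap

noncomputable section

/-- `(Z, u, b)` is isomorphic, as a bilinear module, to the paired module `(M ⊕ M*, a)`
associated with `(M, w)`, where `a(v+f, v'+f') = f(v') + f'(v)` and the automorphism acts by
`w` on `M` and by `f ↦ f ∘ w⁻¹` on `M*`. -/
def IsPairedIso {K : Type*} [Field K] {Z M : Type*} [AddCommGroup Z] [Module K Z]
    [AddCommGroup M] [Module K M] (u : Z ≃ₗ[K] Z) (b : Z →ₗ[K] Z →ₗ[K] K)
    (w : M ≃ₗ[K] M) : Prop :=
  ∃ φ : Z ≃ₗ[K] M × Module.Dual K M,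
    (∀ z, φ (u z) = (w (φ z).1, w.symm.dualMap (φ z).2)) ∧
    (∀ z z', b z z' = (φ z).2 (φ z').1 + (φ z').2 (φ z).1)

end

/-- Symplectic families expand. -/
theorem symp_expand {K V ι : Type*} [Field K] [AddCommGroup V] [Module K V] [FiniteDimensional K V]
    [Fintype ι] [DecidableEq ι] (hdim : finrank K V = 2 * Fintype.card ι)
    (b : V →ₗ[K] V →ₗ[K] K) (halt : ∀ v, b v v = 0)
    (x y : ι → V) (hxx : ∀ i j, b (x i) (x j) = 0) (hyy : ∀ i j, b (y i) (y j) = 0)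
    (hxy : ∀ i j, b (x i) (y j) = if i = j then 1 else 0) (v : V) :
    v = ∑ i, b v (y i) • x i + ∑ i, b (x i) v • y i := by
  have hneg : ∀ v w, b v w = - b w v := fun v w => by
    have h := halt (v + w)
    simp only [map_add, LinearMap.add_apply, halt, zero_add, add_zero] at h
    exact eq_neg_of_add_eq_zero_right h
  have hli : LinearIndependent K (Sum.elim x y) := by
    rw [Fintype.linearIndependent_iff]
    intro g hg
    rw [Fintype.sum_sum_type] at hg
    simp only [Sum.elim_inl, Sum.elim_inr] at hg
    rintro (i | i)
    · have := congrArg (fun z => b z (y i)) hg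
      simpa [map_add, map_sum, hyy, hxy] using this
    · have := congrArg (fun z => b (x i) z) hg
      simpa [map_add, map_sum, hxx, hxy] using this
  have hspan := hli.span_eq_top_of_card_eq_finrank' (by rw [hdim]; simp; ring)
  have hv : v ∈ Submodule.span K (Set.range (Sum.elim x y)) := by rw [hspan]; trivial
  obtain ⟨g, hg⟩ := (Submodule.mem_span_range_iff_exists_fun K).1 hv
  rw [Fintype.sum_sum_type] at hg
  simp only [Sum.elim_inl, Sum.elim_inr] at hg
  have h1 : ∀ i, b v (y i) = g (Sum.inl i) := fun i => by
    rw [← hg]; simp [map_add, map_sum, hyy, hxy]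
  have h2 : ∀ i, b (x i) v = g (Sum.inr i) := fun i => by
    rw [← hg]; simp [map_add, map_sum, hxx, hxy]
  simp only [h1, h2, hg]

/-- Sum of a symmetric coefficient matrix against an alternating map vanishes. -/
theorem symm_sum_zero {K E ι : Type*} [Field K] [AddCommGroup E] [Module K E] [Fintype ι]
    [DecidableEq ι]
    (H : ι → ι → K) (w : ι → ι → E) (hH : ∀ i j, H i j = H j i)
    (hw : ∀ i, w i i = 0) (hw' : ∀ i j, w i j = - w j i) :
    ∑ i, ∑ j, H i j • w i j = 0 := by
  rw [← Finset.sum_product']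
  refine Finset.sum_involution (fun p _ => (p.2, p.1)) ?_ ?_ ?_ ?_
  · rintro ⟨i, j⟩ _
    simp only
    rw [hH j i, hw' j i]; simp
  · rintro ⟨i, j⟩ _ h heq
    simp only [Prod.mk.injEq] at heq
    obtain ⟨h1, h2⟩ := heq
    subst h1
    exact h (by simp [hw])
  · intros; simp
  · intros; simp

theorem beta_indep {K V E ι κ : Type*} [Field K] [CharP K 2] [AddCommGroup V] [Module K V]
    [FiniteDimensional K V] [AddCommGroup E] [Module K E]
    [Fintype ι] [DecidableEq ι] [Fintype κ] [DecidableEq κ]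
    (hdim : finrank K V = 2 * Fintype.card ι) (hdim' : finrank K V = 2 * Fintype.card κ)
    (b : V →ₗ[K] V →ₗ[K] K) (halt : ∀ v, b v v = 0)
    (x y : ι → V) (hxx : ∀ i j, b (x i) (x j) = 0) (hyy : ∀ i j, b (y i) (y j) = 0)
    (hxy : ∀ i j, b (x i) (y j) = if i = j then 1 else 0)
    (x' y' : κ → V) (hxx' : ∀ i j, b (x' i) (x' j) = 0) (hyy' : ∀ i j, b (y' i) (y' j) = 0)
    (hxy' : ∀ i j, b (x' i) (y' j) = if i = j then 1 else 0)
    (wedge : V →ₗ[K] V →ₗ[K] E) (hw : ∀ v, wedge v v = 0) :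
    ∑ i, wedge (x' i) (y' i) = ∑ i, wedge (x i) (y i) := by
  have hneg : ∀ v w, b v w = b w v := fun v w => by
    have h := halt (v + w)
    simp only [map_add, LinearMap.add_apply, halt, zero_add, add_zero] at h
    rw [eq_neg_of_add_eq_zero_right h, CharTwo.neg_eq]
  have hwneg : ∀ v w, wedge v w = - wedge w v := fun v w => by
    have h := hw (v + w)
    simp only [map_add, LinearMap.add_apply, hw, zero_add, add_zero] at h
    exact eq_neg_of_add_eq_zero_right h
  have hex := symp_expand hdim b halt x y hxx hyy hxy
  have hex' := symp_expand hdim' b halt x' y' hxx' hyy' hxy'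
  let s : ι ⊕ ι → V := Sum.elim x y
  let t : ι ⊕ ι → V := Sum.elim y x
  have hs : ∀ v, v = ∑ a, b v (t a) • s a := by
    intro v
    rw [Fintype.sum_sum_type]
    simp only [s, t, Sum.elim_inl, Sum.elim_inr]
    conv_lhs => rw [hex v]
    simp only [hneg v]
  have key : ∀ v w, b v w = ∑ k, (b (x' k) v * b (y' k) w + b (x' k) w * b (y' k) v) := by
    intro v w
    conv_lhs => rw [hex' v]
    simp only [map_add, map_sum, LinearMap.add_apply, LinearMap.sum_apply, map_smul,
      LinearMap.smul_apply, smul_eq_mul]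
    rw [← Finset.sum_add_distrib]
    refine Finset.sum_congr rfl fun k _ => ?_
    rw [hneg v (y' k)]; ring
  let G : ι ⊕ ι → ι ⊕ ι → K := fun a c => ∑ k, b (x' k) (t a) * b (y' k) (t c)
  let J : ι ⊕ ι → ι ⊕ ι → K := fun a c => Sum.elim (fun i => Sum.elim (fun _ => 0)
    (fun j => if i = j then 1 else 0) c) (fun _ => 0) a
  have h1 : ∑ i, wedge (x' i) (y' i) = ∑ a, ∑ c, G a c • wedge (s a) (s c) := by
    have : ∀ i, wedge (x' i) (y' i) =
        ∑ a, ∑ c, (b (x' i) (t a) * b (y' i) (t c)) • wedge (s a) (s c) := by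
      intro i
      conv_lhs => rw [hs (x' i), hs (y' i)]
      simp only [map_sum, LinearMap.sum_apply, map_smul, LinearMap.smul_apply, Finset.smul_sum,
        smul_smul]
      rw [Finset.sum_comm]
      refine Finset.sum_congr rfl fun a _ => Finset.sum_congr rfl fun c _ => ?_
      rw [mul_comm]
    simp only [this, G, Finset.sum_smul]
    rw [Finset.sum_comm]
    refine Finset.sum_congr rfl fun a _ => ?_
    rw [Finset.sum_comm]
  have h2 : ∑ i, wedge (x i) (y i) = ∑ a, ∑ c, J a c • wedge (s a) (s c) := by
    simp [J, s, Fintype.sum_sum_type]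
  rw [h1, h2, ← sub_eq_zero, ← Finset.sum_sub_distrib]
  simp only [← Finset.sum_sub_distrib, ← sub_smul]
  refine symm_sum_zero _ _ ?_ (fun a => hw _) (fun a c => hwneg _ _)
  intro a c
  have hG : G a c + G c a = b (t a) (t c) := by
    rw [key (t a) (t c)]
    simp only [G, ← Finset.sum_add_distrib]
  have hJ : J a c + J c a = b (t a) (t c) := by
    rcases a with i | i <;> rcases c with j | j <;>
      simp [J, t, hxx, hyy, hxy, hneg (y _) (x _), eq_comm]
  rw [sub_eq_sub_iff_add_eq_add]
  have e1 : G a c = b (t a) (t c) + G c a := by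
    rw [← hG, add_assoc, CharTwo.add_self_eq_zero, add_zero]
  rw [e1, ← hJ]
  have e2 : J c a + J c a = 0 := CharTwo.add_self_eq_zero _
  linear_combination e2

theorem ext_lift {K V E : Type*} [Field K] [AddCommGroup V] [Module K V]
    [FiniteDimensional K V] [AddCommGroup E] [Module K E] (hV : 2 ≤ finrank K V)
    (wedge : V →ₗ[K] V →ₗ[K] E) (hw : ∀ v, wedge v v = 0)
    (hsp : Submodule.span K {x | ∃ v w, wedge v w = x} = ⊤)
    (hf : Module.finrank K E = Nat.choose (Module.finrank K V) 2)
    (B : V →ₗ[K] V →ₗ[K] K) (hB : ∀ v, B v v = 0) :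
    ∃ g : E →ₗ[K] K, ∀ v w, g (wedge v w) = B v w := by
  have hwneg : ∀ v w, wedge v w = - wedge w v := fun v w => by
    have h := hw (v + w)
    simp only [map_add, LinearMap.add_apply, hw, zero_add, add_zero] at h
    exact eq_neg_of_add_eq_zero_right h
  have hBneg : ∀ v w, B v w = - B w v := fun v w => by
    have h := hB (v + w)
    simp only [map_add, LinearMap.add_apply, hB, zero_add, add_zero] at h
    exact eq_neg_of_add_eq_zero_right h
  let x := finBasis K V
  let idx := (j : Fin (finrank K V)) × Fin (j : ℕ)
  let lo : idx → Fin (finrank K V) := fun p => ⟨p.2, p.2.2.trans p.1.2⟩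
  let fam : idx → E := fun p => wedge (x (lo p)) (x p.1)
  have hcard : Fintype.card idx = finrank K E := by
    rw [hf, Fintype.card_sigma]
    simp only [Fintype.card_fin]
    rw [Fin.sum_univ_eq_sum_range (fun i => i), Finset.sum_range_id, Nat.choose_two_right]
  have hmem : ∀ i j, wedge (x i) (x j) ∈ Submodule.span K (Set.range fam) := by
    have hlt : ∀ i j, i < j → wedge (x i) (x j) ∈ Submodule.span K (Set.range fam) := by
      intro i j hij
      exact Submodule.subset_span ⟨⟨j, ⟨i, hij⟩⟩, rfl⟩
    intro i j
    rcases lt_trichotomy i j with h | h | h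
    · exact hlt i j h
    · subst h; rw [hw]; exact Submodule.zero_mem _
    · rw [hwneg]; exact Submodule.neg_mem _ (hlt j i h)
  have htop : ⊤ ≤ Submodule.span K (Set.range fam) := by
    rw [← hsp, Submodule.span_le]
    rintro _ ⟨v, w, rfl⟩
    rw [← x.sum_repr v, ← x.sum_repr w]
    simp only [map_sum, LinearMap.sum_apply, map_smul, LinearMap.smul_apply]
    refine Submodule.sum_mem _ fun i _ => Submodule.smul_mem _ _ <|
      Submodule.sum_mem _ fun j _ => Submodule.smul_mem _ _ (hmem _ _)
  let bs := basisOfTopLeSpanOfCardEqFinrank fam htop hcard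
  have hbs : ∀ p, bs p = fam p := fun p => by simp [bs]
  let g : E →ₗ[K] K := bs.constr K (fun p => B (x (lo p)) (x p.1))
  have hg : ∀ p : idx, g (fam p) = B (x (lo p)) (x p.1) := fun p => by
    rw [← hbs]; simp [g]
  refine ⟨g, ?_⟩
  have hlt : ∀ i j, i < j → g (wedge (x i) (x j)) = B (x i) (x j) := fun i j hij =>
    hg ⟨j, ⟨i, hij⟩⟩
  have hall : wedge.compr₂ g = B := by
    refine LinearMap.ext_basis x x fun i j => ?_
    simp only [LinearMap.compr₂_apply]
    rcases lt_trichotomy i j with h | h | h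
    · exact hlt i j h
    · subst h; rw [hw, hB, map_zero]
    · rw [hwneg, hBneg, map_neg, hlt j i h]
  intro v w
  rw [← hall]; rfl

theorem sub_one_pow_geom {K A : Type*} [Field K] [CharP K 2] [Ring A] [Algebra K A] (α : ℕ)
    (a : A) : (a - 1) ^ (2 ^ α - 1) = ∑ r ∈ Finset.range (2 ^ α), a ^ r := by
  have : ((Polynomial.X : Polynomial K) - 1) ^ (2 ^ α - 1)
      = ∑ r ∈ Finset.range (2 ^ α), (Polynomial.X : Polynomial K) ^ r := by
    have h0 : ((Polynomial.X : Polynomial K) - 1) ≠ 0 := Polynomial.X_sub_C_ne_zero 1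
    apply mul_right_cancel₀ h0
    rw [geom_sum_mul, ← pow_succ, Nat.sub_add_cancel Nat.one_le_two_pow, sub_pow_char_pow, one_pow]
  simpa using congrArg (Polynomial.aeval a) this

theorem sub_one_pow_two_pow {K A : Type*} [Field K] [CharP K 2] [Ring A] [Algebra K A] (α : ℕ)
    (a : A) : (a - 1) ^ (2 ^ α) = a ^ (2 ^ α) - 1 := by
  have : ((Polynomial.X : Polynomial K) - 1) ^ (2 ^ α) = Polynomial.X ^ (2 ^ α) - 1 := by
    rw [sub_pow_char_pow, one_pow]
  simpa using congrArg (Polynomial.aeval a) this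

theorem final_step {K V E : Type*} [Field K] [CharP K 2] [AddCommGroup V] [Module K V]
    [FiniteDimensional K V] [AddCommGroup E] [Module K E] (n m α : ℕ) (hn : 1 ≤ n)
    (hnm : n = 2 ^ α * m)
    (hdim : Module.finrank K V = 2 * n)
    (U : Module.End K V)
    (b : V →ₗ[K] V →ₗ[K] K) (halt : ∀ v, b v v = 0)
    (hinv : ∀ v w, b (U v) (U w) = b v w)
    (wedge : V →ₗ[K] V →ₗ[K] E) (hw : ∀ v, wedge v v = 0)
    (hsp : Submodule.span K {x | ∃ v w, wedge v w = x} = ⊤)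
    (hf : Module.finrank K E = Nat.choose (Module.finrank K V) 2)
    (uE : E →ₗ[K] E) (huE : ∀ v w, uE (wedge v w) = wedge (U v) (U w))
    (φ : E →ₗ[K] K) (hφ : ∀ v w, φ (wedge v w) = b v w)
    (x0 y0 : Fin n → V) (hxx : ∀ i j, b (x0 i) (x0 j) = 0) (hyy : ∀ i j, b (y0 i) (y0 j) = 0)
    (hxy : ∀ i j, b (x0 i) (y0 j) = if i = j then 1 else 0)
    (βV : E) (hβV : βV = ∑ i : Fin n, wedge (x0 i) (y0 i))
    (x y : Fin m → V)
    (h1 : ∀ r < 2 ^ α, ∀ s < 2 ^ α, ∀ i j, b ((U ^ r) (x i)) ((U ^ s) (x j)) = 0)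
    (h2 : ∀ r < 2 ^ α, ∀ s < 2 ^ α, ∀ i j, b ((U ^ r) (y i)) ((U ^ s) (y j)) = 0)
    (h3 : ∀ r < 2 ^ α, ∀ s < 2 ^ α, ∀ i j, b ((U ^ r) (x i)) ((U ^ s) (y j)) =
      if r = s ∧ i = j then 1 else 0) :
    ∀ XE : Module.End K E, XE = uE - 1 →
      (∃ δ : E, (XE ^ (2 ^ α - 1)) δ = βV ∧ φ δ = ((n / 2 ^ α : ℕ) : K)) ∧
      (∀ x : E, (XE ^ (2 ^ α - 1)) x = 0 → φ x = 0) ∧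
      (α = padicValNat 2 n → ∃ x : E, (XE ^ (2 ^ α)) x = 0 ∧ φ x ≠ 0) := by
  rintro XE hXE
  have hdiv : n / 2 ^ α = m := by rw [hnm]; exact Nat.mul_div_cancel_left _ (by positivity)
  rw [hdiv]
  have hbsymm : ∀ v w, b v w = b w v := fun v w => by
    have h := halt (v + w)
    simp only [map_add, LinearMap.add_apply, halt, zero_add, add_zero] at h
    rw [eq_neg_of_add_eq_zero_right h, CharTwo.neg_eq]
  have hXp : XE ^ (2 ^ α - 1) = ∑ r ∈ Finset.range (2 ^ α), uE ^ r := by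
    rw [hXE]; exact sub_one_pow_geom (K := K) (A := Module.End K E) α uE
  have hUp : ∀ r v w, (uE ^ r) (wedge v w) = wedge ((U ^ r) v) ((U ^ r) w) := by
    intro r
    induction r with
    | zero => intro v w; simp
    | succ r ih => intro v w; rw [pow_succ, Module.End.mul_apply, huE, ih, pow_succ]; rfl
  have hUinv : ∀ r v w, b ((U ^ r) v) ((U ^ r) w) = b v w := by
    intro r
    induction r with
    | zero => intro v w; simp
    | succ r ih => intro v w; rw [pow_succ, Module.End.mul_apply, Module.End.mul_apply, ih, hinv]
  let xx : Fin (2 ^ α) × Fin m → V := fun p => (U ^ (p.1 : ℕ)) (x p.2)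
  let yy : Fin (2 ^ α) × Fin m → V := fun p => (U ^ (p.1 : ℕ)) (y p.2)
  have hdim' : finrank K V = 2 * Fintype.card (Fin (2 ^ α) × Fin m) := by
    rw [hdim, hnm]; simp
  have hdim0 : finrank K V = 2 * Fintype.card (Fin n) := by
    rw [hdim]; simp
  have hX : ∀ p q, b (xx p) (xx q) = 0 := fun p q => h1 _ p.1.2 _ q.1.2 _ _
  have hY : ∀ p q, b (yy p) (yy q) = 0 := fun p q => h2 _ p.1.2 _ q.1.2 _ _
  have hXY : ∀ p q, b (xx p) (yy q) = if p = q then 1 else 0 := fun p q => by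
    simp only [xx, yy]
    rw [h3 _ p.1.2 _ q.1.2]
    simp only [Prod.ext_iff, Fin.ext_iff]
  have hβ : βV = ∑ p, wedge (xx p) (yy p) := by
    rw [hβV]
    exact beta_indep hdim' hdim0 b halt xx yy hX hY hXY x0 y0 hxx hyy hxy wedge hw
  have huβ : uE βV = βV := by
    rw [hβV, map_sum]
    simp only [huE]
    exact beta_indep hdim0 hdim0 b halt x0 y0 hxx hyy hxy (fun i => U (x0 i)) (fun i => U (y0 i))
      (by intros; rw [hinv, hxx]) (by intros; rw [hinv, hyy]) (by intros; rw [hinv, hxy]) wedge hw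
  have hi : (XE ^ (2 ^ α - 1)) (∑ i, wedge (x i) (y i)) = βV := by
    rw [hXp, hβ, Fintype.sum_prod_type, LinearMap.sum_apply,
      Finset.sum_range (fun r => (uE ^ r) (∑ i, wedge (x i) (y i)))]
    simp only [map_sum, hUp, xx, yy]
  have hφδ : φ (∑ i, wedge (x i) (y i)) = (m : K) := by
    rw [map_sum]
    have : ∀ i, φ (wedge (x i) (y i)) = 1 := fun i => by
      rw [hφ]; simpa using h3 0 (by positivity) 0 (by positivity) i i
    simp [this]
  refine ⟨⟨_, hi, hφδ⟩, ?_, ?_⟩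
  · let Q := 2 ^ α - 1
    let p : Fin m → V →ₗ[K] K := fun i => b ((U ^ Q) (x i))
    let p' : Fin m → V →ₗ[K] K := fun i => b ((U ^ Q) (y i))
    let B : V →ₗ[K] V →ₗ[K] K := ∑ i, ((p i).smulRight (p' i) + (p' i).smulRight (p i))
    have hBapp : ∀ v w, B v w = ∑ i, (p i v * p' i w + p' i v * p i w) := by
      intro v w
      simp [B, LinearMap.sum_apply]
    obtain ⟨g, hg⟩ := ext_lift (by omega) wedge hw hsp hf B (by
      intro v; rw [hBapp]
      refine Finset.sum_eq_zero fun i _ => ?_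
      rw [mul_comm]; exact CharTwo.add_self_eq_zero _)
    have hgX : φ = g ∘ₗ (XE ^ (2 ^ α - 1)) := by
      apply LinearMap.ext_on hsp
      rintro _ ⟨v, w, rfl⟩
      rw [LinearMap.comp_apply, hXp, LinearMap.sum_apply, map_sum, hφ]
      simp only [hUp, hg, hBapp]
      conv_lhs => rw [symp_expand hdim' b halt xx yy hX hY hXY v]
      simp only [map_add, map_sum, LinearMap.add_apply, LinearMap.sum_apply, map_smul,
        LinearMap.smul_apply, smul_eq_mul]
      rw [← Finset.sum_add_distrib, Fintype.sum_prod_type, ← Finset.sum_range_reflect,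
        Finset.sum_range]
      refine Finset.sum_congr rfl fun r _ => Finset.sum_congr rfl fun i _ => ?_
      have hr : ∀ z z', b ((U ^ Q) z) ((U ^ (2 ^ α - 1 - (r : ℕ))) z') = b ((U ^ (r : ℕ)) z) z' := by
        intro z z'
        rw [← hUinv (2 ^ α - 1 - (r : ℕ)) _ z', ← Module.End.mul_apply, ← pow_add]
        congr 4
        have := r.2
        simp only [Q]; omega
      simp only [p, p', hr, xx, yy, hbsymm v]
      ring
    intro z hz
    rw [hgX, LinearMap.comp_apply, hz, map_zero]
  · intro hα
    refine ⟨∑ i, wedge (x i) (y i), ?_, ?_⟩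
    · have : XE ^ (2 ^ α) = XE * XE ^ (2 ^ α - 1) := by
        rw [← pow_succ', Nat.sub_add_cancel Nat.one_le_two_pow]
      rw [this, Module.End.mul_apply, hi, hXE]
      simp [huβ]
    · rw [hφδ, Ne, CharP.cast_eq_zero_iff K 2]
      rintro ⟨k, rfl⟩
      have : 2 ^ (α + 1) ∣ n := ⟨k, by rw [hnm]; ring⟩
      rw [padicValNat_dvd_iff_le (by omega)] at this
      omega

theorem nilp_pow_finrank {K V : Type*} [Field K] [AddCommGroup V] [Module K V]
    [FiniteDimensional K V] (f : Module.End K V) (h : ∃ N : ℕ, f ^ N = 0) :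
    f ^ finrank K V = 0 := by
  have h1 : IsNilpotent f := h
  have h2 := LinearMap.aeval_self_charpoly f
  rw [h1.charpoly_eq_X_pow_finrank] at h2
  simpa using h2

theorem cyclic_li {K V : Type*} [Field K] [AddCommGroup V] [Module K V]
    (U : Module.End K V) (N : ℕ) (v : V) (h1 : ((U - 1) ^ (N - 1)) v ≠ 0)
    (h2 : (U - 1) ^ N = 0) :
    LinearIndependent K (fun k : Fin N => (U ^ (k : ℕ)) v) := by
  have hN : 1 ≤ N := by
    rcases Nat.eq_zero_or_pos N with rfl | h
    · exfalso; apply h1; simp only [pow_zero] at h2; simp [h2]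
    · exact h
  rw [Fintype.linearIndependent_iff]
  intro g hg
  let p : Polynomial K := ∑ k : Fin N, Polynomial.C (g k) * Polynomial.X ^ (k : ℕ)
  have hp : Polynomial.aeval U p v = 0 := by
    rw [← hg]
    simp [p, map_sum, LinearMap.sum_apply, Algebra.algebraMap_eq_smul_one]
  have hcoef : ∀ i : Fin N, p.coeff i = g i := by
    intro i
    simp only [p, Polynomial.finsetSum_coeff, Polynomial.coeff_C_mul, Polynomial.coeff_X_pow]
    rw [Finset.sum_eq_single i]
    · simp
    · intro j _ hj
      rw [if_neg (fun h => hj (Fin.ext h.symm)), mul_zero]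
    · simp
  have hdeg : p.degree < N := Polynomial.degree_sum_fin_lt g
  by_cases hp0 : p = 0
  · intro i; rw [← hcoef, hp0]; simp
  exfalso
  obtain ⟨r, hr, hnd⟩ := Polynomial.exists_eq_pow_rootMultiplicity_mul_and_not_dvd p hp0 1
  set k := p.rootMultiplicity 1
  have hk : k < N := by
    have := Polynomial.natDegree_le_of_dvd ⟨r, hr⟩ hp0
    rw [Polynomial.natDegree_pow, Polynomial.natDegree_X_sub_C, mul_one] at this
    have h3 : p.natDegree < N := (Polynomial.natDegree_lt_iff_degree_lt hp0).2 hdeg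
    exact lt_of_le_of_lt this h3
  rw [Polynomial.dvd_iff_isRoot, Polynomial.IsRoot.def] at hnd
  have hfix : U (((U - 1) ^ (N - 1)) v) = (1 : K) • ((U - 1) ^ (N - 1)) v := by
    have : ((U - 1) ^ N) v = 0 := by rw [h2]; rfl
    rw [← Nat.sub_add_cancel hN, pow_succ', Module.End.mul_apply, LinearMap.sub_apply,
      sub_eq_zero] at this
    simpa using this
  have heig : Module.End.HasEigenvector U 1 (((U - 1) ^ (N - 1)) v) :=
    Module.End.hasEigenvector_iff.2 ⟨Module.End.mem_eigenspace_iff.2 hfix, h1⟩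
  have h4 : Polynomial.aeval U ((Polynomial.X - Polynomial.C 1) ^ (N - 1 - k) * p) v = 0 := by
    rw [map_mul, Module.End.mul_apply, hp, map_zero]
  rw [hr, ← mul_assoc, ← pow_add, Nat.sub_add_cancel (by omega), mul_comm, map_mul,
    Module.End.mul_apply] at h4
  have h5 : Polynomial.aeval U ((Polynomial.X - Polynomial.C (1 : K)) ^ (N - 1))
    = (U - 1) ^ (N - 1) := by simp
  rw [h5, Module.End.aeval_apply_of_hasEigenvector heig] at h4
  exact (smul_ne_zero hnd h1) h4

theorem form_inv_pow {K V : Type*} [Field K] [AddCommGroup V] [Module K V]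
    (U : Module.End K V) (b : V →ₗ[K] V →ₗ[K] K) (hinv : ∀ v w, b (U v) (U w) = b v w)
    (r : ℕ) : ∀ v w, b ((U ^ r) v) ((U ^ r) w) = b v w := by
  induction r with
  | zero => intro v w; simp
  | succ r ih => intro v w; rw [pow_succ, Module.End.mul_apply, Module.End.mul_apply, ih, hinv]

theorem dual_shift {K V : Type*} [Field K] [AddCommGroup V] [Module K V]
    (U : Module.End K V) (b : V →ₗ[K] V →ₗ[K] K) (hinv : ∀ v w, b (U v) (U w) = b v w)
    (q M : ℕ) (v y : V) (hrec : ((U ^ q - 1) ^ M) v = 0) (i : ℕ)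
    (hy : ∀ k < q * M, b ((U ^ k) v) y = if k = q * i then 1 else 0) :
    ∀ r < q, ∀ k < q * M, b ((U ^ k) v) ((U ^ r) y) = if k = q * i + r then 1 else 0 := by
  intro r hr k hk
  have hge : ∀ l, r ≤ l → l < q * M + r → b ((U ^ l) v) ((U ^ r) y) =
      if l = q * i + r then 1 else 0 := by
    intro l hl hl'
    obtain ⟨j, rfl⟩ := Nat.exists_eq_add_of_le hl
    rw [pow_add, Module.End.mul_apply, form_inv_pow U b hinv, hy j (by omega)]
    congr 1
    apply propext; constructor <;> intro h <;> omega
  rcases le_or_gt r k with h | h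
  · exact hge k h (by omega)
  rw [if_neg (by omega)]
  have h0 : ((U ^ q - 1) ^ M) ((U ^ k) v) = 0 := by
    have hc : Commute ((U ^ q - 1) ^ M) (U ^ k) :=
      (((Commute.refl U).pow_left q).sub_left (Commute.one_left U)).pow_pow M k
    rw [← Module.End.mul_apply, hc.eq, Module.End.mul_apply, hrec, map_zero]
  rw [sub_eq_add_neg, ((Commute.one_right (U ^ q)).neg_right).add_pow, LinearMap.sum_apply] at h0
  have h1 := congrArg (fun z => b z ((U ^ r) y)) h0
  simp only [map_sum, LinearMap.sum_apply, map_zero, LinearMap.zero_apply] at h1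
  rw [Finset.sum_eq_single 0] at h1
  · rcases neg_one_pow_eq_or (Module.End K V) M with h' | h' <;> simpa [h'] using h1
  · intro j hj hj0
    have hjM : j ≤ M := by simpa [Nat.lt_succ_iff] using hj
    have e : ((U ^ q) ^ j) ((U ^ k) v) = (U ^ (q * j + k)) v := by
      rw [← pow_mul, pow_add]; rfl
    have e2 : b ((U ^ (q * j + k)) v) ((U ^ r) y) = 0 := by
      have hqj : q ≤ q * j := Nat.le_mul_of_pos_right q (Nat.pos_of_ne_zero hj0)
      have hqM : q * j ≤ q * M := Nat.mul_le_mul_left q hjM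
      rw [hge _ (by omega) (by omega), if_neg]
      intro h3
      have h4 : q * j + k < q * j + r := by omega
      have h5 : q * i < q * j := by omega
      have h6 : i < j := lt_of_mul_lt_mul_left' h5
      have h7 : q * (i + 1) ≤ q * j := Nat.mul_le_mul_left q h6
      rw [mul_add] at h7
      omega
    have hcast : ((M.choose j : ℕ) : Module.End K V) ((U ^ k) v) = (M.choose j) • ((U ^ k) v) := by
      rw [← nsmul_one]; rfl
    rcases neg_one_pow_eq_or (Module.End K V) (M - j) with h' | h' <;>
      simp [h', Module.End.mul_apply, hcast, map_nsmul, e, e2]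
  · intro h; simp at h

theorem idx_lt (q m r : ℕ) (hr : r < q) (i : Fin m) : r + q * (i : ℕ) < q * m := by
  have h : q * ((i : ℕ) + 1) ≤ q * m := Nat.mul_le_mul_left q i.2
  rw [mul_add] at h
  omega

theorem idx_eq (q m r s : ℕ) (hr : r < q) (hs : s < q) (i j : Fin m) :
    r + q * (i : ℕ) = q * (j : ℕ) + s ↔ r = s ∧ i = j := by
  constructor
  · intro h
    have h1 := congrArg (· % q) h
    simp only [Nat.add_mul_mod_self_left, Nat.mul_add_mod_self_left, Nat.mod_eq_of_lt hr,
      Nat.mod_eq_of_lt hs] at h1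
    subst h1
    refine ⟨rfl, Fin.ext (Nat.eq_of_mul_eq_mul_left (by omega : 0 < q) (by omega))⟩
  · rintro ⟨rfl, rfl⟩; omega

theorem paired_case {K V : Type*} [Field K] [CharP K 2] [AddCommGroup V] [Module K V]
    (n m α : ℕ) (hnm : n = 2 ^ α * m)
    (U : Module.End K V)
    (b : V →ₗ[K] V →ₗ[K] K) 
    (hinv : ∀ v w, b (U v) (U w) = b v w)
    (hU : ∀ β : ℕ, (U - 1) ^ (2 ^ β) = U ^ (2 ^ β) - 1)
    (w : (Fin n → K) ≃ₗ[K] (Fin n → K))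
    (hw : ((w : (Fin n → K) →ₗ[K] (Fin n → K)) - 1) ^ (n - 1) ≠ 0)
    (hun : ∃ N : ℕ, ((w : (Fin n → K) →ₗ[K] (Fin n → K)) - 1) ^ N = 0)
    (φ : V ≃ₗ[K] (Fin n → K) × Module.Dual K (Fin n → K))
    (hφ1 : ∀ z, φ (U z) = (w (φ z).1, w.symm.dualMap (φ z).2))
    (hφ2 : ∀ z z', b z z' = (φ z).2 (φ z').1 + (φ z').2 (φ z).1) :
    ∃ x y : Fin m → V,
    (∀ r < 2 ^ α, ∀ s < 2 ^ α, ∀ i j, b ((U ^ r) (x i)) ((U ^ s) (x j)) = 0) ∧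
    (∀ r < 2 ^ α, ∀ s < 2 ^ α, ∀ i j, b ((U ^ r) (y i)) ((U ^ s) (y j)) = 0) ∧
    (∀ r < 2 ^ α, ∀ s < 2 ^ α, ∀ i j, b ((U ^ r) (x i)) ((U ^ s) (y j)) =
      if r = s ∧ i = j then 1 else 0) := by
  set W : Module.End K (Fin n → K) := (w : (Fin n → K) →ₗ[K] (Fin n → K)) with hW
  have hWn : (W - 1) ^ n = 0 := by
    have := nilp_pow_finrank (W - 1) hun
    simpa using this
  obtain ⟨v0, hv0⟩ : ∃ v0, ((W - 1) ^ (n - 1)) v0 ≠ 0 := by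
    by_contra! h
    exact hw (LinearMap.ext h)
  have hli := cyclic_li W n v0 hv0 hWn
  rcases Nat.eq_zero_or_pos n with hn0 | hnpos
  · have hm0 : m = 0 := by
      rcases Nat.mul_eq_zero.1 (hnm.symm.trans hn0) with h | h
      · exact absurd h (by positivity)
      · exact h
    subst hm0
    exact ⟨fun _ => 0, fun _ => 0, fun _ _ _ _ i => i.elim0, fun _ _ _ _ i => i.elim0,
      fun _ _ _ _ i => i.elim0⟩
  have : Nonempty (Fin n) := ⟨⟨0, hnpos⟩⟩
  let bs := basisOfLinearIndependentOfCardEqFinrank hli (by simp)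
  have hbs : ∀ k : Fin n, bs k = (W ^ (k : ℕ)) v0 := fun k => by simp [bs]
  let v : V := φ.symm (v0, 0)
  have hUv : ∀ k z, (φ z).2 = 0 → φ ((U ^ k) z) = ((W ^ k) (φ z).1, 0) := by
    intro k
    induction k with
    | zero => intro z hz; simp [Prod.ext_iff, hz]
    | succ k ih =>
      intro z hz
      rw [pow_succ', Module.End.mul_apply, hφ1, ih z hz, pow_succ']
      simp [hW]
  have hXv : ∀ (k : ℕ) (z : V), (φ z).2 = 0 →
      φ (((U - 1) ^ k : Module.End K V) z) = (((W - 1) ^ k : Module.End K (Fin n → K)) (φ z).1, 0) := by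
    intro k
    induction k with
    | zero => intro z hz; simp [Prod.ext_iff, hz]
    | succ k ih =>
      intro z hz
      rw [pow_succ', Module.End.mul_apply, LinearMap.sub_apply, map_sub, hφ1, Module.End.one_apply,
        ih z hz, pow_succ']
      simp [hW]
  have hUy : ∀ k z, (φ z).1 = 0 → (φ ((U ^ k) z)).1 = 0 := by
    intro k
    induction k with
    | zero => intro z hz; simpa using hz
    | succ k ih =>
      intro z hz
      rw [pow_succ', Module.End.mul_apply, hφ1]
      simp [ih z hz]
  have hv2 : (φ v).2 = 0 := by simp [v]
  have hv1 : (φ v).1 = v0 := by simp [v]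
  have hrec : ((U ^ (2 ^ α) - 1) ^ m : Module.End K V) v = 0 := by
    rw [← hU, ← pow_mul, ← hnm]
    apply φ.injective
    rw [hXv n v hv2, hWn]; simp
  have hidx : ∀ i : Fin m, 2 ^ α * (i : ℕ) < n := fun i => by
    rw [hnm]; exact Nat.mul_lt_mul_of_pos_left i.2 (by positivity)
  let y : Fin m → V := fun i => φ.symm (0, bs.coord ⟨2 ^ α * (i : ℕ), hidx i⟩)
  have hy1 : ∀ i, (φ (y i)).1 = 0 := fun i => by simp [y]
  have hyv : ∀ i : Fin m, ∀ k < 2 ^ α * m, b ((U ^ k) v) (y i) =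
      if k = 2 ^ α * (i : ℕ) then 1 else 0 := by
    intro i k hk
    rw [hφ2, hUv k v hv2, hv1]
    simp only [y, LinearEquiv.apply_symm_apply, LinearMap.zero_apply, zero_add]
    rw [← hbs ⟨k, by omega⟩]
    simp [Finsupp.single_apply]
  have hsh := fun i : Fin m => dual_shift U b hinv (2 ^ α) m v (y i) hrec i (hyv i)
  refine ⟨fun i => (U ^ (2 ^ α * (i : ℕ))) v, y, ?_, ?_, ?_⟩
  · intro r _ s _ i j
    rw [← Module.End.mul_apply, ← Module.End.mul_apply, ← pow_add, ← pow_add, hφ2, hUv _ v hv2,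
      hUv _ v hv2]
    simp
  · intro r _ s _ i j
    rw [hφ2, hUy _ _ (hy1 i), hUy _ _ (hy1 j)]; simp
  · intro r hr s hs i j
    rw [← Module.End.mul_apply, ← pow_add, hsh j s hs _ (idx_lt _ m r hr i)]
    exact if_congr (idx_eq _ m r s hr hs i j) rfl rfl

/-- Improving a vector so that the first values of the form vanish. -/
theorem good_vector {K V : Type*} [Field K] [IsAlgClosed K] [CharP K 2] [AddCommGroup V]
    [Module K V] [FiniteDimensional K V] (n : ℕ) (hn : 1 ≤ n) (hdim : finrank K V = 2 * n)
    (u : V ≃ₗ[K] V)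
    (b : V →ₗ[K] V →ₗ[K] K) (halt : ∀ v, b v v = 0)
    (hnd : ∀ v, (∀ w, b v w = 0) → v = 0)
    (hinv : ∀ v w, b (u v) (u w) = b v w)
    (U : Module.End K V) (hUu : U = (u : V →ₗ[K] V))
    (hnil : (U - 1) ^ (2 * n) = 0) (hne : (U - 1) ^ (2 * n - 1) ≠ 0) :
    ∃ v, ((U - 1) ^ (2 * n - 1)) v ≠ 0 ∧ ∀ k < n, b v ((U ^ k) v) = 0 := by
  have hUapp : ∀ z, U z = u z := fun z => by rw [hUu]; rfl
  have hbsymm : ∀ v w, b v w = b w v := fun v w => by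
    have h := halt (v + w)
    simp only [map_add, LinearMap.add_apply, halt, zero_add, add_zero] at h
    rw [eq_neg_of_add_eq_zero_right h, CharTwo.neg_eq]
  have hinvU : ∀ v w, b (U v) (U w) = b v w := fun v w => by rw [hUapp, hUapp, hinv]
  let T : Module.End K V := (u.symm : V →ₗ[K] V)
  have hUT : U * T = 1 := by
    ext z; simp [T, Module.End.mul_apply, hUapp]
  have hTU : T * U = 1 := by
    ext z; simp [T, Module.End.mul_apply, hUapp]
  have hcTU : Commute T U := by rw [Commute, SemiconjBy, hTU, hUT]
  let S : Module.End K V := U + T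
  have hcS : Commute S U := (Commute.refl U).add_left hcTU
  have hTadj : ∀ v w, b (T v) w = b v (U w) := fun v w => by
    rw [← hinvU (T v), ← Module.End.mul_apply, hUT]; rfl
  have hSadj : ∀ v w, b (S v) w = b v (S w) := fun v w => by
    simp only [S, LinearMap.add_apply, map_add, hTadj]
    rw [hbsymm v (T w), hTadj, hbsymm w (U v), add_comm]
  have hSkadj : ∀ (k : ℕ) (v w : V), b ((S ^ k) v) w = b v ((S ^ k) w) := by
    intro k
    induction k with
    | zero => intro v w; simp
    | succ k ih =>
      intro v w
      rw [pow_succ, Module.End.mul_apply, ih, hSadj, ← Module.End.mul_apply, ← pow_succ', pow_succ]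
  have hSk0 : ∀ (k : ℕ) (v : V), b v ((S ^ k) v) = 0 := by
    intro k v
    rcases Nat.even_or_odd' k with ⟨j, rfl | rfl⟩
    · rw [two_mul, pow_add, Module.End.mul_apply, ← hSkadj, halt]
    · have : S ^ (2 * j + 1) = S ^ j * (S * S ^ j) := by
        rw [← pow_succ', ← pow_add]; congr 1; ring
      rw [this, Module.End.mul_apply, ← hSkadj, Module.End.mul_apply]
      set z := (S ^ j) v
      simp only [S, LinearMap.add_apply, map_add]
      rw [hbsymm z (T z), hTadj]
      exact CharTwo.add_self_eq_zero _
  have hU2 : U * U = U * S - 1 := by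
    simp only [S]; rw [mul_add, hUT]; abel
  -- S and U - 1
  have hUS : U * S = (U - 1) ^ 2 := by
    have h2 : (U - 1) ^ 2 = U * U - (2 : K) • U + 1 := by
      rw [two_smul]; noncomm_ring
    have h20 : (2 : K) = 0 := CharTwo.two_eq_zero
    rw [h2, h20, zero_smul, sub_zero]
    simp only [S]; rw [mul_add, hUT]
  have hST : S = T * (U - 1) ^ 2 := by
    rw [← hUS, ← mul_assoc, hTU, one_mul]
  have hcT1 : Commute T (U - 1) := hcTU.sub_right (Commute.one_right T)
  have hSpow : ∀ k : ℕ, S ^ k = T ^ k * (U - 1) ^ (2 * k) := fun k => by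
    rw [hST, (hcT1.pow_right 2).mul_pow, pow_mul]
  have hSn : S ^ n = 0 := by rw [hSpow, hnil, mul_zero]
  have hSbig : ∀ k, n ≤ k → S ^ k = 0 := fun k hk => pow_eq_zero_of_le hk hSn
  -- fixed vectors
  have hcU1 : Commute U (U - 1) := (Commute.refl U).sub_right (Commute.one_right U)
  have hfix : ∀ v, U (((U - 1) ^ (2 * n - 1)) v) = ((U - 1) ^ (2 * n - 1)) v := by
    intro v
    have h : ((U - 1) ^ (2 * n)) v = 0 := by rw [hnil]; rfl
    rw [show 2 * n = (2 * n - 1) + 1 by omega, pow_succ', Module.End.mul_apply,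
      LinearMap.sub_apply, sub_eq_zero] at h
    simpa using h
  have hfixk : ∀ (k : ℕ) v, (U ^ k) (((U - 1) ^ (2 * n - 1)) v) = ((U - 1) ^ (2 * n - 1)) v := by
    intro k
    induction k with
    | zero => intro v; simp
    | succ k ih => intro v; rw [pow_succ, Module.End.mul_apply, hfix, ih]
  have hTfixk : ∀ (k : ℕ) v, (T ^ k) (((U - 1) ^ (2 * n - 1)) v) = ((U - 1) ^ (2 * n - 1)) v := by
    intro k v
    conv_lhs => rw [← hfixk k v]
    rw [← Module.End.mul_apply, ← hcTU.mul_pow, hTU, one_pow]; rfl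
  have hmu : ∀ v, b v (U ((S ^ (n - 1)) v)) = b v (((U - 1) ^ (2 * n - 1)) v) := by
    intro v
    have h1 : U ((S ^ (n - 1)) v) = (S ^ (n - 1)) v + ((U - 1) * S ^ (n - 1)) v := by
      rw [Module.End.mul_apply, LinearMap.sub_apply, Module.End.one_apply]; abel
    have h2 : (U - 1) * S ^ (n - 1) = T ^ (n - 1) * (U - 1) ^ (2 * n - 1) := by
      rw [hSpow, ← mul_assoc, ← (hcT1.pow_left (n - 1)).eq, mul_assoc, ← pow_succ']
      congr 2; omega
    rw [h1, map_add, hSk0, zero_add, h2, Module.End.mul_apply, hTfixk]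
  -- initial vector
  obtain ⟨v0, hv0⟩ : ∃ v0, ((U - 1) ^ (2 * n - 1)) v0 ≠ 0 := by
    by_contra! h
    exact hne (LinearMap.ext h)
  have hli := cyclic_li U (2 * n) v0 hv0 hnil
  have hspan := hli.span_eq_top_of_card_eq_finrank' (by rw [hdim]; simp)
  have hb0 : b v0 (((U - 1) ^ (2 * n - 1)) v0) ≠ 0 := by
    intro h0
    apply hv0
    apply hnd
    intro w
    have hw : w ∈ Submodule.span K (Set.range fun k : Fin (2 * n) => (U ^ (k : ℕ)) v0) := by
      rw [hspan]; trivial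
    induction hw using Submodule.span_induction with
    | mem x hx =>
      obtain ⟨k, rfl⟩ := hx
      simp only
      rw [← hfixk k v0, form_inv_pow U b hinvU, hbsymm, h0]
    | zero => simp
    | add x y _ _ hx hy => rw [map_add, hx, hy, add_zero]
    | smul a x _ hx => rw [map_smul, hx, smul_zero]
  -- the modification formula
  have hmod : ∀ (c : K) (i j : ℕ) (v : V),
      b (v + c • (S ^ j) (U v)) (U ((S ^ i) (v + c • (S ^ j) (U v)))) =
        b v (U ((S ^ i) v)) + c * b v (U ((S ^ (i + j + 1)) v))
          + c ^ 2 * b v (U ((S ^ (i + 2 * j)) v)) := by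
    intro c i j v
    have hSU : ∀ (k : ℕ) z, (S ^ k) (U z) = U ((S ^ k) z) := fun k z => by
      rw [← Module.End.mul_apply, (hcS.pow_left k).eq]; rfl
    have hSS : ∀ (k l : ℕ) z, (S ^ k) ((S ^ l) z) = (S ^ (k + l)) z := fun k l z => by
      rw [pow_add]; rfl
    simp only [map_add, map_smul, LinearMap.add_apply, LinearMap.smul_apply, smul_eq_mul, hSU, hSS,
      hinvU]
    have t2 : b v (U (U ((S ^ (i + j)) v))) = b v (U ((S ^ (i + j + 1)) v)) := by
      have : U (U ((S ^ (i + j)) v)) = U ((S ^ (i + j + 1)) v) - (S ^ (i + j)) v := by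
        rw [← Module.End.mul_apply, hU2, LinearMap.sub_apply, pow_succ']; rfl
      rw [this, map_sub, hSk0, sub_zero]
    have t3 : b ((S ^ j) v) ((S ^ i) v) = 0 := by rw [hSkadj, hSS, hSk0]
    have t4 : b ((S ^ j) v) (U ((S ^ (i + j)) v)) = b v (U ((S ^ (i + 2 * j)) v)) := by
      rw [hSkadj, hSU, hSS]; congr 4; ring
    rw [t2, t3, t4]; ring
  have hzero : ∀ (k : ℕ) v, n ≤ k → b v (U ((S ^ k) v)) = 0 := fun k v hk => by
    rw [hSbig k hk]; simp
  have main : ∀ d : ℕ, d ≤ n - 1 → ∃ v, b v (U ((S ^ (n - 1)) v)) ≠ 0 ∧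
      ∀ i, i < n - 1 → n - 1 ≤ i + d → b v (U ((S ^ i) v)) = 0 := by
    intro d
    induction d with
    | zero =>
      intro _
      exact ⟨v0, by rwa [hmu], fun i h1 h2 => by omega⟩
    | succ d ih =>
      intro hd
      obtain ⟨v, hv, hvi⟩ := ih (by omega)
      set A := b v (U ((S ^ (n - 1 - (d + 1))) v)) with hA
      set B := b v (U ((S ^ (n - 1)) v)) with hBdef
      set C := b v (U ((S ^ (n - 1 - (d + 1) + 2 * d)) v)) with hC
      obtain ⟨c, hc⟩ : ∃ c : K, A + c * B + c ^ 2 * C = 0 := by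
        by_cases hC0 : C = 0
        · refine ⟨- A / B, ?_⟩
          rw [hC0]; field_simp; ring
        · have hdeg : (Polynomial.C C * Polynomial.X ^ 2 + Polynomial.C B * Polynomial.X
              + Polynomial.C A).degree = 2 := Polynomial.degree_quadratic hC0
          obtain ⟨c, hc⟩ := IsAlgClosed.exists_root _ (by rw [hdeg]; decide)
          refine ⟨c, ?_⟩
          simp only [Polynomial.IsRoot.def, Polynomial.eval_add, Polynomial.eval_mul,
            Polynomial.eval_C, Polynomial.eval_pow, Polynomial.eval_X] at hc
          linear_combination hc
      refine ⟨v + c • (S ^ d) (U v), ?_, ?_⟩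
      · rw [hmod, hzero (n - 1 + d + 1) v (by omega), mul_zero, add_zero]
        rcases Nat.eq_zero_or_pos d with h0 | hpos
        · subst h0
          simp only [mul_zero, add_zero] at hC ⊢
          have hCA : C = A := by rw [hC, hA]
          have : b v (U ((S ^ (n - 1)) v)) + c ^ 2 * b v (U ((S ^ (n - 1)) v)) = (1 + c) ^ 2 * B := by
            have h20 : (2 : K) = 0 := CharTwo.two_eq_zero
            rw [← hBdef]; linear_combination (-(c * B)) * h20
          rw [this]
          refine mul_ne_zero (pow_ne_zero 2 ?_) hv
          intro h1
          have hc1 : c = 1 := by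
            rw [← CharTwo.neg_eq (1 : K)]; exact eq_neg_of_add_eq_zero_right h1
          rw [hCA, hc1] at hc
          apply hv
          have h20 : (2 : K) = 0 := CharTwo.two_eq_zero
          linear_combination hc - A * h20
        · rw [hzero (n - 1 + 2 * d) v (by omega), mul_zero, add_zero]; exact hv
      · intro i hi1 hi2
        rw [hmod]
        rcases Nat.lt_or_ge (i + d) (n - 1) with h | h
        · have hi : i = n - 1 - (d + 1) := by omega
          have hi' : n - 1 - (d + 1) + d + 1 = n - 1 := by omega
          rw [hi, hi']
          exact hc
        · rw [hvi i hi1 h, hzero (i + d + 1) v (by omega), hzero (i + 2 * d) v (by omega)]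
          simp
  obtain ⟨v, hv, hvi⟩ := main (n - 1) le_rfl
  refine ⟨v, ?_, ?_⟩
  · intro h; rw [hmu, h, map_zero] at hv; exact hv rfl
  · have hall : ∀ j : ℕ, (∀ i, i + j ≤ n - 1 → b v ((U ^ j * S ^ i) v) = 0) ∧
        (∀ i, i + (j + 1) ≤ n - 1 → b v ((U ^ (j + 1) * S ^ i) v) = 0) := by
      intro j
      induction j with
      | zero =>
        refine ⟨fun i _ => by simpa using hSk0 i v, fun i hi => ?_⟩
        simpa using hvi i (by omega) (by omega)
      | succ j ih =>
        refine ⟨ih.2, fun i hi => ?_⟩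
        have : U ^ (j + 1 + 1) * S ^ i = U ^ (j + 1) * S ^ (i + 1) - U ^ j * S ^ i := by
          have h1 : U ^ (j + 1 + 1) = U ^ j * (U * U) := by rw [pow_succ, pow_succ, mul_assoc]
          rw [h1, hU2, mul_sub, sub_mul, mul_one, pow_succ U j, pow_succ' S i]
          simp only [mul_assoc]
        rw [this, LinearMap.sub_apply, map_sub, ih.2 (i + 1) (by omega), ih.1 i (by omega), sub_zero]
    intro k hk
    simpa using (hall k).1 0 (by omega)

theorem single_case {K V : Type*} [Field K] [IsAlgClosed K] [CharP K 2] [AddCommGroup V]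
    [Module K V] [FiniteDimensional K V] (n m α : ℕ) (hn : 1 ≤ n) (hnm : n = 2 ^ α * m)
    (hdim : finrank K V = 2 * n)
    (u : V ≃ₗ[K] V)
    (b : V →ₗ[K] V →ₗ[K] K) (halt : ∀ v, b v v = 0)
    (hnd : ∀ v, (∀ w, b v w = 0) → v = 0)
    (hinv : ∀ v w, b (u v) (u w) = b v w)
    (U : Module.End K V) (hUu : U = (u : V →ₗ[K] V))
    (hU : ∀ β : ℕ, (U - 1) ^ (2 ^ β) = U ^ (2 ^ β) - 1)
    (hnil : (U - 1) ^ (2 * n) = 0) (hne : (U - 1) ^ (2 * n - 1) ≠ 0) :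
    ∃ x y : Fin m → V,
    (∀ r < 2 ^ α, ∀ s < 2 ^ α, ∀ i j, b ((U ^ r) (x i)) ((U ^ s) (x j)) = 0) ∧
    (∀ r < 2 ^ α, ∀ s < 2 ^ α, ∀ i j, b ((U ^ r) (y i)) ((U ^ s) (y j)) = 0) ∧
    (∀ r < 2 ^ α, ∀ s < 2 ^ α, ∀ i j, b ((U ^ r) (x i)) ((U ^ s) (y j)) =
      if r = s ∧ i = j then 1 else 0) := by
  obtain ⟨v, hv, hv0⟩ := good_vector n hn hdim u b halt hnd hinv U hUu hnil hne
  have hUapp : ∀ z, U z = u z := fun z => by rw [hUu]; rfl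
  have hbsymm : ∀ v w, b v w = b w v := fun v w => by
    have h := halt (v + w)
    simp only [map_add, LinearMap.add_apply, halt, zero_add, add_zero] at h
    rw [eq_neg_of_add_eq_zero_right h, CharTwo.neg_eq]
  have hinvU : ∀ v w, b (U v) (U w) = b v w := fun v w => by rw [hUapp, hUapp, hinv]
  have hli := cyclic_li U (2 * n) v hv hnil
  have : Nonempty (Fin (2 * n)) := ⟨⟨0, by omega⟩⟩
  let bs := basisOfLinearIndependentOfCardEqFinrank hli (by simp [hdim])
  have hbs : ∀ k : Fin (2 * n), bs k = (U ^ (k : ℕ)) v := fun k => by simp [bs]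
  -- orthogonality of close powers
  have hclose' : ∀ k l d : ℕ, l = k + d → d < n → b ((U ^ k) v) ((U ^ l) v) = 0 := by
    rintro k l d rfl hd
    rw [pow_add, Module.End.mul_apply, form_inv_pow U b hinvU, hv0 d hd]
  have hclose : ∀ k l : ℕ, k < l + n → l < k + n → b ((U ^ k) v) ((U ^ l) v) = 0 := by
    intro k l h1 h2
    rcases le_total k l with h | h
    · exact hclose' k l (l - k) (by omega) (by omega)
    · rw [hbsymm]; exact hclose' l k (k - l) (by omega) (by omega)
  have hsurj : Function.Surjective b := by
    have hinj : Function.Injective b := by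
      rw [injective_iff_map_eq_zero]
      intro z hz
      exact hnd z fun w => by rw [hz]; rfl
    exact (LinearMap.injective_iff_surjective_of_finrank_eq_finrank
      (Subspace.dual_finrank_eq).symm).1 hinj
  have hidx : ∀ i : Fin m, 2 ^ α * (i : ℕ) < n := fun i => by
    rw [hnm]; exact Nat.mul_lt_mul_of_pos_left i.2 (by positivity)
  choose y hy using fun i : Fin m => hsurj (bs.coord ⟨2 ^ α * (i : ℕ), by have := hidx i; omega⟩)
  have h2n : 2 * n = 2 ^ α * (2 * m) := by rw [hnm]; ring
  have hrec : ((U ^ (2 ^ α) - 1) ^ (2 * m) : Module.End K V) v = 0 := by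
    rw [← hU, ← pow_mul, ← h2n, hnil]; rfl
  have hyv : ∀ i : Fin m, ∀ k < 2 ^ α * (2 * m), b ((U ^ k) v) (y i) =
      if k = 2 ^ α * (i : ℕ) then 1 else 0 := by
    intro i k hk
    rw [hbsymm, hy, ← hbs ⟨k, by omega⟩]
    simp [Finsupp.single_apply]
  have hsh := fun i : Fin m => dual_shift U b hinvU (2 ^ α) (2 * m) v (y i) hrec i (hyv i)
  -- triangularity: vectors orthogonal to the upper half are in the upper half
  have hperp : ∀ z z', (∀ k, n ≤ k → k < 2 * n → b ((U ^ k) v) z = 0) →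
      (∀ k, n ≤ k → k < 2 * n → b ((U ^ k) v) z' = 0) → b z z' = 0 := by
    let B : LinearMap.BilinForm K V := b
    have hBnd : B.Nondegenerate := by
      exact ⟨fun z hz => hnd z hz, fun z hz => hnd z fun w => by rw [hbsymm]; exact hz w⟩
    let L : Submodule K V := Submodule.span K (Set.range fun k : Fin n => (U ^ (n + (k : ℕ))) v)
    have hLfin : finrank K L = n := by
      have := finrank_span_eq_card (R := K) (b := fun k : Fin n => (U ^ (n + (k : ℕ))) v)
        (hli.comp (fun k : Fin n => (⟨n + k, by omega⟩ : Fin (2 * n)))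
          (fun a c h => by simpa [Fin.ext_iff] using h))
      simpa using this
    have hmemL : ∀ z, (∀ k, n ≤ k → k < 2 * n → b ((U ^ k) v) z = 0) → z ∈ B.orthogonal L := by
      intro z hz
      rw [LinearMap.BilinForm.mem_orthogonal_iff]
      intro w hw
      change b w z = 0
      induction hw using Submodule.span_induction with
      | mem x hx =>
        obtain ⟨k, rfl⟩ := hx
        exact hz _ (by omega) (by omega)
      | zero => simp
      | add x y _ _ hx hy => rw [map_add, LinearMap.add_apply, hx, hy, add_zero]
      | smul a x _ hx => rw [map_smul, LinearMap.smul_apply, hx, smul_zero]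
    have hLL : L ≤ B.orthogonal L := by
      rw [Submodule.span_le]
      rintro _ ⟨k, rfl⟩
      apply hmemL
      intro l _ _
      exact hclose _ _ (by omega) (by omega)
    have hfo : finrank K (B.orthogonal L) = n := by
      rw [LinearMap.BilinForm.finrank_orthogonal hBnd, hLfin, hdim]
      omega
    have heq : L = B.orthogonal L := Submodule.eq_of_le_of_finrank_eq hLL (by rw [hLfin, hfo])
    intro z z' hz hz'
    have h1 : z ∈ L := by rw [heq]; exact hmemL z hz
    have h2 := hmemL z' hz'
    rw [LinearMap.BilinForm.mem_orthogonal_iff] at h2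
    exact h2 z h1
  have hlt : ∀ r < 2 ^ α, ∀ i : Fin m, r + 2 ^ α * (i : ℕ) < n := fun r hr i => by
    rw [hnm]; exact idx_lt _ m r hr i
  refine ⟨fun i => (U ^ (2 ^ α * (i : ℕ))) v, y, ?_, ?_, ?_⟩
  · intro r hr s hs i j
    rw [← Module.End.mul_apply, ← Module.End.mul_apply, ← pow_add, ← pow_add]
    have h1 := hlt r hr i
    have h2 := hlt s hs j
    exact hclose _ _ (by omega) (by omega)
  · intro r hr s hs i j
    have h1 := hlt r hr i
    have h2 := hlt s hs j
    apply hperp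
    · intro k hk1 hk2
      rw [hsh i r hr k (by omega), if_neg (by omega)]
    · intro k hk1 hk2
      rw [hsh j s hs k (by omega), if_neg (by omega)]
  · intro r hr s hs i j
    have h1 := hlt r hr i
    rw [← Module.End.mul_apply, ← pow_add, hsh j s hs _ (by omega)]
    exact if_congr (idx_eq _ m r s hr hs i j) rfl rfl

/-- key lemma for Theorem C: if `(V,b)` is `V(2n)` or `W(n)` and `2^α ∣ n`,
then on `∧²V` (with `X = ∧²u - 1`): (i) some `δ` satisfies `X^{2^α-1}δ = β_V` and
`φ_V(δ) = n/2^α`; (ii) `Ker X^{2^α-1} ⊆ Ker φ_V`; (iii) if `α = ν₂(n)` then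
`Ker X^{2^α} ⊄ Ker φ_V`. -/
theorem hesselink_main_lemma
    (K : Type*) [Field K] [IsAlgClosed K] [CharP K 2]
    (V : Type*) [AddCommGroup V] [Module K V] [FiniteDimensional K V]
    (n : ℕ) (hn : 1 ≤ n) (hdim : Module.finrank K V = 2 * n)
    (u : V ≃ₗ[K] V) (huni : IsUnipotent K (u : V →ₗ[K] V))
    (hord : ∃ k : ℕ, u ^ (2 ^ k) = 1)
    (b : V →ₗ[K] V →ₗ[K] K)
    (halt : ∀ v, b v v = 0)
    (hnd : ∀ v, (∀ w, b v w = 0) → v = 0)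
    (hinv : ∀ v w, b (u v) (u w) = b v w)
    -- (V,b) ≅ V(2n) (a single Jordan block) or (V,b) ≅ W(n) (the paired module on a single
    -- unipotent Jordan block of size n)
    (hVb : ((u : V →ₗ[K] V) - 1) ^ (2 * n - 1) ≠ 0 ∨
      ∃ w : (Fin n → K) ≃ₗ[K] (Fin n → K),
        ((w : (Fin n → K) →ₗ[K] (Fin n → K)) - 1) ^ (n - 1) ≠ 0 ∧
        IsUnipotent K (w : (Fin n → K) →ₗ[K] (Fin n → K)) ∧
        (∃ k : ℕ, w ^ (2 ^ k) = 1) ∧ IsPairedIso u b w)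
    -- a model (E, wedge) of the exterior square ∧²V with the induced action uE of u
    (E : Type*) [AddCommGroup E] [Module K E]
    (wedge : V →ₗ[K] V →ₗ[K] E) (hE : IsExteriorSquare K wedge)
    (uE : E →ₗ[K] E) (huE : ∀ v w, uE (wedge v w) = wedge (u v) (u w))
    -- φ_V : ∧²V → K, v∧w ↦ b(v,w)
    (φ : E →ₗ[K] K) (hφ : ∀ v w, φ (wedge v w) = b v w)
    -- β_V = ∑ eᵢ ∧ e_{2n+1-i}, written in a symplectic basis
    (e : Basis (Fin n ⊕ Fin n) K V)
    (he₁ : ∀ i j, b (e (Sum.inl i)) (e (Sum.inl j)) = 0)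
    (he₂ : ∀ i j, b (e (Sum.inr i)) (e (Sum.inr j)) = 0)
    (he₃ : ∀ i j, b (e (Sum.inl i)) (e (Sum.inr j)) = if i = j then 1 else 0)
    (he₄ : ∀ i j, b (e (Sum.inr i)) (e (Sum.inl j)) = if i = j then 1 else 0)
    (βV : E) (hβV : βV = ∑ i : Fin n, wedge (e (Sum.inl i)) (e (Sum.inr i)))
    (α : ℕ) (hα : 2 ^ α ∣ n) :
    ∀ XE : Module.End K E, XE = uE - 1 →
      -- (i)
      (∃ δ : E, (XE ^ (2 ^ α - 1)) δ = βV ∧ φ δ = ((n / 2 ^ α : ℕ) : K)) ∧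
      -- (ii)
      (∀ x : E, (XE ^ (2 ^ α - 1)) x = 0 → φ x = 0) ∧
      -- (iii)
      (α = padicValNat 2 n → ∃ x : E, (XE ^ (2 ^ α)) x = 0 ∧ φ x ≠ 0) := by
  rintro XE hXE
  obtain ⟨m, hm⟩ := hα
  obtain ⟨hw, hsp, hf⟩ := hE
  have hU : ∀ β : ℕ, ((u : V →ₗ[K] V) - 1) ^ (2 ^ β) = (u : V →ₗ[K] V) ^ (2 ^ β) - 1 := fun β =>
    sub_one_pow_two_pow (K := K) (A := Module.End K V) β (u : V →ₗ[K] V)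
  have hnil : ((u : V →ₗ[K] V) - 1) ^ (2 * n) = 0 := by
    have := nilp_pow_finrank (K := K) ((u : V →ₗ[K] V) - 1) huni
    rwa [hdim] at this
  have hxy : ∃ x y : Fin m → V,
      (∀ r < 2 ^ α, ∀ s < 2 ^ α, ∀ i j, b (((u : V →ₗ[K] V) ^ r) (x i))
        (((u : V →ₗ[K] V) ^ s) (x j)) = 0) ∧
      (∀ r < 2 ^ α, ∀ s < 2 ^ α, ∀ i j, b (((u : V →ₗ[K] V) ^ r) (y i))
        (((u : V →ₗ[K] V) ^ s) (y j)) = 0) ∧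
      (∀ r < 2 ^ α, ∀ s < 2 ^ α, ∀ i j, b (((u : V →ₗ[K] V) ^ r) (x i))
        (((u : V →ₗ[K] V) ^ s) (y j)) = if r = s ∧ i = j then 1 else 0) := by
    rcases hVb with h | ⟨w, hw1, hw2, -, ψ, hψ1, hψ2⟩
    · exact single_case n m α hn hm hdim u b halt hnd hinv _ rfl hU hnil h
    · exact paired_case n m α hm _ b hinv hU w hw1 hw2 ψ hψ1 hψ2
  obtain ⟨x, y, h1, h2, h3⟩ := hxy
  exact final_step n m α hn hm hdim (u : V →ₗ[K] V) b halt hinv wedge hw hsp hf uE huE φ hφ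
    (fun i => e (Sum.inl i)) (fun i => e (Sum.inr i)) he₁ he₂ he₃ βV hβV x y h1 h2 h3 XE hXE
end
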